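/- For odd integers p, q ≥ 3, there exists a quasisymmetric homeomorphism from the standard 1/p-Sierpiński carpet S_p onto the standard 1/q-Sierpiński carpet S_q if and only if p = q. -/

import Mathlib

open Set Metric

noncomputable section

/-- Level-`n` approximation `Q_n` of the standard `1/p`-Sierpiński carpet in `ℂ ≅ ℝ²`:
`Q_0` is the closed unit square, and `Q_{n+1}` is the union of the images of `Q_n` under
the `p² - 1` contractions `z ↦ (z + i + j·√-1)/p` with `(i,j)` ranging over all non-middle
positions; this is the usual subdivide-and-remove-middle-squares construction. -/
def carpetApprox (p : ℕ) : ℕ → Set ℂ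
  | 0 => {z : ℂ | z.re ∈ Set.Icc (0:ℝ) 1 ∧ z.im ∈ Set.Icc (0:ℝ) 1}
  | n + 1 =>
      ⋃ (i : ℕ) (j : ℕ) (_ : i < p) (_ : j < p)
        (_ : ¬(i = (p - 1) / 2 ∧ j = (p - 1) / 2)),
        (fun z : ℂ => (z + (i : ℂ) + (j : ℂ) * Complex.I) / (p : ℂ)) '' carpetApprox p n

/-- The standard `1/p`-Sierpiński carpet `S_p ⊆ ℝ² ≅ ℂ`. -/
def sierpinskiCarpet (p : ℕ) : Set ℂ := ⋂ n, carpetApprox p n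

/-- `η : [0,∞) → [0,∞)` is a (self-)homeomorphism of `[0,∞)`: it is continuous, strictly
increasing on `[0,∞)`, fixes `0` and maps `[0,∞)` onto `[0,∞)`. -/
def IsQSControl (η : ℝ → ℝ) : Prop :=
  ContinuousOn η (Set.Ici 0) ∧ StrictMonoOn η (Set.Ici 0) ∧ η 0 = 0 ∧
    Set.SurjOn η (Set.Ici 0) (Set.Ici 0)

/-- A map `f` between metric spaces is quasisymmetric: for some homeomorphism
`η : [0,∞) → [0,∞)` one has `d(f u, f v) ≤ η(d(u,v)/d(u,w)) · d(f u, f w)` for all `u,v,w`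
with `u ≠ w`. -/
def IsQSMap {X Y : Type*} [MetricSpace X] [MetricSpace Y] (f : X → Y) : Prop :=
  ∃ η : ℝ → ℝ, IsQSControl η ∧
    ∀ u v w : X, u ≠ w → dist (f u) (f v) ≤ η (dist u v / dist u w) * dist (f u) (f w)

/-- The boundary of the axis-parallel closed square with lower-left corner `c` and
side length `l`. -/
def squareBoundary (c : ℂ) (l : ℝ) : Set ℂ :=
  {z : ℂ | max |z.re - (c.re + l / 2)| |z.im - (c.im + l / 2)| = l / 2}

/-- The outer square `O = ∂([0,1]×[0,1])`. -/
def outerSquare : Set ℂ := squareBoundary 0 1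

/-- The middle square `M = ∂([(p-1)/(2p),(p+1)/(2p)]²)`. -/
def middleSquare (p : ℕ) : Set ℂ :=
  squareBoundary ((((p : ℝ) - 1) / (2 * p) : ℝ) * (1 + Complex.I)) (1 / p)

end

namespace Carpet

/-- A continuous function with constant exponential is constant on preconnected sets. -/
lemma eq_of_exp_eq {X : Type*} [TopologicalSpace X] {s : Set X} (hs : IsPreconnected s)
    {f : X → ℂ} (hf : ContinuousOn f s)
    (he : ∀ x ∈ s, ∀ y ∈ s, Complex.exp (f x) = Complex.exp (f y)) {x y : X}
    (hx : x ∈ s) (hy : y ∈ s) : f x = f y :=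
  Complex.isCoveringMap_exp.constOn_of_comp hs hf
    (fun a ha b hb => Subtype.ext (he a ha b hb)) hx hy

/-- Off an arc from `a` to `b`, the function `(z - a) / (z - b)` has a continuous logarithm. -/
lemma exists_log_off_path {a b : ℂ} (γ : Path a b) :
    ∃ L : ℂ → ℂ, ContinuousOn L (range γ)ᶜ ∧
      ∀ z ∉ range γ, Complex.exp (L z) = (z - a) / (z - b) := by
  have hb : b ∈ range γ := ⟨1, γ.target⟩
  have hne : ∀ z : ↥(range γ)ᶜ, ∀ t, (z : ℂ) - γ t ≠ 0 := fun z t h =>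
    z.2 ⟨t, (sub_eq_zero.1 h).symm⟩
  have hne' : ∀ z : ↥(range γ)ᶜ, (z : ℂ) - b ≠ 0 := fun z h =>
    z.2 (by rw [sub_eq_zero.1 h]; exact hb)
  let H : C(unitInterval × ↥(range γ)ᶜ, {z : ℂ // z ≠ 0}) :=
    { toFun := fun x => ⟨(x.2 - γ.symm x.1) / (x.2 - b), div_ne_zero (by
        rw [Path.symm_apply]; exact hne _ _) (hne' _)⟩
      continuous_toFun := by
        refine Continuous.subtype_mk (Continuous.div (by fun_prop) (by fun_prop)
          (fun x => hne' _)) _ }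
  have H0 : ∀ z, H (0, z) = (fun w : ℂ ↦ (⟨_, w.exp_ne_zero⟩ : {z : ℂ // z ≠ 0}))
      ((ContinuousMap.const _ (0:ℂ)) z) := by
    intro z
    refine Subtype.ext ?_
    simp [H, div_self (hne' z)]
  let K := Complex.isCoveringMap_exp.liftHomotopy H (ContinuousMap.const _ (0:ℂ)) H0
  have hK : ∀ z, Complex.exp (K (1, z)) = (z - a) / (z - b) := by
    intro z
    have := congr_fun (Complex.isCoveringMap_exp.liftHomotopy_lifts H
      (ContinuousMap.const _ (0:ℂ)) H0) (1, z)
    have h2 := congrArg Subtype.val this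
    simpa [H, K] using h2
  classical
  refine ⟨fun z => if h : z ∈ (range γ)ᶜ then K (1, ⟨z, h⟩) else 0, ?_, ?_⟩
  · rw [continuousOn_iff_continuous_domRestrict]
    have : (range γ)ᶜ.domRestrict (fun z => if h : z ∈ (range γ)ᶜ then K (1, ⟨z, h⟩) else 0)
        = fun z => K (1, z) := by
      funext z
      have hz := z.2
      simp only [domRestrict_apply, dif_pos hz]
    rw [this]
    fun_prop
  · intro z hz
    have hz' : z ∈ (range γ)ᶜ := hz
    simp only [dif_pos hz']
    exact hK ⟨z, hz'⟩

/-- There is no continuous logarithm of `(z - a) / (z - b)` on the twice punctured plane. -/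
lemma no_log_off_pair {a b : ℂ} (hab : a ≠ b) (L : ℂ → ℂ) (hL : ContinuousOn L {a, b}ᶜ)
    (he : ∀ z ∉ ({a, b} : Set ℂ), Complex.exp (L z) = (z - a) / (z - b)) : False := by
  have hab' : a - b ≠ 0 := sub_ne_zero.2 hab
  set w : ℝ → ℂ := fun θ => Complex.exp (θ * Complex.I) / 2 with hw
  have hwn : ∀ θ, ‖w θ‖ = 1 / 2 := by
    intro θ; simp [hw, Complex.norm_exp_ofReal_mul_I]
  have hw0 : ∀ θ, w θ ≠ 0 := by
    intro θ h
    have := hwn θ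
    rw [h] at this
    norm_num at this
  have hw1 : ∀ θ, 1 + w θ ∈ Complex.slitPlane := by
    intro θ
    refine Complex.mem_slitPlane_iff.2 (Or.inl ?_)
    have h1 := Complex.abs_re_le_norm (w θ)
    rw [hwn] at h1
    have := (abs_le.1 h1).1
    simp only [Complex.add_re, Complex.one_re]
    linarith
  set z : ℝ → ℂ := fun θ => a + (a - b) * w θ with hz
  have hzb : ∀ θ, z θ - b = (a - b) * (1 + w θ) := by intro θ; simp only [hz]; ring
  have hza : ∀ θ, z θ - a = (a - b) * w θ := by intro θ; simp only [hz]; ring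
  have hzm : ∀ θ, z θ ∉ ({a, b} : Set ℂ) := by
    rintro θ (h | h)
    · have := hza θ
      rw [h, sub_self] at this
      exact (mul_ne_zero hab' (hw0 θ)) this.symm
    · have := hzb θ
      rw [mem_singleton_iff.1 h, sub_self] at this
      exact (mul_ne_zero hab' (Complex.slitPlane_ne_zero (hw1 θ))) this.symm
  have hwc : Continuous w := by simp only [hw]; fun_prop
  have hzc : Continuous z := by simp only [hz]; fun_prop
  set M : ℝ → ℂ := fun θ => L (z θ) + Complex.log (1 + w θ) - θ * Complex.I with hM
  have hMc : Continuous M := by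
    refine Continuous.sub (Continuous.add ?_ ?_) (by fun_prop)
    · exact hL.comp_continuous hzc hzm
    · exact Continuous.clog (by fun_prop) hw1
  have hMe : ∀ θ, Complex.exp (M θ) = 1 / 2 := by
    intro θ
    have h1 := Complex.slitPlane_ne_zero (hw1 θ)
    have h2 := Complex.exp_ne_zero (θ * Complex.I)
    simp only [hM]
    rw [Complex.exp_sub, Complex.exp_add, he _ (hzm θ), Complex.exp_log h1, hza, hzb]
    field_simp
    simp only [hw]
    ring
  have hconst := eq_of_exp_eq (isPreconnected_univ) hMc.continuousOn
    (fun x _ y _ => (hMe x).trans (hMe y).symm) (mem_univ 0) (mem_univ (2 * Real.pi))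
  have hper : w (2 * Real.pi) = w 0 := by
    simp [hw, Complex.exp_two_pi_mul_I]
  simp only [hM, hz, hper] at hconst
  have : ((2 * Real.pi : ℝ) : ℂ) * Complex.I = 0 := by
    have h := hconst
    push_cast at h ⊢
    linear_combination h
  have h3 := congrArg Complex.im this
  simp at h3

/-- Two arcs with common distinct endpoints, otherwise disjoint, separate the plane. -/
theorem not_isPreconnected_compl_of_paths {a b : ℂ} (hab : a ≠ b) (α β : Path a b)
    (h : range α ∩ range β ⊆ {a, b}) : ¬ IsPreconnected (range α ∪ range β)ᶜ := by
  intro hpre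
  obtain ⟨LA, hLA, heA⟩ := exists_log_off_path α
  obtain ⟨LB, hLB, heB⟩ := exists_log_off_path β
  have hAcl : IsOpen (range α)ᶜ := (isCompact_range α.continuous).isClosed.isOpen_compl
  have hBcl : IsOpen (range β)ᶜ := (isCompact_range β.continuous).isClosed.isOpen_compl
  have ha : a ∈ range α ∧ a ∈ range β := ⟨⟨0, α.source⟩, ⟨0, β.source⟩⟩
  have hb : b ∈ range α ∧ b ∈ range β := ⟨⟨1, α.target⟩, ⟨1, β.target⟩⟩
  have hc : ∃ c : ℂ, Complex.exp c = 1 ∧ ∀ z ∉ range α ∪ range β, LA z = LB z + c := by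
    by_cases hne : ((range α ∪ range β)ᶜ).Nonempty
    · obtain ⟨z₀, hz₀⟩ := hne
      have hexp : ∀ z ∈ (range α ∪ range β)ᶜ, Complex.exp (LA z - LB z) = 1 := by
        intro z hz
        rw [mem_compl_iff, mem_union, not_or] at hz
        rw [Complex.exp_sub, heA z hz.1, heB z hz.2, div_self]
        exact div_ne_zero (sub_ne_zero.2 (fun h => hz.1 (h ▸ ha.1)))
          (sub_ne_zero.2 (fun h => hz.1 (h ▸ hb.1)))
      refine ⟨LA z₀ - LB z₀, hexp _ hz₀, fun z hz => ?_⟩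
      have := eq_of_exp_eq (f := fun z => LA z - LB z) hpre
        ((hLA.mono (compl_subset_compl.2 subset_union_left)).sub
          (hLB.mono (compl_subset_compl.2 subset_union_right)))
        (fun x hx y hy => (hexp x hx).trans (hexp y hy).symm) hz hz₀
      linear_combination this
    · exact ⟨0, Complex.exp_zero, fun z hz => absurd ⟨z, hz⟩ hne⟩
  obtain ⟨c, hc1, hc2⟩ := hc
  classical
  let L : ℂ → ℂ := fun z => if z ∈ range α then LB z + c else LA z
  have hLA' : EqOn L LA (range α)ᶜ := fun z hz => if_neg hz
  have hLB' : EqOn L (fun z => LB z + c) (range β)ᶜ := by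
    intro z hz
    by_cases hz' : z ∈ range α
    · exact if_pos hz'
    · rw [hLA' hz']
      exact hc2 z (fun h => h.elim hz' hz)
  have hcov : ∀ z ∈ ({a, b} : Set ℂ)ᶜ, z ∈ (range α)ᶜ ∨ z ∈ (range β)ᶜ := by
    intro z hz
    by_contra hcon
    rw [not_or, mem_compl_iff, mem_compl_iff, not_not, not_not] at hcon
    exact hz (h hcon)
  refine no_log_off_pair hab L ?_ ?_
  · intro z hz
    refine ContinuousAt.continuousWithinAt ?_
    rcases hcov z hz with hz' | hz'
    · exact (hLA.continuousAt (hAcl.mem_nhds hz')).congr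
        (hLA'.symm.eventuallyEq_of_mem (hAcl.mem_nhds hz'))
    · exact ((hLB.continuousAt (hBcl.mem_nhds hz')).add continuousAt_const).congr
        (hLB'.symm.eventuallyEq_of_mem (hBcl.mem_nhds hz'))
  · intro z hz
    rcases hcov z hz with hz' | hz'
    · rw [hLA' hz', heA z hz']
    · rw [hLB' hz', Complex.exp_add, hc1, mul_one, heB z hz']

/-- Indices `(n, a, b)` of the grid squares `[a, a+1] × [b, b+1]`, scaled by `p ^ (-n)`. -/
abbrev Idx := ℕ × ℕ × ℕ

/-- Closed grid square with index `c`. -/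
def sq (p : ℕ) (c : Idx) : Set ℂ :=
  {z | (c.2.1 ≤ (p:ℝ) ^ c.1 * z.re ∧ (p:ℝ) ^ c.1 * z.re ≤ c.2.1 + 1) ∧
    (c.2.2 ≤ (p:ℝ) ^ c.1 * z.im ∧ (p:ℝ) ^ c.1 * z.im ≤ c.2.2 + 1)}

/-- Open grid square with index `c`. -/
def osq (p : ℕ) (c : Idx) : Set ℂ :=
  {z | (c.2.1 < (p:ℝ) ^ c.1 * z.re ∧ (p:ℝ) ^ c.1 * z.re < c.2.1 + 1) ∧
    (c.2.2 < (p:ℝ) ^ c.1 * z.im ∧ (p:ℝ) ^ c.1 * z.im < c.2.2 + 1)}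

/-- The middle subsquare of `c`. -/
def mid (p : ℕ) (c : Idx) : Idx := (c.1 + 1, p * c.2.1 + p / 2, p * c.2.2 + p / 2)

/-- The square boundary of the hole of `c`. -/
def per (p : ℕ) (c : Idx) : Set ℂ := sq p (mid p c) \ osq p (mid p c)

/-- No ancestor of the square `(n, a, b)` is a middle square. -/
def Solid (p n a b : ℕ) : Prop :=
  ∀ k < n, ¬((a / p ^ k) % p = p / 2 ∧ (b / p ^ k) % p = p / 2)

/-- Grid squares of the construction that are never removed. -/
def IsCell (p : ℕ) (c : Idx) : Prop :=
  c.2.1 < p ^ c.1 ∧ c.2.2 < p ^ c.1 ∧ Solid p c.1 c.2.1 c.2.2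

/-- The closed unit square. -/
def unitSq : Set ℂ := {z : ℂ | z.re ∈ Set.Icc (0:ℝ) 1 ∧ z.im ∈ Set.Icc (0:ℝ) 1}

lemma nest_of_coarse {p : ℕ} (hp : 0 < p) {A B k : ℕ} {s : ℝ} (h1 : (A:ℝ) ≤ (p:ℝ) ^ k * s)
    (h2 : (p:ℝ) ^ k * s ≤ A + 1) (h3 : (B:ℝ) < s) (h4 : s < B + 1) : A / p ^ k = B := by
  have hpk : (0:ℝ) < (p:ℝ) ^ k := by positivity
  have e1 : A < (B + 1) * p ^ k := by
    have : (A:ℝ) < (B + 1) * (p:ℝ) ^ k := by nlinarith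
    exact_mod_cast this
  have e2 : B * p ^ k < A + 1 := by
    have : (B:ℝ) * (p:ℝ) ^ k < A + 1 := by nlinarith
    exact_mod_cast this
  exact Nat.div_eq_of_lt_le (by omega) e1

lemma nest_of_fine {p : ℕ} (hp : 0 < p) {A B k : ℕ} {s : ℝ} (h1 : (A:ℝ) < (p:ℝ) ^ k * s)
    (h2 : (p:ℝ) ^ k * s < A + 1) (h3 : (B:ℝ) ≤ s) (h4 : s ≤ B + 1) :
    A / p ^ k = B ∧ (B:ℝ) < s ∧ s < B + 1 := by
  have hpk : (0:ℝ) < (p:ℝ) ^ k := by positivity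
  have e1 : A < (B + 1) * p ^ k := by
    have : (A:ℝ) < (B + 1) * (p:ℝ) ^ k := by nlinarith
    exact_mod_cast this
  have e2 : B * p ^ k < A + 1 := by
    have : (B:ℝ) * (p:ℝ) ^ k < A + 1 := by nlinarith
    exact_mod_cast this
  refine ⟨Nat.div_eq_of_lt_le (by omega) e1, ?_, ?_⟩
  · have : (B:ℝ) * (p:ℝ) ^ k ≤ A := by exact_mod_cast (by omega : B * p ^ k ≤ A)
    by_contra hc
    nlinarith
  · have : (A:ℝ) + 1 ≤ (B + 1) * (p:ℝ) ^ k := by exact_mod_cast e1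
    by_contra hc
    nlinarith

lemma osq_subset_sq (p : ℕ) (c : Idx) : osq p c ⊆ sq p c := fun _ h =>
  ⟨⟨h.1.1.le, h.1.2.le⟩, h.2.1.le, h.2.2.le⟩

/-- A point of a closed grid square lying in the interior of a coarser grid square. -/
lemma div_eq_of_sq_osq {p : ℕ} (hp : 0 < p) {n k A B a b : ℕ} {z : ℂ}
    (h : z ∈ sq p (n + k, A, B)) (h' : z ∈ osq p (n, a, b)) : A / p ^ k = a ∧ B / p ^ k = b := by
  simp only [sq, osq, mem_ofPred_eq, pow_add, mul_comm ((p:ℝ) ^ n), mul_assoc] at h h'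
  exact ⟨nest_of_coarse hp h.1.1 h.1.2 h'.1.1 h'.1.2, nest_of_coarse hp h.2.1 h.2.2 h'.2.1 h'.2.2⟩

/-- A point of an open grid square lying in a coarser closed grid square. -/
lemma div_eq_of_osq_sq {p : ℕ} (hp : 0 < p) {n k A B a b : ℕ} {z : ℂ}
    (h : z ∈ osq p (n + k, A, B)) (h' : z ∈ sq p (n, a, b)) :
    A / p ^ k = a ∧ B / p ^ k = b ∧ z ∈ osq p (n, a, b) := by
  simp only [sq, osq, mem_ofPred_eq, pow_add, mul_comm ((p:ℝ) ^ n), mul_assoc] at h h' ⊢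
  have e1 := nest_of_fine hp h.1.1 h.1.2 h'.1.1 h'.1.2
  have e2 := nest_of_fine hp h.2.1 h.2.2 h'.2.1 h'.2.2
  exact ⟨e1.1, e2.1, e1.2, e2.2⟩

/-- A point of a closed grid square lies in the corresponding coarser closed grid square. -/
lemma sq_subset_of_div {p : ℕ} (hp : 0 < p) (n k A B : ℕ) :
    sq p (n + k, A, B) ⊆ sq p (n, A / p ^ k, B / p ^ k) := by
  intro z h
  have hpk : (0:ℝ) < (p:ℝ) ^ k := by positivity
  have hpk' : 0 < p ^ k := by positivity
  simp only [sq, mem_ofPred_eq, pow_add, mul_comm ((p:ℝ) ^ n), mul_assoc] at h ⊢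
  have key : ∀ (A : ℕ) (s : ℝ), ((A:ℝ) ≤ (p:ℝ) ^ k * s ∧ (p:ℝ) ^ k * s ≤ A + 1) →
      (((A / p ^ k : ℕ):ℝ) ≤ s ∧ s ≤ ((A / p ^ k : ℕ):ℝ) + 1) := by
    intro A s hs
    have h1 : A / p ^ k * p ^ k ≤ A := Nat.div_mul_le_self _ _
    have h2 : A + 1 ≤ (A / p ^ k + 1) * p ^ k := by
      have := Nat.lt_div_mul_add (a := A) hpk'
      rw [add_mul]; omega
    have h1' : ((A / p ^ k : ℕ):ℝ) * (p:ℝ) ^ k ≤ A := by exact_mod_cast h1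
    have h2' : (A:ℝ) + 1 ≤ (((A / p ^ k : ℕ):ℝ) + 1) * (p:ℝ) ^ k := by exact_mod_cast h2
    constructor
    · by_contra hc; nlinarith
    · by_contra hc; nlinarith
  exact ⟨key _ _ h.1, key _ _ h.2⟩

lemma mid_bounds {p : ℕ} (hp : 3 ≤ p) : 1 ≤ p / 2 ∧ p / 2 + 1 < p := by omega

/-- A closed middle square is contained in the interior of its parent. -/
lemma sq_mid_subset {p : ℕ} (hp : 3 ≤ p) (c : Idx) : sq p (mid p c) ⊆ osq p c := by
  intro z h
  have hm := mid_bounds hp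
  have hm1 : (1:ℝ) ≤ (p / 2 : ℕ) := by exact_mod_cast hm.1
  have hm2 : ((p / 2 : ℕ):ℝ) + 1 < p := by exact_mod_cast hm.2
  have hp0 : (0:ℝ) < p := by positivity
  simp only [sq, osq, mid, mem_ofPred_eq, pow_succ', mul_assoc] at h ⊢
  push_cast at h
  have key : ∀ (A : ℕ) (s : ℝ), ((p:ℝ) * A + (p / 2 : ℕ) ≤ (p:ℝ) * s ∧
      (p:ℝ) * s ≤ (p:ℝ) * A + (p / 2 : ℕ) + 1) → ((A:ℝ) < s ∧ s < A + 1) := by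
    intro A s hs
    constructor
    · by_contra hc; nlinarith
    · by_contra hc; nlinarith
  exact ⟨key _ _ (by exact_mod_cast h.1), key _ _ (by exact_mod_cast h.2)⟩

lemma carpetApprox_iff {p : ℕ} (hp : 3 ≤ p) (hop : Odd p) (n : ℕ) (z : ℂ) :
    z ∈ carpetApprox p n ↔ z ∈ unitSq ∧ ∀ c : Idx, c.1 < n → z ∉ osq p (mid p c) := by
  have hp0 : 0 < p := by omega
  have hpR : (0:ℝ) < p := by positivity
  have hpC : (p:ℂ) ≠ 0 := by exact_mod_cast hp0.ne'
  have hmid : (p - 1) / 2 = p / 2 := by obtain ⟨k, rfl⟩ := hop; omega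
  have hm := mid_bounds hp
  induction n generalizing z with
  | zero => simp [carpetApprox, unitSq]
  | succ n ih =>
    simp only [carpetApprox, hmid, mem_iUnion, mem_image, exists_prop]
    constructor
    · rintro ⟨i, j, hi, hj, hij, w, hw, rfl⟩
      obtain ⟨hwu, hwh⟩ := (ih w).1 hw
      set z : ℂ := (w + i + j * Complex.I) / p with hz
      have hzw : (p:ℂ) * z = w + i + j * Complex.I := by rw [hz]; field_simp
      have hre : (p:ℝ) * z.re = w.re + i := by
        have := congrArg Complex.re hzw; simpa using this
      have him : (p:ℝ) * z.im = w.im + j := by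
        have := congrArg Complex.im hzw; simpa using this
      simp only [unitSq, mem_ofPred_eq, mem_Icc] at hwu
      have hi' : (i:ℝ) + 1 ≤ p := by exact_mod_cast hi
      have hj' : (j:ℝ) + 1 ≤ p := by exact_mod_cast hj
      have hi0 : (0:ℝ) ≤ i := by positivity
      have hj0 : (0:ℝ) ≤ j := by positivity
      have hzsq : z ∈ sq p (1, i, j) := by
        simp only [sq, mem_ofPred_eq, pow_one, hre, him]
        refine ⟨⟨?_, ?_⟩, ?_, ?_⟩ <;> linarith
      refine ⟨?_, ?_⟩
      · simp only [unitSq, mem_ofPred_eq, mem_Icc]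
        refine ⟨⟨?_, ?_⟩, ?_, ?_⟩
        · by_contra hc; nlinarith
        · by_contra hc; nlinarith
        · by_contra hc; nlinarith
        · by_contra hc; nlinarith
      · rintro ⟨m, a, b⟩ hm' hmem
        rcases m with _ | m
        · have h1 := div_eq_of_sq_osq hp0 (n := 1) (k := 0) hzsq hmem
          simp only [pow_zero, Nat.div_one] at h1
          have ha : a = 0 := by
            rcases Nat.eq_zero_or_pos a with h | h
            · exact h
            · have : p * 1 ≤ p * a := Nat.mul_le_mul_left _ h
              omega
          have hb : b = 0 := by
            rcases Nat.eq_zero_or_pos b with h | h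
            · exact h
            · have : p * 1 ≤ p * b := Nat.mul_le_mul_left _ h
              omega
          subst ha hb
          exact hij (by simpa using h1)
        · have hd : ∀ (a i : ℕ) (x w : ℝ), (p:ℝ) * x = w + i → 0 ≤ w →
              (((p * a + p / 2 : ℕ):ℝ) < (p:ℝ) ^ (m + 1 + 1) * x ∧
                (p:ℝ) ^ (m + 1 + 1) * x < ((p * a + p / 2 : ℕ):ℝ) + 1) → p ^ m * i ≤ a ∧
              (((p * (a - p ^ m * i) + p / 2 : ℕ):ℝ) < (p:ℝ) ^ (m + 1) * w ∧
                (p:ℝ) ^ (m + 1) * w < ((p * (a - p ^ m * i) + p / 2 : ℕ):ℝ) + 1) := by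
            intro a i x w hx hw hh
            have e : (p:ℝ) ^ (m + 1 + 1) * x = (p:ℝ) ^ (m + 1) * (w + i) := by
              rw [pow_succ, mul_assoc, hx]
            rw [e] at hh
            have hpm : (0:ℝ) < (p:ℝ) ^ (m + 1) := by positivity
            have h1 : (p:ℝ) ^ (m + 1) * i < ((p * a + p / 2 : ℕ):ℝ) + 1 := by nlinarith
            have h2 : p ^ (m + 1) * i < p * a + p / 2 + 1 := by exact_mod_cast h1
            have h3 : p ^ m * i ≤ a := by
              have : p * (p ^ m * i) < p * (a + 1) := by
                rw [← mul_assoc, ← pow_succ', mul_add]; omega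
              exact Nat.lt_succ_iff.1 (Nat.lt_of_mul_lt_mul_left this)
            refine ⟨h3, ?_⟩
            have e2 : ((p * (a - p ^ m * i) + p / 2 : ℕ):ℝ)
                = ((p * a + p / 2 : ℕ):ℝ) - (p:ℝ) ^ (m + 1) * i := by
              push_cast [Nat.cast_sub h3]; ring
            rw [e2]
            constructor <;> linarith
          have h1 := hd a i z.re w.re hre hwu.1.1 hmem.1
          have h2 := hd b j z.im w.im him hwu.2.1 hmem.2
          exact hwh (m, a - p ^ m * i, b - p ^ m * j) (by simpa using hm') ⟨h1.2, h2.2⟩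
    · rintro ⟨hzu, hzh⟩
      simp only [unitSq, mem_ofPred_eq, mem_Icc] at hzu
      have hex : ∀ x : ℝ, 0 ≤ x ∧ x ≤ 1 → ∃ i : ℕ, i < p ∧ (i:ℝ) ≤ p * x ∧ p * x ≤ i + 1 := by
        intro x hx
        rcases hx.2.lt_or_eq with h | h
        · refine ⟨⌊(p:ℝ) * x⌋₊, ?_, Nat.floor_le (by nlinarith), (Nat.lt_floor_add_one _).le⟩
          exact (Nat.floor_lt (by nlinarith)).2 (by nlinarith)
        · refine ⟨p - 1, by omega, ?_, ?_⟩
          · rw [Nat.cast_sub (by omega), h]; push_cast; linarith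
          · rw [Nat.cast_sub (by omega), h]; push_cast; linarith
      have hex2 : ∃ i j : ℕ, i < p ∧ j < p ∧ ¬ (i = p / 2 ∧ j = p / 2) ∧
          ((i:ℝ) ≤ p * z.re ∧ p * z.re ≤ i + 1) ∧ ((j:ℝ) ≤ p * z.im ∧ p * z.im ≤ j + 1) := by
        obtain ⟨i, hi, hi1, hi2⟩ := hex z.re hzu.1
        obtain ⟨j, hj, hj1, hj2⟩ := hex z.im hzu.2
        by_cases hij : i = p / 2 ∧ j = p / 2
        · have h0 := hzh (0, 0, 0) (Nat.succ_pos n)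
          simp only [osq, mid, mem_ofPred_eq, zero_add, pow_one, mul_zero, ← hij.1] at h0
          have hn1 : ((i - 1 : ℕ):ℝ) = i - 1 := by
            rw [Nat.cast_sub (by omega)]; norm_num
          have hn2 : ((j - 1 : ℕ):ℝ) = j - 1 := by
            rw [Nat.cast_sub (by omega)]; norm_num
          have hji : (j:ℝ) = i := by rw [hij.1, hij.2]
          rcases hi1.lt_or_eq with h1 | h1
          · rcases hi2.lt_or_eq with h2 | h2
            · rcases hj1.lt_or_eq with h3 | h3
              · rcases hj2.lt_or_eq with h4 | h4
                · exact absurd ⟨⟨h1, h2⟩, hji ▸ h3, hji ▸ h4⟩ h0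
                · refine ⟨i, j + 1, hi, by omega, by omega, ⟨hi1, hi2⟩, ?_, ?_⟩ <;>
                    push_cast <;> linarith
              · refine ⟨i, j - 1, hi, by omega, by omega, ⟨hi1, hi2⟩, ?_, ?_⟩ <;>
                    rw [hn2] <;> linarith
            · refine ⟨i + 1, j, by omega, hj, by omega, ⟨?_, ?_⟩, hj1, hj2⟩ <;>
                    push_cast <;> linarith
          · refine ⟨i - 1, j, by omega, hj, by omega, ⟨?_, ?_⟩, hj1, hj2⟩ <;>
                    rw [hn1] <;> linarith
        · exact ⟨i, j, hi, hj, hij, ⟨hi1, hi2⟩, hj1, hj2⟩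
      obtain ⟨i, j, hi, hj, hij, hzi, hzj⟩ := hex2
      refine ⟨i, j, hi, hj, hij, p * z - i - j * Complex.I, ?_, by field_simp; ring⟩
      refine (ih _).2 ?_
      have hre : ((p:ℂ) * z - i - j * Complex.I).re = p * z.re - i := by simp
      have him : ((p:ℂ) * z - i - j * Complex.I).im = p * z.im - j := by simp
      refine ⟨?_, ?_⟩
      · simp only [unitSq, mem_ofPred_eq, mem_Icc, hre, him]
        refine ⟨⟨?_, ?_⟩, ?_, ?_⟩ <;> linarith
      · rintro ⟨m, a, b⟩ hmn hmem
        refine hzh (m + 1, a + p ^ m * i, b + p ^ m * j) (by simpa using hmn) ?_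
        simp only [osq, mid, mem_ofPred_eq, hre, him] at hmem ⊢
        have key : ∀ x : ℝ, ∀ a i : ℕ, (((p * a + p / 2 : ℕ):ℝ) < (p:ℝ) ^ (m + 1) * (p * x - i) ∧
            (p:ℝ) ^ (m + 1) * (p * x - i) < ((p * a + p / 2 : ℕ):ℝ) + 1) →
            (((p * (a + p ^ m * i) + p / 2 : ℕ):ℝ) < (p:ℝ) ^ (m + 1 + 1) * x ∧
            (p:ℝ) ^ (m + 1 + 1) * x < ((p * (a + p ^ m * i) + p / 2 : ℕ):ℝ) + 1) := by
          intro x a i h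
          have e : ((p * (a + p ^ m * i) + p / 2 : ℕ):ℝ)
              = ((p * a + p / 2 : ℕ):ℝ) + (p:ℝ) ^ (m + 1) * i := by push_cast; ring
          have e2 : (p:ℝ) ^ (m + 1 + 1) * x = (p:ℝ) ^ (m + 1) * (p * x - i)
              + (p:ℝ) ^ (m + 1) * i := by ring
          rw [e, e2]
          constructor <;> linarith
        exact ⟨key _ _ _ hmem.1, key _ _ _ hmem.2⟩

lemma mem_carpet_iff {p : ℕ} (hp : 3 ≤ p) (hop : Odd p) (z : ℂ) :
    z ∈ sierpinskiCarpet p ↔ z ∈ unitSq ∧ ∀ c : Idx, z ∉ osq p (mid p c) := by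
  simp only [sierpinskiCarpet, mem_iInter, carpetApprox_iff hp hop]
  exact ⟨fun h => ⟨(h 0).1, fun c => (h (c.1 + 1)).2 c (Nat.lt_succ_self _)⟩,
    fun h n => ⟨h.1, fun c _ => h.2 c⟩⟩

lemma isClosed_sq (p : ℕ) (c : Idx) : IsClosed (sq p c) := by
  have h1 : Continuous fun z : ℂ => (p:ℝ) ^ c.1 * z.re := by fun_prop
  have h2 : Continuous fun z : ℂ => (p:ℝ) ^ c.1 * z.im := by fun_prop
  exact ((isClosed_le continuous_const h1).inter (isClosed_le h1 continuous_const)).inter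
    ((isClosed_le continuous_const h2).inter (isClosed_le h2 continuous_const))

lemma isOpen_osq (p : ℕ) (c : Idx) : IsOpen (osq p c) := by
  have h1 : Continuous fun z : ℂ => (p:ℝ) ^ c.1 * z.re := by fun_prop
  have h2 : Continuous fun z : ℂ => (p:ℝ) ^ c.1 * z.im := by fun_prop
  exact ((isOpen_lt continuous_const h1).inter (isOpen_lt h1 continuous_const)).inter
    ((isOpen_lt continuous_const h2).inter (isOpen_lt h2 continuous_const))

lemma sq_zero (p : ℕ) : sq p (0, 0, 0) = unitSq := by
  ext z; simp [sq, unitSq]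

lemma isClosed_unitSq : IsClosed unitSq := sq_zero 1 ▸ isClosed_sq 1 _

lemma isClosed_carpet {p : ℕ} (hp : 3 ≤ p) (hop : Odd p) : IsClosed (sierpinskiCarpet p) := by
  have : sierpinskiCarpet p = unitSq ∩ ⋂ c : Idx, (osq p (mid p c))ᶜ := by
    ext z; simp [mem_carpet_iff hp hop]
  rw [this]
  exact isClosed_unitSq.inter (isClosed_iInter fun c => (isOpen_osq p _).isClosed_compl)

/-- A grid square with all proper ancestors solid has its boundary in the carpet. -/
lemma boundary_subset_carpet {p : ℕ} (hp : 3 ≤ p) (hop : Odd p) {n A B : ℕ}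
    (hA : A < p ^ n) (hB : B < p ^ n)
    (hs : ∀ k < n, 0 < k → ¬((A / p ^ k) % p = p / 2 ∧ (B / p ^ k) % p = p / 2)) :
    sq p (n, A, B) \ osq p (n, A, B) ⊆ sierpinskiCarpet p := by
  rintro z ⟨hz, hzo⟩
  have hp0 : 0 < p := by omega
  rw [mem_carpet_iff hp hop]
  constructor
  · have := sq_subset_of_div hp0 0 n A B (by simpa using hz)
    rwa [Nat.div_eq_of_lt hA, Nat.div_eq_of_lt hB, sq_zero] at this
  · rintro ⟨m, a, b⟩ hm
    rcases le_or_gt (m + 1) n with h | h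
    · obtain ⟨k, rfl⟩ := Nat.exists_eq_add_of_le h
      have e := div_eq_of_sq_osq hp0 hz hm
      rcases Nat.eq_zero_or_pos k with rfl | hk
      · simp only [pow_zero, Nat.div_one] at e
        rw [e.1, e.2] at hzo
        exact hzo hm
      · refine hs k (by omega) hk ?_
        have : p / 2 < p := by omega
        rw [e.1, e.2]
        simp [Nat.mod_eq_of_lt this]
    · obtain ⟨k, hk⟩ := Nat.exists_eq_add_of_le h.le
      have hm' : z ∈ osq p (n + k, p * a + p / 2, p * b + p / 2) := hk ▸ hm
      exact hzo (div_eq_of_osq_sq hp0 hm' hz).2.2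

lemma cell_boundary_subset {p : ℕ} (hp : 3 ≤ p) (hop : Odd p) {c : Idx} (hc : IsCell p c) :
    sq p c \ osq p c ⊆ sierpinskiCarpet p :=
  boundary_subset_carpet hp hop hc.1 hc.2.1 (fun k hk _ => hc.2.2 k hk)

lemma mul_add_mid_lt {p : ℕ} (hp : 3 ≤ p) {n a : ℕ} (ha : a < p ^ n) :
    p * a + p / 2 < p ^ (n + 1) := by
  have h1 : p * (a + 1) ≤ p * p ^ n := Nat.mul_le_mul_left _ ha
  rw [← pow_succ'] at h1
  have := mid_bounds hp
  rw [mul_add] at h1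
  omega

lemma mul_add_mid_div {p : ℕ} (hp : 3 ≤ p) (a k : ℕ) :
    (p * a + p / 2) / p ^ (k + 1) = a / p ^ k := by
  rw [pow_succ', ← Nat.div_div_eq_div_mul, Nat.mul_add_div (by omega),
    Nat.div_eq_of_lt (by omega : p / 2 < p), add_zero]

lemma per_subset_carpet {p : ℕ} (hp : 3 ≤ p) (hop : Odd p) {c : Idx} (hc : IsCell p c) :
    per p c ⊆ sierpinskiCarpet p := by
  refine boundary_subset_carpet hp hop (mul_add_mid_lt hp hc.1) (mul_add_mid_lt hp hc.2.1) ?_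
  intro k hk hk0
  obtain ⟨k, rfl⟩ : ∃ j, k = j + 1 := ⟨k - 1, by omega⟩
  rw [mul_add_mid_div hp, mul_add_mid_div hp]
  exact hc.2.2 k (by omega)

/-- Points of the unit square outside the carpet lie in the hole of a cell. -/
lemma exists_cell_of_not_mem {p : ℕ} (hp : 3 ≤ p) (hop : Odd p) {z : ℂ} (hz : z ∈ unitSq)
    (hz' : z ∉ sierpinskiCarpet p) : ∃ c, IsCell p c ∧ z ∈ osq p (mid p c) := by
  have hp0 : 0 < p := by omega
  rw [mem_carpet_iff hp hop] at hz'
  push Not at hz'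
  obtain ⟨c₀, hc₀⟩ := hz' hz
  classical
  have hex : ∃ n, ∃ a b : ℕ, z ∈ osq p (mid p (n, a, b)) := ⟨c₀.1, c₀.2.1, c₀.2.2, hc₀⟩
  obtain ⟨a, b, hab⟩ := Nat.find_spec hex
  set n := Nat.find hex with hn
  have hbd : ∀ (x : ℝ) (a : ℕ), x ≤ 1 → ((p * a + p / 2 : ℕ):ℝ) < (p:ℝ) ^ (n + 1) * x →
      a < p ^ n := by
    intro x a hx h
    have hpp : (0:ℝ) < (p:ℝ) ^ (n + 1) := by positivity
    have h1 : ((p * a + p / 2 : ℕ):ℝ) < (p:ℝ) ^ (n + 1) := by nlinarith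
    have h2 : p * a + p / 2 < p ^ (n + 1) := by exact_mod_cast h1
    rw [pow_succ'] at h2
    exact Nat.lt_of_mul_lt_mul_left (a := p) (by omega)
  refine ⟨(n, a, b), ⟨hbd _ _ hz.1.2 hab.1.1, hbd _ _ hz.2.2 hab.2.1, ?_⟩, hab⟩
  rintro k hk ⟨hka, hkb⟩
  have hk : k < n := hk
  have hka : a / p ^ k % p = p / 2 := hka
  have hkb : b / p ^ k % p = p / 2 := hkb
  refine Nat.find_min hex (m := n - k - 1) (by omega) ⟨a / p ^ (k + 1), b / p ^ (k + 1), ?_⟩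
  have hidx : ∀ a, a / p ^ k % p = p / 2 → p * (a / p ^ (k + 1)) + p / 2 = a / p ^ k := by
    intro a h
    rw [pow_succ, ← Nat.div_div_eq_div_mul, ← h]
    exact Nat.div_add_mod _ _
  have h1 : z ∈ osq p (n, a, b) := sq_mid_subset hp _ (osq_subset_sq _ _ hab)
  obtain ⟨m, hm⟩ : ∃ m, n = m + k := ⟨n - k, by omega⟩
  have h2 : z ∈ osq p (m + k, a, b) := hm ▸ h1
  have h3 := (div_eq_of_osq_sq hp0 h2 (sq_subset_of_div hp0 m k a b (osq_subset_sq _ _ h2))).2.2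
  have e : n - k - 1 + 1 = m := by omega
  simpa only [mid, e, hidx a hka, hidx b hkb] using h3

/-- Closed holes of distinct cells are disjoint. -/
lemma mid_eq_of_mem {p : ℕ} (hp : 3 ≤ p) {c c' : Idx} (hc : IsCell p c) (hc' : IsCell p c')
    {z : ℂ} (hz : z ∈ sq p (mid p c)) (hz' : z ∈ sq p (mid p c')) : c = c' := by
  have hp0 : 0 < p := by omega
  have hm := mid_bounds hp
  wlog hle : c.1 ≤ c'.1 generalizing c c'
  · exact (this hc' hc hz' hz (by omega)).symm
  obtain ⟨n, a, b⟩ := c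
  obtain ⟨m, a', b'⟩ := c'
  simp only at hle
  rcases hle.lt_or_eq with h | rfl
  · obtain ⟨k, rfl⟩ := Nat.exists_eq_add_of_le (Nat.succ_le_of_lt h)
    have h1 : z ∈ osq p (n + 1 + k, a', b') := sq_mid_subset hp _ hz'
    have h2 := div_eq_of_osq_sq hp0 h1 hz
    refine absurd ?_ (hc'.2.2 k (by simp only; omega))
    simp only
    rw [h2.1, h2.2.1]
    simp [Nat.mod_eq_of_lt (by omega : p / 2 < p)]
  · have h1 := sq_mid_subset hp _ hz
    have h2 := div_eq_of_osq_sq hp0 (n := n) (k := 0) h1 (osq_subset_sq _ _ (sq_mid_subset hp _ hz'))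
    simp only [pow_zero, Nat.div_one] at h2
    rw [h2.1, h2.2.1]

/-- Boundary of a grid square. -/
def bd (p : ℕ) (c : Idx) : Set ℂ := sq p c \ osq p c

/-- Peripheral squares of the carpet: `none` stands for the outer square. -/
def perO (p : ℕ) : Option Idx → Set ℂ
  | none => bd p (0, 0, 0)
  | some c => bd p (mid p c)

/-- Complementary components of the carpet. -/
def regO (p : ℕ) : Option Idx → Set ℂ
  | none => (sq p (0, 0, 0))ᶜ
  | some c => osq p (mid p c)

/-- Admissible labels of peripheral squares. -/
def ValidO (p : ℕ) : Option Idx → Prop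
  | none => True
  | some c => IsCell p c

lemma isCell_zero (p : ℕ) : IsCell p (0, 0, 0) := ⟨by simp, by simp, fun k hk => by simp at hk⟩

/-- A point of the grid square `c` in relative coordinates. -/
noncomputable def relPt (p : ℕ) (c : Idx) (s t : ℝ) : ℂ :=
  ⟨(c.2.1 + s) / (p:ℝ) ^ c.1, (c.2.2 + t) / (p:ℝ) ^ c.1⟩

lemma relPt_re {p : ℕ} (hp : 0 < p) (c : Idx) (s t : ℝ) :
    (p:ℝ) ^ c.1 * (relPt p c s t).re = c.2.1 + s := by
  have : (p:ℝ) ^ c.1 ≠ 0 := by positivity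
  simp only [relPt]; field_simp

lemma relPt_im {p : ℕ} (hp : 0 < p) (c : Idx) (s t : ℝ) :
    (p:ℝ) ^ c.1 * (relPt p c s t).im = c.2.2 + t := by
  have : (p:ℝ) ^ c.1 ≠ 0 := by positivity
  simp only [relPt]; field_simp

lemma eq_relPt {p : ℕ} (hp : 0 < p) (c : Idx) (z : ℂ) :
    z = relPt p c ((p:ℝ) ^ c.1 * z.re - c.2.1) ((p:ℝ) ^ c.1 * z.im - c.2.2) := by
  have : (p:ℝ) ^ c.1 ≠ 0 := by positivity
  apply Complex.ext <;> simp only [relPt] <;> field_simp <;> ring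

lemma relPt_mem_sq {p : ℕ} (hp : 0 < p) (c : Idx) (s t : ℝ) :
    relPt p c s t ∈ sq p c ↔ (0 ≤ s ∧ s ≤ 1) ∧ (0 ≤ t ∧ t ≤ 1) := by
  simp only [sq, mem_ofPred_eq, relPt_re hp, relPt_im hp, le_add_iff_nonneg_right,
    add_le_add_iff_left]

lemma relPt_mem_osq {p : ℕ} (hp : 0 < p) (c : Idx) (s t : ℝ) :
    relPt p c s t ∈ osq p c ↔ (0 < s ∧ s < 1) ∧ (0 < t ∧ t < 1) := by
  simp only [osq, mem_ofPred_eq, relPt_re hp, relPt_im hp, lt_add_iff_pos_right,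
    add_lt_add_iff_left]

lemma relPt_inj {p : ℕ} (hp : 0 < p) (c : Idx) {s t s' t' : ℝ}
    (h : relPt p c s t = relPt p c s' t') : s = s' ∧ t = t' := by
  have h1 := relPt_re hp c s t
  have h2 := relPt_im hp c s t
  rw [h, relPt_re hp] at h1
  rw [h, relPt_im hp] at h2
  constructor <;> linarith

lemma continuous_relPt (p : ℕ) (c : Idx) : Continuous fun x : ℝ × ℝ => relPt p c x.1 x.2 := by
  have : (fun x : ℝ × ℝ => relPt p c x.1 x.2) = fun x : ℝ × ℝ =>
      (((c.2.1 + x.1) / (p:ℝ) ^ c.1 : ℝ) : ℂ) + (((c.2.2 + x.2) / (p:ℝ) ^ c.1 : ℝ) : ℂ) * Complex.I := by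
    funext x
    apply Complex.ext <;> simp [relPt, Complex.ofReal_re, Complex.ofReal_im, -Complex.ofReal_div]
  rw [this]
  fun_prop

/-- The boundary of a grid square is the union of two arcs. -/
lemma exists_paths_bd {p : ℕ} (hp : 0 < p) (c : Idx) : ∃ a b : ℂ, a ≠ b ∧ ∃ α β : Path a b,
    range α ∪ range β = bd p c ∧ range α ∩ range β ⊆ {a, b} := by
  have hc := continuous_relPt p c
  let u : ℝ → ℝ := fun t => min (2 * t) 1
  let v : ℝ → ℝ := fun t => max (2 * t - 1) 0
  have huc : Continuous u := by fun_prop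
  have hvc : Continuous v := by fun_prop
  have hA : ∀ t : ℝ, 0 ≤ t → t ≤ 1 → (0 ≤ u t ∧ u t ≤ 1) ∧ (0 ≤ v t ∧ v t ≤ 1) ∧
      (u t = 1 ∨ v t = 0) := by
    intro t h0 h1
    refine ⟨⟨le_min (by linarith) zero_le_one, min_le_right _ _⟩,
      ⟨le_max_right _ _, max_le (by linarith) zero_le_one⟩, ?_⟩
    rcases le_total (2 * t) 1 with h | h
    · exact Or.inr (max_eq_right (by linarith))
    · exact Or.inl (min_eq_right h)
  have hsurj : ∀ s t : ℝ, 0 ≤ s → s ≤ 1 → 0 ≤ t → t ≤ 1 → (s = 1 ∨ t = 0) →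
      ∃ r : unitInterval, u r = s ∧ v r = t := by
    rintro s t hs0 hs1 ht0 ht1 (rfl | rfl)
    · refine ⟨⟨(1 + t) / 2, by constructor <;> linarith⟩, ?_, ?_⟩
      · simp only [u]; rw [min_eq_right]; linarith
      · simp only [v]; rw [max_eq_left] <;> linarith
    · refine ⟨⟨s / 2, by constructor <;> linarith⟩, ?_, ?_⟩
      · simp only [u]; rw [min_eq_left] <;> linarith
      · simp only [v]; rw [max_eq_right]; linarith
  let α : Path (relPt p c 0 0) (relPt p c 1 1) :=
    { toFun := fun t => relPt p c (u t) (v t)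
      continuous_toFun := hc.comp (f := fun t : unitInterval => (u t, v t)) (by fun_prop)
      source' := by simp [u, v]
      target' := by norm_num [u, v] }
  let β : Path (relPt p c 0 0) (relPt p c 1 1) :=
    { toFun := fun t => relPt p c (v t) (u t)
      continuous_toFun := hc.comp (f := fun t : unitInterval => (v t, u t)) (by fun_prop)
      source' := by simp [u, v]
      target' := by norm_num [u, v] }
  refine ⟨relPt p c 0 0, relPt p c 1 1, fun h => by simpa using (relPt_inj hp c h).1, α, β, ?_, ?_⟩
  · ext z
    constructor
    · rintro (⟨r, rfl⟩ | ⟨r, rfl⟩)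
      · have h := hA r r.2.1 r.2.2
        refine ⟨(relPt_mem_sq hp c _ _).2 ⟨h.1, h.2.1⟩, fun hh => ?_⟩
        have := (relPt_mem_osq hp c _ _).1 hh
        rcases h.2.2 with h | h <;> linarith
      · have h := hA r r.2.1 r.2.2
        refine ⟨(relPt_mem_sq hp c _ _).2 ⟨h.2.1, h.1⟩, fun hh => ?_⟩
        have := (relPt_mem_osq hp c _ _).1 hh
        rcases h.2.2 with h | h <;> linarith
    · rintro ⟨h1, h2⟩
      rw [eq_relPt hp c z] at h1 h2 ⊢
      generalize (p:ℝ) ^ c.1 * z.re - c.2.1 = s at *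
      generalize (p:ℝ) ^ c.1 * z.im - c.2.2 = t at *
      rw [relPt_mem_sq hp] at h1
      rw [relPt_mem_osq hp] at h2
      by_cases hst : s = 1 ∨ t = 0
      · obtain ⟨r, hr1, hr2⟩ := hsurj s t h1.1.1 h1.1.2 h1.2.1 h1.2.2 hst
        exact Or.inl ⟨r, by change relPt p c (u r) (v r) = _; rw [hr1, hr2]⟩
      · have hst' : t = 1 ∨ s = 0 := by
          by_contra hcon
          push Not at hst hcon
          exact h2 ⟨⟨lt_of_le_of_ne h1.1.1 (Ne.symm hcon.2), lt_of_le_of_ne h1.1.2 hst.1⟩,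
            lt_of_le_of_ne h1.2.1 (Ne.symm hst.2), lt_of_le_of_ne h1.2.2 hcon.1⟩
        obtain ⟨r, hr1, hr2⟩ := hsurj t s h1.2.1 h1.2.2 h1.1.1 h1.1.2 hst'
        exact Or.inr ⟨r, by change relPt p c (v r) (u r) = _; rw [hr1, hr2]⟩
  · rintro z ⟨⟨r, rfl⟩, ⟨r', hr'⟩⟩
    have h := hA r r.2.1 r.2.2
    have h' := hA r' r'.2.1 r'.2.2
    have e := relPt_inj hp c hr'
    change relPt p c (u r) (v r) ∈ _
    rcases h.2.2 with h1 | h1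
    · rcases h'.2.2 with h2 | h2
      · right; rw [h1, ← e.2, h2]; rfl
      · rw [e.1] at h2; linarith
    · rcases h'.2.2 with h2 | h2
      · rw [e.2] at h2; linarith
      · left; rw [h1, ← e.1, h2]

lemma isPreconnected_bd {p : ℕ} (hp : 0 < p) (c : Idx) : IsPreconnected (bd p c) := by
  obtain ⟨a, b, -, α, β, h, -⟩ := exists_paths_bd hp c
  rw [← h]
  exact IsPreconnected.union a ⟨0, α.source⟩ ⟨0, β.source⟩ (isPreconnected_range α.continuous)
    (isPreconnected_range β.continuous)

lemma bd_nonempty {p : ℕ} (hp : 0 < p) (c : Idx) : (bd p c).Nonempty := by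
  obtain ⟨a, b, -, α, β, h, -⟩ := exists_paths_bd hp c
  exact ⟨a, h ▸ Or.inl ⟨0, α.source⟩⟩

lemma convex_osq (p : ℕ) (c : Idx) : Convex ℝ (osq p c) := by
  have h1 : IsLinearMap ℝ fun z : ℂ => (p:ℝ) ^ c.1 * z.re :=
    ⟨fun x y => by simp [mul_add], fun a x => by simp; ring⟩
  have h2 : IsLinearMap ℝ fun z : ℂ => (p:ℝ) ^ c.1 * z.im :=
    ⟨fun x y => by simp [mul_add], fun a x => by simp; ring⟩
  exact ((convex_halfSpace_gt h1 _).inter (convex_halfSpace_lt h1 _)).inter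
    ((convex_halfSpace_gt h2 _).inter (convex_halfSpace_lt h2 _))

lemma convex_sq (p : ℕ) (c : Idx) : Convex ℝ (sq p c) := by
  have h1 : IsLinearMap ℝ fun z : ℂ => (p:ℝ) ^ c.1 * z.re :=
    ⟨fun x y => by simp [mul_add], fun a x => by simp; ring⟩
  have h2 : IsLinearMap ℝ fun z : ℂ => (p:ℝ) ^ c.1 * z.im :=
    ⟨fun x y => by simp [mul_add], fun a x => by simp; ring⟩
  exact ((convex_halfSpace_ge h1 _).inter (convex_halfSpace_le h1 _)).inter
    ((convex_halfSpace_ge h2 _).inter (convex_halfSpace_le h2 _))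

/-- A convex set minus a box, reaching beyond three corners of the box, is preconnected. -/
lemma isPreconnected_diff_box {Y : Set ℂ} (hY : Convex ℝ Y) {x₀ x₁ y₀ y₁ u₀ u₁ v₀ v₁ : ℝ}
    (hu₀ : u₀ < x₀) (hu₁ : x₁ < u₁) (hv₀ : v₀ < y₀) (hv₁ : y₁ < v₁)
    (h00 : (⟨u₀, v₀⟩ : ℂ) ∈ Y) (h01 : (⟨u₀, v₁⟩ : ℂ) ∈ Y) (h11 : (⟨u₁, v₁⟩ : ℂ) ∈ Y) :
    IsPreconnected (Y \ {z | (x₀ ≤ z.re ∧ z.re ≤ x₁) ∧ (y₀ ≤ z.im ∧ z.im ≤ y₁)}) := by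
  have hre : IsLinearMap ℝ Complex.re := ⟨fun x y => by simp, fun a x => by simp⟩
  have him : IsLinearMap ℝ Complex.im := ⟨fun x y => by simp, fun a x => by simp⟩
  have e : Y \ {z | (x₀ ≤ z.re ∧ z.re ≤ x₁) ∧ (y₀ ≤ z.im ∧ z.im ≤ y₁)} =
      (((Y ∩ {z | z.im < y₀}) ∪ (Y ∩ {z | z.re < x₀})) ∪ (Y ∩ {z | y₁ < z.im})) ∪
        (Y ∩ {z | x₁ < z.re}) := by
    ext z
    simp only [mem_sdiff, mem_ofPred_eq, mem_union, mem_inter_iff, not_and_or, not_le]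
    tauto
  rw [e]
  refine IsPreconnected.union ⟨u₁, v₁⟩ (Or.inr ⟨h11, hv₁⟩) ⟨h11, hu₁⟩
    (IsPreconnected.union ⟨u₀, v₁⟩ (Or.inr ⟨h01, hu₀⟩) ⟨h01, hv₁⟩
    (IsPreconnected.union ⟨u₀, v₀⟩ ⟨h00, hv₀⟩ ⟨h00, hu₀⟩ ?_ ?_) ?_) ?_
  · exact (hY.inter (convex_halfSpace_lt him _)).isPreconnected
  · exact (hY.inter (convex_halfSpace_lt hre _)).isPreconnected
  · exact (hY.inter (convex_halfSpace_gt him _)).isPreconnected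
  · exact (hY.inter (convex_halfSpace_gt hre _)).isPreconnected

lemma sq_mid_subset_osq_zero {p : ℕ} (hp : 3 ≤ p) {c : Idx} (hc : IsCell p c) :
    sq p (mid p c) ⊆ osq p (0, 0, 0) := by
  intro z hz
  have h1 : z ∈ osq p (0 + c.1, c.2.1, c.2.2) := by simpa using sq_mid_subset hp c hz
  have h2 := sq_subset_of_div (by omega) _ _ _ _ (osq_subset_sq _ _ h1)
  rw [Nat.div_eq_of_lt hc.1, Nat.div_eq_of_lt hc.2.1] at h2
  exact (div_eq_of_osq_sq (by omega) h1 h2).2.2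

lemma perO_subset {p : ℕ} (hp : 3 ≤ p) (hop : Odd p) {d : Option Idx} (hd : ValidO p d) :
    perO p d ⊆ sierpinskiCarpet p := by
  cases d with
  | none => exact cell_boundary_subset hp hop (isCell_zero p)
  | some c => exact per_subset_carpet hp hop hd

lemma perO_nonempty {p : ℕ} (hp : 0 < p) (d : Option Idx) : (perO p d).Nonempty := by
  cases d with
  | none => exact bd_nonempty hp _
  | some c => exact bd_nonempty hp _

lemma perO_disjoint {p : ℕ} (hp : 3 ≤ p) {d d' : Option Idx} (hd : ValidO p d)
    (hd' : ValidO p d') {z : ℂ} (hz : z ∈ perO p d) (hz' : z ∈ perO p d') : d = d' := by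
  cases d with
  | none =>
    cases d' with
    | none => rfl
    | some c' => exact absurd (sq_mid_subset_osq_zero hp hd' hz'.1) hz.2
  | some c =>
    cases d' with
    | none => exact absurd (sq_mid_subset_osq_zero hp hd hz.1) hz'.2
    | some c' => rw [mid_eq_of_mem hp hd hd' hz.1 hz'.1]

lemma exists_regO {p : ℕ} (hp : 3 ≤ p) (hop : Odd p) {z : ℂ} (hz : z ∉ sierpinskiCarpet p) :
    ∃ d, ValidO p d ∧ z ∈ regO p d := by
  by_cases hzu : z ∈ unitSq
  · obtain ⟨c, hc, hzc⟩ := exists_cell_of_not_mem hp hop hzu hz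
    exact ⟨some c, hc, hzc⟩
  · exact ⟨none, trivial, by rw [regO, sq_zero]; exact hzu⟩

lemma regO_disjoint_carpet {p : ℕ} (hp : 3 ≤ p) (hop : Odd p) {d : Option Idx} {z : ℂ}
    (hz : z ∈ regO p d) : z ∉ sierpinskiCarpet p := by
  rw [mem_carpet_iff hp hop]
  rintro ⟨h1, h2⟩
  cases d with
  | none => rw [regO, sq_zero] at hz; exact hz h1
  | some c => exact h2 c hz

lemma isPreconnected_regO (p : ℕ) (d : Option Idx) : IsPreconnected (regO p d) := by
  cases d with
  | none =>
    have h := isPreconnected_diff_box (Y := univ) convex_univ (x₀ := 0) (x₁ := 1) (y₀ := 0)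
      (y₁ := 1) (u₀ := -1) (u₁ := 2) (v₀ := -1) (v₁ := 2) (by norm_num) (by norm_num)
      (by norm_num) (by norm_num) trivial trivial trivial
    rw [← compl_eq_univ_sdiff] at h
    rw [regO, sq_zero]
    exact h
  | some c => exact (convex_osq p _).isPreconnected

lemma mem_closure_of_ray {D : Set ℂ} {x v : ℂ} (h : ∀ t : ℝ, 0 < t → t < 1 → x + t * v ∈ D) :
    x ∈ closure D := by
  have h1 : Filter.Tendsto (fun t : ℝ => x + t * v) (nhdsWithin 0 (Ioi 0)) (nhds x) := by
    have : Continuous fun t : ℝ => x + t * v := by fun_prop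
    have h2 := this.tendsto 0
    simp only [Complex.ofReal_zero, zero_mul, add_zero] at h2
    exact h2.mono_left nhdsWithin_le_nhds
  refine mem_closure_of_tendsto h1 ?_
  filter_upwards [Ioo_mem_nhdsGT (zero_lt_one (α := ℝ))] with t ht
  exact h t ht.1 ht.2

lemma perO_subset_closure {p : ℕ} (hp : 0 < p) (d : Option Idx) : perO p d ⊆ closure (regO p d) := by
  intro z hz
  cases d with
  | none =>
    refine mem_closure_of_ray (v := z - (1 / 2 : ℝ) * (1 + Complex.I)) fun t ht0 ht1 hcon => ?_
    simp only [sq, mem_ofPred_eq, pow_zero, one_mul, Complex.add_re, Complex.add_im,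
      Complex.re_ofReal_mul, Complex.im_ofReal_mul, Complex.sub_re, Complex.sub_im,
      Complex.one_re, Complex.one_im, Complex.I_re, Complex.I_im, Nat.cast_zero] at hcon
    obtain ⟨h1, h2⟩ := hz
    simp only [sq, osq, mem_ofPred_eq, pow_zero, one_mul, Nat.cast_zero] at h1 h2
    refine h2 ⟨⟨?_, ?_⟩, ?_, ?_⟩ <;> by_contra hc <;> nlinarith
  | some c =>
    simp only [perO, regO] at *
    generalize mid p c = e at *
    have h1 := hz.1
    rw [eq_relPt hp e z] at h1
    set s := (p:ℝ) ^ e.1 * z.re - e.2.1 with hs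
    set t := (p:ℝ) ^ e.1 * z.im - e.2.2 with ht
    rw [relPt_mem_sq hp] at h1
    refine mem_closure_of_ray (v := relPt p e (1 / 2) (1 / 2) - z) fun r hr0 hr1 => ?_
    have e1 := relPt_re hp e (1 / 2) (1 / 2)
    have e2 := relPt_im hp e (1 / 2) (1 / 2)
    simp only [osq, mem_ofPred_eq, Complex.add_re, Complex.add_im, Complex.re_ofReal_mul,
      Complex.im_ofReal_mul, Complex.sub_re, Complex.sub_im]
    have e3 : (p:ℝ) ^ e.1 * (z.re + r * ((relPt p e (1 / 2) (1 / 2)).re - z.re))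
        = e.2.1 + s + r * (1 / 2 - s) := by
      rw [hs]; linear_combination r * e1
    have e4 : (p:ℝ) ^ e.1 * (z.im + r * ((relPt p e (1 / 2) (1 / 2)).im - z.im))
        = e.2.2 + t + r * (1 / 2 - t) := by
      rw [ht]; linear_combination r * e2
    rw [e3, e4]
    refine ⟨⟨?_, ?_⟩, ?_, ?_⟩ <;> nlinarith

/-- A segment leaving an open grid square meets its boundary. -/
lemma segment_inter_bd {p : ℕ} {c : Idx} {w z : ℂ} (hw : w ∈ osq p c) (hz : z ∉ osq p c) :
    ∃ x ∈ segment ℝ w z, x ∈ bd p c := by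
  have h := (convex_segment (𝕜 := ℝ) w z).isPreconnected
  by_contra hcon
  push Not at hcon
  have hsub : segment ℝ w z ⊆ osq p c ∪ (sq p c)ᶜ := by
    intro x hx
    by_contra hx'
    rw [mem_union, not_or, mem_compl_iff, not_not] at hx'
    exact hcon x hx ⟨hx'.2, hx'.1⟩
  have hzz : z ∈ (sq p c)ᶜ := by
    rcases hsub (right_mem_segment ℝ w z) with h | h
    · exact absurd h hz
    · exact h
  obtain ⟨x, -, hx1, hx2⟩ := h _ _ (isOpen_osq p c) (isClosed_sq p c).isOpen_compl hsub
    ⟨w, left_mem_segment ℝ w z, hw⟩ ⟨z, right_mem_segment ℝ w z, hzz⟩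
  exact hx2 (osq_subset_sq _ _ hx1)

/-- The carpet minus a peripheral square is preconnected. -/
theorem isPreconnected_diff_perO {p : ℕ} (hp : 3 ≤ p) (hop : Odd p) {d : Option Idx}
    (hd : ValidO p d) : IsPreconnected (sierpinskiCarpet p \ perO p d) := by
  have hp0 : 0 < p := by omega
  obtain ⟨X, hX, hsX, hXs⟩ : ∃ X : Set ℂ, IsPreconnected X ∧ sierpinskiCarpet p \ perO p d ⊆ X ∧
      ∀ z ∈ X, z ∉ sierpinskiCarpet p \ perO p d →
        ∃ c, IsCell p c ∧ some c ≠ d ∧ z ∈ osq p (mid p c) := by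
    cases d with
    | none =>
      refine ⟨osq p (0, 0, 0), (convex_osq p _).isPreconnected, ?_, ?_⟩
      · rintro z ⟨h1, h2⟩
        by_contra h3
        refine h2 ⟨?_, h3⟩
        rw [sq_zero]
        exact ((mem_carpet_iff hp hop z).1 h1).1
      · intro z hz hz'
        have hz1 : z ∉ sierpinskiCarpet p := fun h => hz' ⟨h, fun h2 => h2.2 hz⟩
        obtain ⟨c, hc, hzc⟩ := exists_cell_of_not_mem hp hop
          (sq_zero p ▸ osq_subset_sq _ _ hz) hz1
        exact ⟨c, hc, by simp, hzc⟩
    | some c =>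
      have hpk : (0:ℝ) < (p:ℝ) ^ (mid p c).1 := by positivity
      have h00 := sq_mid_subset_osq_zero hp hd
        ((relPt_mem_sq hp0 (mid p c) 0 0).2 (by norm_num))
      have h11 := sq_mid_subset_osq_zero hp hd
        ((relPt_mem_sq hp0 (mid p c) 1 1).2 (by norm_num))
      simp only [osq, mem_ofPred_eq, pow_zero, one_mul, Nat.cast_zero, zero_add, relPt] at h00 h11
      refine ⟨unitSq \ sq p (mid p c), ?_, ?_, ?_⟩
      · have h := isPreconnected_diff_box (Y := unitSq) (sq_zero p ▸ convex_sq p _)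
          (u₀ := 0) (u₁ := 1) (v₀ := 0) (v₁ := 1) h00.1.1 h11.1.2 h00.2.1 h11.2.2
          (by simp [unitSq]) (by simp [unitSq]) (by simp [unitSq])
        convert h using 2
        ext z
        simp only [sq, mem_ofPred_eq]
        rw [div_le_iff₀' hpk, le_div_iff₀' hpk, div_le_iff₀' hpk, le_div_iff₀' hpk]
        simp
      · rintro z ⟨h1, h2⟩
        have h3 := (mem_carpet_iff hp hop z).1 h1
        exact ⟨h3.1, fun h4 => h2 ⟨h4, h3.2 c⟩⟩
      · rintro z ⟨hz1, hz2⟩ hz'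
        have hz3 : z ∉ sierpinskiCarpet p := fun h => hz' ⟨h, fun h2 => hz2 h2.1⟩
        obtain ⟨c', hc', hzc⟩ := exists_cell_of_not_mem hp hop hz1 hz3
        refine ⟨c', hc', fun h => hz2 ?_, hzc⟩
        rw [← Option.some.inj h]
        exact osq_subset_sq _ _ hzc
  set s := sierpinskiCarpet p \ perO p d with hs
  have hbds : ∀ c, IsCell p c → some c ≠ d → bd p (mid p c) ⊆ s := by
    intro c hc hcd z hz
    exact ⟨per_subset_carpet hp hop hc hz, fun h => hcd (perO_disjoint hp (d := some c) hc hd hz h)⟩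
  -- enlarge a relatively closed piece by the holes it surrounds
  let E : Set ℂ → Set ℂ := fun t => (s ∩ t) ∪
    {z | ∃ c, IsCell p c ∧ some c ≠ d ∧ bd p (mid p c) ⊆ t ∧ z ∈ osq p (mid p c)}
  have hE : ∀ t, IsClosed t → X ∩ closure (E t) ⊆ E t := by
    rintro t ht z ⟨hzX, hzcl⟩
    by_cases hzs : z ∈ s
    · by_cases hzt : z ∈ t
      · exact Or.inl ⟨hzs, hzt⟩
      · exfalso
        obtain ⟨ε, hε, hball⟩ := Metric.isOpen_iff.1 ht.isOpen_compl z hzt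
        obtain ⟨w, hw, hwz⟩ := Metric.mem_closure_iff.1 hzcl ε hε
        have hwb : w ∈ ball z ε := by rwa [mem_ball, dist_comm]
        rcases hw with hw | ⟨c, hc, hcd, hct, hwc⟩
        · exact hball hwb hw.2
        · obtain ⟨x, hx, hxb⟩ := segment_inter_bd hwc
            (((mem_carpet_iff hp hop z).1 hzs.1).2 c)
          exact hball ((convex_ball z ε).segment_subset hwb (mem_ball_self hε) hx) (hct hxb)
    · obtain ⟨c, hc, hcd, hzc⟩ := hXs z hzX hzs
      obtain ⟨w, hw1, hw2⟩ := mem_closure_iff.1 hzcl _ (isOpen_osq p _) hzc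
      rcases hw2 with hw2 | ⟨c', hc', hcd', hct', hwc'⟩
      · exact absurd hw1 (((mem_carpet_iff hp hop w).1 hw2.1.1).2 c)
      · have := mid_eq_of_mem hp hc hc' (osq_subset_sq _ _ hw1) (osq_subset_sq _ _ hwc')
        subst this
        exact Or.inr ⟨c, hc, hcd, hct', hzc⟩
  rw [isPreconnected_closed_iff]
  intro t t' ht ht' hst hnt hnt'
  by_contra hcon
  have hcon' : ∀ z ∈ s, z ∈ t → z ∈ t' → False := fun z h1 h2 h3 => hcon ⟨z, h1, h2, h3⟩
  have hcov : X ⊆ closure (E t) ∪ closure (E t') := by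
    intro z hz
    by_cases hzs : z ∈ s
    · rcases hst hzs with h | h
      · exact Or.inl (subset_closure (Or.inl ⟨hzs, h⟩))
      · exact Or.inr (subset_closure (Or.inl ⟨hzs, h⟩))
    · obtain ⟨c, hc, hcd, hzc⟩ := hXs z hz hzs
      have hb := hbds c hc hcd
      have : bd p (mid p c) ⊆ t ∨ bd p (mid p c) ⊆ t' := by
        refine isPreconnected_iff_subset_of_disjoint_closed.1 (isPreconnected_bd hp0 _) t t' ht ht'
          (hb.trans hst) ?_
        ext z
        simp only [mem_inter_iff, mem_empty_iff_false, iff_false]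
        exact fun h => hcon' z (hb h.1) h.2.1 h.2.2
      rcases this with h | h
      · exact Or.inl (subset_closure (Or.inr ⟨c, hc, hcd, h, hzc⟩))
      · exact Or.inr (subset_closure (Or.inr ⟨c, hc, hcd, h, hzc⟩))
  obtain ⟨x, hx⟩ := hnt
  obtain ⟨x', hx'⟩ := hnt'
  obtain ⟨z, hzX, hz1, hz2⟩ := isPreconnected_closed_iff.1 hX _ _ isClosed_closure
    isClosed_closure hcov ⟨x, hsX hx.1, subset_closure (Or.inl hx)⟩
    ⟨x', hsX hx'.1, subset_closure (Or.inl hx')⟩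
  rcases hE t ht ⟨hzX, hz1⟩ with h1 | ⟨c, hc, hcd, hct, hzc⟩ <;>
  rcases hE t' ht' ⟨hzX, hz2⟩ with h2 | ⟨c', hc', hcd', hct', hzc'⟩
  · exact hcon' z h1.1 h1.2 h2.2
  · exact ((mem_carpet_iff hp hop z).1 h1.1.1).2 _ hzc'
  · exact ((mem_carpet_iff hp hop z).1 h2.1.1).2 _ hzc
  · have := mid_eq_of_mem hp hc hc' (osq_subset_sq _ _ hzc) (osq_subset_sq _ _ hzc')
    subst this
    obtain ⟨y, hy⟩ := bd_nonempty hp0 (mid p c)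
    exact hcon' y (hbds c hc hcd hy) (hct hy) (hct' hy)

/-- Weak quasisymmetry with arbitrary parameters on a subset of the plane. -/
def WQS (S : Set ℂ) (F : ℂ → ℂ) : Prop :=
  ∀ t : ℝ, ∃ T : ℝ, 0 < T ∧ ∀ u ∈ S, ∀ v ∈ S, ∀ w ∈ S,
    dist u v ≤ t * dist u w → dist (F u) (F v) ≤ T * dist (F u) (F w)

/-- A pair of mutually inverse weakly quasisymmetric homeomorphisms between carpets. -/
structure QSPair (p q : ℕ) (F G : ℂ → ℂ) : Prop where
  contF : ContinuousOn F (sierpinskiCarpet p)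
  contG : ContinuousOn G (sierpinskiCarpet q)
  mapsF : MapsTo F (sierpinskiCarpet p) (sierpinskiCarpet q)
  mapsG : MapsTo G (sierpinskiCarpet q) (sierpinskiCarpet p)
  leftInv : ∀ z ∈ sierpinskiCarpet p, G (F z) = z
  rightInv : ∀ z ∈ sierpinskiCarpet q, F (G z) = z
  wqsF : WQS (sierpinskiCarpet p) F
  wqsG : WQS (sierpinskiCarpet q) G

lemma QSPair.symm {p q : ℕ} {F G : ℂ → ℂ} (h : QSPair p q F G) : QSPair q p G F :=
  ⟨h.contG, h.contF, h.mapsG, h.mapsF, h.rightInv, h.leftInv, h.wqsG, h.wqsF⟩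

/-- A quasisymmetric homeomorphism of carpets induces a `QSPair`. -/
lemma exists_qsPair {p q : ℕ} (f : ↥(sierpinskiCarpet p) ≃ₜ ↥(sierpinskiCarpet q))
    (hf : IsQSMap f) : ∃ F G, QSPair p q F G := by
  classical
  obtain ⟨η, ⟨-, hmono, h0, hsurj⟩, hη⟩ := hf
  let F : ℂ → ℂ := fun z => if h : z ∈ sierpinskiCarpet p then f ⟨z, h⟩ else 0
  let G : ℂ → ℂ := fun z => if h : z ∈ sierpinskiCarpet q then f.symm ⟨z, h⟩ else 0
  have hF : ∀ z : ↥(sierpinskiCarpet p), F z = f z := fun z => dif_pos z.2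
  have hG : ∀ z : ↥(sierpinskiCarpet q), G z = f.symm z := fun z => dif_pos z.2
  have hGF : ∀ z : ↥(sierpinskiCarpet p), G (F z) = z := fun z => by
    rw [hF, hG, f.symm_apply_apply]
  refine ⟨F, G, ?_, ?_, ?_, ?_, ?_, ?_, ?_, ?_⟩
  · rw [continuousOn_iff_continuous_domRestrict]
    have : (sierpinskiCarpet p).domRestrict F = fun z => (f z : ℂ) := funext hF
    rw [this]
    fun_prop
  · rw [continuousOn_iff_continuous_domRestrict]
    have : (sierpinskiCarpet q).domRestrict G = fun z => (f.symm z : ℂ) := funext hG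
    rw [this]
    fun_prop
  · intro z hz
    rw [hF ⟨z, hz⟩]
    exact (f _).2
  · intro z hz
    rw [hG ⟨z, hz⟩]
    exact (f.symm _).2
  · exact fun z hz => hGF ⟨z, hz⟩
  · intro z hz
    rw [hG ⟨z, hz⟩, hF, f.apply_symm_apply]
  · intro t
    refine ⟨|η t| + 1, by positivity, ?_⟩
    intro u hu v hv w hw hle
    rw [hF ⟨u, hu⟩, hF ⟨v, hv⟩, hF ⟨w, hw⟩]
    by_cases huw : u = w
    · subst huw
      rw [dist_self, mul_zero] at hle
      have := dist_le_zero.1 hle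
      subst this
      simp
    · have hpos : 0 < dist u w := dist_pos.2 huw
      have h1 := hη ⟨u, hu⟩ ⟨v, hv⟩ ⟨w, hw⟩ (fun h => huw (congrArg Subtype.val h))
      refine h1.trans (mul_le_mul_of_nonneg_right ?_ dist_nonneg)
      have h2 : dist u v / dist u w ≤ t := (div_le_iff₀ hpos).2 hle
      have h3 : (0:ℝ) ≤ dist u v / dist u w := by positivity
      have h4 := hmono.monotoneOn (mem_Ici.2 h3) (mem_Ici.2 (h3.trans h2)) h2
      exact h4.trans ((le_abs_self _).trans (by linarith))
  · intro t
    have ht : (0:ℝ) < 1 / (|t| + 2) := by positivity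
    obtain ⟨s, hs, hst⟩ := hsurj (mem_Ici.2 ht.le)
    have hs0 : 0 < s := by
      refine lt_of_le_of_ne hs ?_
      rintro rfl
      rw [h0] at hst
      exact ht.ne hst
    refine ⟨1 / s, by positivity, ?_⟩
    intro u' hu' v' hv' w' hw' hle
    obtain ⟨u, hu⟩ : ∃ u, f u = ⟨u', hu'⟩ := ⟨f.symm _, f.apply_symm_apply _⟩
    obtain ⟨v, hv⟩ : ∃ v, f v = ⟨v', hv'⟩ := ⟨f.symm _, f.apply_symm_apply _⟩
    obtain ⟨w, hw⟩ : ∃ w, f w = ⟨w', hw'⟩ := ⟨f.symm _, f.apply_symm_apply _⟩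
    rw [hG ⟨u', hu'⟩, hG ⟨v', hv'⟩, hG ⟨w', hw'⟩, ← hu, ← hv, ← hw]
    simp only [f.symm_apply_apply]
    have hle' : dist (f u) (f v) ≤ t * dist (f u) (f w) := by rw [hu, hv, hw]; exact hle
    change dist u v ≤ 1 / s * dist u w
    by_contra hcon
    push Not at hcon
    have huv : u ≠ v := by
      rintro rfl
      rw [dist_self] at hcon
      have : 0 ≤ 1 / s * dist u w := by positivity
      linarith
    have hpos : 0 < dist u v := dist_pos.2 huv
    have h1 := hη u w v huv
    have h2 : dist u w / dist u v ≤ s := by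
      rw [div_le_iff₀ hpos]
      have : s * (1 / s * dist u w) = dist u w := by field_simp
      nlinarith
    have h3 : (0:ℝ) ≤ dist u w / dist u v := by positivity
    have h4 := hmono.monotoneOn (mem_Ici.2 h3) hs h2
    rw [hst] at h4
    have h5 : dist (f u) (f w) ≤ 1 / (|t| + 2) * (|t| * dist (f u) (f w)) := by
      refine h1.trans (mul_le_mul h4 (hle'.trans ?_) dist_nonneg ht.le)
      exact mul_le_mul_of_nonneg_right (le_abs_self t) dist_nonneg
    have h6 : dist (f u) (f w) ≤ 0 := by
      have h7 : 1 / (|t| + 2) * (|t| * dist (f u) (f w)) * (|t| + 2)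
          = |t| * dist (f u) (f w) := by field_simp
      have h8 := mul_le_mul_of_nonneg_right h5 (by positivity : (0:ℝ) ≤ |t| + 2)
      rw [h7] at h8
      linarith
    have h9 : dist (f u) (f w) = 0 := le_antisymm h6 dist_nonneg
    rw [h9, mul_zero] at hle'
    exact huv (f.injective (dist_le_zero.1 hle'))

lemma QSPair.image_perO_superset {p q : ℕ} (hp : 3 ≤ p) (hop : Odd p) (hq : 3 ≤ q) (hoq : Odd q)
    {F G : ℂ → ℂ} (h : QSPair p q F G) {d : Option Idx} (hd : ValidO p d) :
    ∃ d', ValidO q d' ∧ perO q d' ⊆ F '' perO p d := by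
  have hp0 : 0 < p := by omega
  have hq0 : 0 < q := by omega
  have hsub := perO_subset hp hop hd
  have hinj : InjOn F (sierpinskiCarpet p) := fun x hx y hy hxy => by
    rw [← h.leftInv x hx, ← h.leftInv y hy, hxy]
  obtain ⟨c, hc⟩ : ∃ c, perO p d = bd p c := by
    cases d with
    | none => exact ⟨_, rfl⟩
    | some c => exact ⟨_, rfl⟩
  obtain ⟨a, b, hab, α, β, hαβ, hins⟩ := exists_paths_bd hp0 c
  rw [← hc] at hαβ
  have hα : range α ⊆ sierpinskiCarpet p := fun x hx => hsub (hαβ ▸ Or.inl hx)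
  have hβ : range β ⊆ sierpinskiCarpet p := fun x hx => hsub (hαβ ▸ Or.inr hx)
  have ha := hα ⟨0, α.source⟩
  have hb := hα ⟨1, α.target⟩
  let α' := α.map' (h.contF.mono hα)
  let β' := β.map' (h.contF.mono hβ)
  have hα' : range α' = F '' range α := by rw [← range_comp]; rfl
  have hβ' : range β' = F '' range β := by rw [← range_comp]; rfl
  set K := F '' perO p d with hK
  have hKun : range α' ∪ range β' = K := by rw [hα', hβ', ← image_union, hαβ]
  have hKS : K ⊆ sierpinskiCarpet q := by
    rintro _ ⟨x, hx, rfl⟩; exact h.mapsF (hsub hx)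
  have hnp := not_isPreconnected_compl_of_paths (fun e => hab (hinj ha hb e)) α' β' (by
    rw [hα', hβ', ← hinj.image_inter hα hβ]
    rintro _ ⟨x, hx, rfl⟩
    rcases hins hx with rfl | hx
    · exact Or.inl rfl
    · rw [mem_singleton_iff.1 hx]; exact Or.inr rfl)
  rw [hKun, isPreconnected_iff_subset_of_disjoint] at hnp
  push Not at hnp
  obtain ⟨u, v, hu, hv, huv, hdisj, hnu, hnv⟩ := hnp
  have hpre : IsPreconnected (sierpinskiCarpet q \ K) := by
    have e : sierpinskiCarpet q \ K = F '' (sierpinskiCarpet p \ perO p d) := by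
      ext z
      constructor
      · rintro ⟨h1, h2⟩
        exact ⟨G z, ⟨h.mapsG h1, fun h3 => h2 ⟨_, h3, h.rightInv z h1⟩⟩, h.rightInv z h1⟩
      · rintro ⟨x, ⟨h1, h2⟩, rfl⟩
        refine ⟨h.mapsF h1, ?_⟩
        rintro ⟨y, hy, hxy⟩
        exact h2 (hinj (hsub hy) h1 hxy ▸ hy)
    rw [e]
    exact (isPreconnected_diff_perO hp hop hd).image _ (h.contF.mono sdiff_subset)
  have key : ∀ u v : Set ℂ, IsOpen u → IsOpen v → Kᶜ ⊆ u ∪ v → Kᶜ ∩ (u ∩ v) = ∅ → ¬ Kᶜ ⊆ v →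
      sierpinskiCarpet q \ K ⊆ v → ∃ d', ValidO q d' ∧ perO q d' ⊆ K := by
    intro u v hu hv huv hdisj hnv hSv
    obtain ⟨z, hzK, hzv⟩ := not_subset.1 hnv
    have hzu : z ∈ u := (huv hzK).resolve_right hzv
    have hzS : z ∉ sierpinskiCarpet q := fun hh => hzv (hSv ⟨hh, hzK⟩)
    obtain ⟨d', hd', hzd⟩ := exists_regO hq hoq hzS
    refine ⟨d', hd', fun x hx => ?_⟩
    by_contra hxK
    have hxv : x ∈ v := hSv ⟨perO_subset hq hoq hd' hx, hxK⟩
    have hDK : regO q d' ⊆ Kᶜ := fun y hy hyK => regO_disjoint_carpet hq hoq hy (hKS hyK)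
    have hDu : regO q d' ⊆ u := by
      rcases isPreconnected_iff_subset_of_disjoint.1 (isPreconnected_regO q d') u v hu hv
        (hDK.trans huv) (by
          rw [← subset_empty_iff, ← hdisj]; exact inter_subset_inter_left _ hDK) with h | h
      · exact h
      · exact absurd (h hzd) hzv
    obtain ⟨y, hyv, hyD⟩ := mem_closure_iff.1 (perO_subset_closure hq0 d' hx) v hv hxv
    have : y ∈ Kᶜ ∩ (u ∩ v) := ⟨hDK hyD, hDu hyD, hyv⟩
    rw [hdisj] at this
    exact this
  rcases isPreconnected_iff_subset_of_disjoint.1 hpre u v hu hv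
    ((fun x hx => huv hx.2)) (by
      rw [← subset_empty_iff, ← hdisj]; exact inter_subset_inter_left _ (fun x hx => hx.2)) with h1 | h1
  · exact key v u hv hu (by rwa [union_comm]) (by rwa [inter_comm v u]) hnu h1
  · exact key u v hu hv huv hdisj hnv h1

/-- Homeomorphisms of carpets permute peripheral squares. -/
theorem QSPair.image_perO {p q : ℕ} (hp : 3 ≤ p) (hop : Odd p) (hq : 3 ≤ q) (hoq : Odd q)
    {F G : ℂ → ℂ} (h : QSPair p q F G) {d : Option Idx} (hd : ValidO p d) :
    ∃ d', ValidO q d' ∧ F '' perO p d = perO q d' := by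
  obtain ⟨d', hd', hsub⟩ := h.image_perO_superset hp hop hq hoq hd
  obtain ⟨d'', hd'', hsub'⟩ := h.symm.image_perO_superset hq hoq hp hop hd'
  obtain ⟨x, hx⟩ := perO_nonempty (by omega : 0 < p) d''
  have hmem : ∀ y ∈ perO q d', G y ∈ perO p d := by
    intro y hy
    obtain ⟨z, hz, rfl⟩ := hsub hy
    rw [h.leftInv z (perO_subset hp hop hd hz)]
    exact hz
  obtain ⟨y, hy, rfl⟩ := hsub' hx
  have e := perO_disjoint hp hd'' hd hx (hmem y hy)
  subst e
  refine ⟨d', hd', subset_antisymm ?_ hsub⟩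
  rintro _ ⟨z, hz, rfl⟩
  obtain ⟨w, hw, rfl⟩ := hsub' hz
  rw [h.rightInv w (perO_subset hq hoq hd' hw)]
  exact hw

open Classical in
/-- The deepest cell containing the level-`n` grid square `(j, i)` in its middle square,
or the square itself when it is solid. -/
noncomputable def own (p n j i : ℕ) : Idx :=
  (n - Nat.findGreatest (fun K => 0 < K ∧ (j / p ^ (K - 1)) % p = p / 2 ∧
      (i / p ^ (K - 1)) % p = p / 2) n,
    j / p ^ Nat.findGreatest (fun K => 0 < K ∧ (j / p ^ (K - 1)) % p = p / 2 ∧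
      (i / p ^ (K - 1)) % p = p / 2) n,
    i / p ^ Nat.findGreatest (fun K => 0 < K ∧ (j / p ^ (K - 1)) % p = p / 2 ∧
      (i / p ^ (K - 1)) % p = p / 2) n)

lemma own_spec (p n j i : ℕ) : ∃ K ≤ n, own p n j i = (n - K, j / p ^ K, i / p ^ K) ∧
    (K ≠ 0 → (j / p ^ (K - 1)) % p = p / 2 ∧ (i / p ^ (K - 1)) % p = p / 2) ∧
    ∀ K', K < K' → K' ≤ n → ¬ ((j / p ^ (K' - 1)) % p = p / 2 ∧ (i / p ^ (K' - 1)) % p = p / 2) := by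
  classical
  refine ⟨_, Nat.findGreatest_le n, rfl, fun h => ?_, fun K' h1 h2 h3 => ?_⟩
  · have := Nat.findGreatest_of_ne_zero (P := fun K => 0 < K ∧ (j / p ^ (K - 1)) % p = p / 2 ∧
      (i / p ^ (K - 1)) % p = p / 2) rfl h
    exact this.2
  · exact Nat.findGreatest_is_greatest h1 h2 ⟨by omega, h3⟩

lemma div_pow_lt {p n K j : ℕ} (hK : K ≤ n) (hj : j < p ^ n) : j / p ^ K < p ^ (n - K) := by
  apply Nat.div_lt_of_lt_mul
  rwa [← pow_add, Nat.add_sub_cancel' hK]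

lemma own_isCell {p n j i : ℕ} (hj : j < p ^ n) (hi : i < p ^ n) :
    IsCell p (own p n j i) ∧ (own p n j i).1 ≤ n := by
  obtain ⟨K, hK, e, h1, h2⟩ := own_spec p n j i
  rw [e]
  refine ⟨⟨div_pow_lt hK hj, div_pow_lt hK hi, ?_⟩, Nat.sub_le _ _⟩
  intro k hk
  have hk : k < n - K := hk
  have := h2 (K + k + 1) (by omega) (by omega)
  rw [Nat.add_sub_cancel, pow_add] at this
  simpa [Nat.div_div_eq_div_mul] using this

lemma own_of_isCell {p n j i : ℕ} (h : IsCell p (n, j, i)) : own p n j i = (n, j, i) := by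
  obtain ⟨K, hK, e, h1, h2⟩ := own_spec p n j i
  rcases Nat.eq_zero_or_pos K with rfl | h0
  · simpa using e
  · exact absurd (h1 h0.ne') (h.2.2 (K - 1) (by simp only; omega))

lemma own_of_level {p n j i : ℕ} (h : (own p n j i).1 = n) : own p n j i = (n, j, i) := by
  obtain ⟨K, hK, e, h1, h2⟩ := own_spec p n j i
  rw [e] at h
  have : K = 0 := by simp only at h; omega
  subst this
  simpa using e

lemma own_eq_iff {p n j i : ℕ} (hp : 3 ≤ p) {c : Idx} (hc : IsCell p c) (hn : c.1 < n) :
    own p n j i = c ↔ j / p ^ (n - c.1 - 1) = p * c.2.1 + p / 2 ∧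
      i / p ^ (n - c.1 - 1) = p * c.2.2 + p / 2 := by
  obtain ⟨K, hK, e, h1, h2⟩ := own_spec p n j i
  have hmid : p / 2 < p := by omega
  have hdm : ∀ j K : ℕ, 0 < K → (j / p ^ (K - 1)) % p = p / 2 →
      j / p ^ (K - 1) = p * (j / p ^ K) + p / 2 := by
    intro j K hK h
    obtain ⟨K, rfl⟩ : ∃ k, K = k + 1 := ⟨K - 1, by omega⟩
    rw [Nat.add_sub_cancel] at h ⊢
    rw [pow_succ, ← Nat.div_div_eq_div_mul, ← h]
    exact (Nat.div_add_mod _ _).symm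
  constructor
  · rintro rfl
    rw [e] at hn ⊢
    simp only at hn ⊢
    have hK0 : 0 < K := by omega
    have e2 : n - (n - K) - 1 = K - 1 := by omega
    rw [e2]
    exact ⟨hdm j K hK0 (h1 hK0.ne').1, hdm i K hK0 (h1 hK0.ne').2⟩
  · rintro ⟨hj, hi⟩
    have hdv : ∀ j a, j / p ^ (n - c.1 - 1) = p * a + p / 2 → j / p ^ (n - c.1) = a := by
      intro j a h
      have : n - c.1 = n - c.1 - 1 + 1 := by omega
      rw [this, pow_succ, ← Nat.div_div_eq_div_mul, h, Nat.mul_add_div (by omega),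
        Nat.div_eq_of_lt hmid, add_zero]
    have hK' : K = n - c.1 := by
      apply le_antisymm
      · by_contra hlt
        push Not at hlt
        have h3 := h1 (by omega)
        have hex : K - 1 = (n - c.1) + (K - 1 - (n - c.1)) := by omega
        rw [hex, pow_add, ← Nat.div_div_eq_div_mul, ← Nat.div_div_eq_div_mul, hdv j _ hj,
          hdv i _ hi] at h3
        exact hc.2.2 _ (by omega) h3
      · by_contra hlt
        push Not at hlt
        refine h2 (n - c.1) hlt (by omega) ?_
        rw [hj, hi]
        simp [Nat.mod_eq_of_lt hmid]
    rw [e, hK', hdv j _ hj, hdv i _ hi]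
    ext <;> simp
    omega

open Classical in
/-- Cells of level less than `n`. -/
noncomputable def cellsLt (p n : ℕ) : Finset Idx :=
  (Finset.range n ×ˢ Finset.range (p ^ n) ×ˢ Finset.range (p ^ n)).filter (IsCell p)

/-- Cells of level `n`. -/
noncomputable def cellsEq (p n : ℕ) : Finset Idx := (cellsLt p (n + 1)).filter (fun c => c.1 = n)

lemma mem_cellsLt {p n : ℕ} (hp : 0 < p) {c : Idx} : c ∈ cellsLt p n ↔ IsCell p c ∧ c.1 < n := by
  classical
  simp only [cellsLt, Finset.mem_filter, Finset.mem_product, Finset.mem_range]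
  constructor
  · rintro ⟨⟨h1, h2, h3⟩, h4⟩
    exact ⟨h4, h1⟩
  · rintro ⟨h1, h2⟩
    have := Nat.pow_le_pow_right hp h2.le
    exact ⟨⟨h2, h1.1.trans_le this, h1.2.1.trans_le this⟩, h1⟩

lemma mem_cellsEq {p n : ℕ} (hp : 0 < p) {c : Idx} : c ∈ cellsEq p n ↔ IsCell p c ∧ c.1 = n := by
  rw [cellsEq, Finset.mem_filter, mem_cellsLt hp]
  constructor
  · rintro ⟨⟨h1, h2⟩, h3⟩; exact ⟨h1, h3⟩
  · rintro ⟨h1, h3⟩; exact ⟨⟨h1, by omega⟩, h3⟩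

/-- Side of the hole of `c` in units of the level-`n` grid. -/
def blk (p n : ℕ) (c : Idx) : ℕ := p ^ (n - c.1 - 1)

/-- Range of level-`n` grid indices covered by the middle part of index `a`. -/
def rng (p n : ℕ) (c : Idx) (a : ℕ) : Finset ℕ :=
  Finset.Ico ((p * a + p / 2) * blk p n c) ((p * a + p / 2) * blk p n c + blk p n c)

lemma mem_rng {p n : ℕ} (hp : 0 < p) {c : Idx} {a j : ℕ} :
    j ∈ rng p n c a ↔ j / p ^ (n - c.1 - 1) = p * a + p / 2 := by
  have : 0 < p ^ (n - c.1 - 1) := by positivity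
  rw [rng, Finset.mem_Ico, blk, Nat.div_eq_iff this]
  omega

lemma rng_lt {p n : ℕ} (hp : 3 ≤ p) {c : Idx} {a j : ℕ} (ha : a < p ^ c.1) (hn : c.1 < n)
    (hj : j ∈ rng p n c a) : j < p ^ n := by
  have h1 := mul_add_mid_lt hp ha
  rw [rng, Finset.mem_Ico, blk] at hj
  have h2 : (p * a + p / 2 + 1) * p ^ (n - c.1 - 1) ≤ p ^ (c.1 + 1) * p ^ (n - c.1 - 1) :=
    Nat.mul_le_mul_right _ h1
  rw [← pow_add, (by omega : c.1 + 1 + (n - c.1 - 1) = n)] at h2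
  rw [add_mul, one_mul] at h2
  omega

/-- Splitting a sum over the level-`n` grid into holes and solid squares. -/
theorem sum_grid_eq {p : ℕ} (hp : 3 ≤ p) (n : ℕ) (F : ℕ → ℕ → ℝ) :
    ∑ j ∈ Finset.range (p ^ n), ∑ i ∈ Finset.range (p ^ n), F j i =
      ∑ c ∈ cellsLt p n, ∑ j ∈ rng p n c c.2.1, ∑ i ∈ rng p n c c.2.2, F j i +
        ∑ c ∈ cellsEq p n, F c.2.1 c.2.2 := by
  classical
  have hp0 : 0 < p := by omega
  rw [← Finset.sum_product' (f := F)]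
  rw [← Finset.sum_fiberwise_of_maps_to (g := fun x : ℕ × ℕ => own p n x.1 x.2)
    (t := cellsLt p (n + 1))]
  swap
  · rintro ⟨j, i⟩ h
    rw [Finset.mem_product, Finset.mem_range, Finset.mem_range] at h
    have := own_isCell h.1 h.2
    rw [mem_cellsLt hp0]
    exact ⟨this.1, Nat.lt_succ_of_le this.2⟩
  rw [← Finset.sum_filter_add_sum_filter_not (cellsLt p (n + 1)) (fun c => c.1 < n)]
  congr 1
  · have e : (cellsLt p (n + 1)).filter (fun c => c.1 < n) = cellsLt p n := by
      ext c
      rw [Finset.mem_filter, mem_cellsLt hp0, mem_cellsLt hp0]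
      constructor
      · rintro ⟨⟨h1, -⟩, h2⟩; exact ⟨h1, h2⟩
      · rintro ⟨h1, h2⟩; exact ⟨⟨h1, by omega⟩, h2⟩
    rw [e]
    refine Finset.sum_congr rfl fun c hc => ?_
    rw [mem_cellsLt hp0] at hc
    rw [← Finset.sum_product' (f := F)]
    refine Finset.sum_congr ?_ fun _ _ => rfl
    ext ⟨j, i⟩
    simp only [Finset.mem_filter, Finset.mem_product, Finset.mem_range]
    rw [own_eq_iff hp hc.1 hc.2, ← mem_rng hp0, ← mem_rng hp0]
    constructor
    · exact fun h => h.2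
    · exact fun h => ⟨⟨rng_lt hp hc.1.1 hc.2 h.1, rng_lt hp hc.1.2.1 hc.2 h.2⟩, h⟩
  · have e : (cellsLt p (n + 1)).filter (fun c => ¬ c.1 < n) = cellsEq p n := by
      ext c
      rw [Finset.mem_filter, mem_cellsLt hp0, mem_cellsEq hp0]
      constructor
      · rintro ⟨⟨h1, h3⟩, h2⟩; exact ⟨h1, by omega⟩
      · rintro ⟨h1, h2⟩; exact ⟨⟨h1, by omega⟩, by omega⟩
    rw [e]
    refine Finset.sum_congr rfl fun c hc => ?_
    rw [mem_cellsEq hp0] at hc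
    obtain ⟨hc, hcn⟩ := hc
    obtain ⟨m, a, b⟩ := c
    simp only at hcn
    subst hcn
    have : Finset.filter (fun x : ℕ × ℕ => own p m x.1 x.2 = (m, a, b))
        (Finset.range (p ^ m) ×ˢ Finset.range (p ^ m)) = {(a, b)} := by
      ext ⟨j, i⟩
      simp only [Finset.mem_filter, Finset.mem_product, Finset.mem_range, Finset.mem_singleton]
      constructor
      · rintro ⟨-, h⟩
        have := own_of_level (p := p) (n := m) (j := j) (i := i) (by rw [h])
        rw [h] at this
        simpa using this.symm
      · intro h
        obtain ⟨rfl, rfl⟩ := Prod.mk.inj h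
        exact ⟨⟨hc.1, hc.2.1⟩, own_of_isCell hc⟩
    rw [this, Finset.sum_singleton]

/-- Side length of the hole of `c`. -/
noncomputable def hs (p : ℕ) (c : Idx) : ℝ := 1 / (p:ℝ) ^ (c.1 + 1)

lemma hs_pos {p : ℕ} (hp : 0 < p) (c : Idx) : 0 < hs p c := by unfold hs; positivity

lemma blk_mul {p n : ℕ} (hp : 0 < p) {c : Idx} (hn : c.1 < n) :
    (blk p n c : ℝ) * (1 / (p:ℝ) ^ n) = hs p c := by
  have : (p:ℝ) ^ n = (p:ℝ) ^ (n - c.1 - 1) * (p:ℝ) ^ (c.1 + 1) := by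
    rw [← pow_add]; congr 1; omega
  unfold blk hs
  rw [this]
  push_cast
  have h1 : (p:ℝ) ^ (n - c.1 - 1) ≠ 0 := by positivity
  have h2 : (p:ℝ) ^ (c.1 + 1) ≠ 0 := by positivity
  field_simp

open MeasureTheory in
/-- Area estimate: holes of distinct cells contained in a box. -/
theorem sum_sq_hs_le {p : ℕ} (hp : 3 ≤ p) (E : Finset Idx) (hE : ∀ c ∈ E, IsCell p c)
    {x y D : ℝ} (hD : 0 ≤ D)
    (hbox : ∀ c ∈ E, ∀ z ∈ osq p (mid p c), (x ≤ z.re ∧ z.re ≤ x + D) ∧ (y ≤ z.im ∧ z.im ≤ y + D)) :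
    ∑ c ∈ E, hs p c ^ 2 ≤ D ^ 2 := by
  have hp0 : 0 < p := by omega
  let R : Idx → Set (ℝ × ℝ) := fun c =>
    Ioo (((mid p c).2.1:ℝ) / (p:ℝ) ^ (c.1 + 1)) (((mid p c).2.1 + 1:ℝ) / (p:ℝ) ^ (c.1 + 1)) ×ˢ
    Ioo (((mid p c).2.2:ℝ) / (p:ℝ) ^ (c.1 + 1)) (((mid p c).2.2 + 1:ℝ) / (p:ℝ) ^ (c.1 + 1))
  have hR : ∀ c (w : ℝ × ℝ), w ∈ R c ↔ (⟨w.1, w.2⟩ : ℂ) ∈ osq p (mid p c) := by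
    intro c w
    have : (0:ℝ) < (p:ℝ) ^ (c.1 + 1) := by positivity
    simp only [R, mem_prod, mem_Ioo, osq, mem_ofPred_eq, div_lt_iff₀' this, lt_div_iff₀' this]
    rfl
  have hvol : ∀ c, volume (R c) = ENNReal.ofReal (hs p c ^ 2) := by
    intro c
    have h1 : (0:ℝ) < (p:ℝ) ^ (c.1 + 1) := by positivity
    have e : ∀ A : ℝ, (A + 1) / (p:ℝ) ^ (c.1 + 1) - A / (p:ℝ) ^ (c.1 + 1) = hs p c := by
      intro A; unfold hs; field_simp; ring
    simp only [R]
    rw [Measure.volume_eq_prod, Measure.prod_prod, Real.volume_Ioo, Real.volume_Ioo, e, e,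
      ← ENNReal.ofReal_mul (hs_pos hp0 c).le, pow_two]
  have hdis : (E : Set Idx).PairwiseDisjoint R := by
    intro c hc c' hc' hne
    rw [Function.onFun, Set.disjoint_left]
    intro w hw hw'
    exact hne (mid_eq_of_mem hp (hE c hc) (hE c' hc') (osq_subset_sq _ _ ((hR c w).1 hw))
      (osq_subset_sq _ _ ((hR c' w).1 hw')))
  have hm : ∀ c ∈ E, MeasurableSet (R c) := fun c _ => measurableSet_Ioo.prod measurableSet_Ioo
  have h1 := measure_biUnion_finset (μ := volume) hdis hm
  have h2 : volume (⋃ c ∈ E, R c) ≤ volume (Icc x (x + D) ×ˢ Icc y (y + D)) := by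
    refine measure_mono ?_
    intro w hw
    simp only [mem_iUnion] at hw
    obtain ⟨c, hc, hw⟩ := hw
    have := hbox c hc _ ((hR c w).1 hw)
    exact ⟨this.1, this.2⟩
  rw [h1, Measure.volume_eq_prod, Measure.prod_prod, Real.volume_Icc, Real.volume_Icc,
    add_sub_cancel_left, add_sub_cancel_left, ← ENNReal.ofReal_mul hD] at h2
  simp only [← Measure.volume_eq_prod, hvol] at h2
  rw [← ENNReal.ofReal_sum_of_nonneg (fun c _ => sq_nonneg _),
    ENNReal.ofReal_le_ofReal_iff (by positivity)] at h2
  rw [pow_two D]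
  exact h2

/-- Combinatorial data extracted from a quasisymmetric embedding: `lp c` is the side of the image
of the hole of `c`, `Y0 c` its lowest height and `Y` the height function. -/
structure Core (p : ℕ) (lp Y0 : Idx → ℝ) (Y : ℂ → ℝ) (A C₂ c₀ : ℝ) : Prop where
  one_le_A : 1 ≤ A
  C₂_pos : 1 ≤ C₂
  c₀_pos : 0 < c₀
  lp_pos : ∀ c, IsCell p c → 0 < lp c
  y0_nonneg : ∀ c, IsCell p c → 0 ≤ Y0 c
  bot : ∀ z ∈ sierpinskiCarpet p, z.im = 0 → Y z = 0
  Y_ge : ∀ c, IsCell p c → ∀ z ∈ per p c, Y0 c ≤ Y z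
  Y_le : ∀ c, IsCell p c → ∀ z ∈ per p c, Y z ≤ Y0 c + lp c
  step : ∀ c, IsCell p c → ∀ u ∈ bd p c, ∀ v ∈ bd p c, |Y u - Y v| ≤ A * lp c
  sum_le : ∀ E : Finset Idx, (∀ c ∈ E, IsCell p c) → ∑ c ∈ E, lp c ^ 2 ≤ 1
  loc : ∀ k β : ℕ, β < p ^ (k + 1) → ∀ E : Finset Idx,
    (∀ c ∈ E, IsCell p c ∧ sq p c ⊆ sq p (k, β / p, 0)) →
      ∑ c ∈ E, lp c ^ 2 ≤ C₂ * lp (k + 1, β, 0) ^ 2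
  gap : ∀ k β : ℕ, β < p ^ k →
    lp (k, β, 0) / (p + 1) ≤ |lp (k, β, 0) - p * lp (k + 1, p * β + p / 2, 0)|
  lower : ∀ b : ℕ, 1 ≤ b → c₀ / (p:ℝ) ^ b ≤
    ∑ β ∈ Finset.Ico ((p / 2) * p ^ (b - 1)) ((p / 2 + 1) * p ^ (b - 1)), lp (b, β, 0) ^ 2
  key : ∀ (φ : ℂ → ℝ) (low high : Idx → ℝ) (C : ℝ),
    (∀ u ∈ sierpinskiCarpet p, ∀ v ∈ sierpinskiCarpet p, |φ u - φ v| ≤ C * dist u v) →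
    (∀ z ∈ sierpinskiCarpet p, 0 ≤ φ z ∧ φ z ≤ C) →
    (∀ z ∈ sierpinskiCarpet p, φ z ≠ 0 → 1 / 4 ≤ z.re ∧ z.re ≤ 3 / 4 ∧ z.im ≤ 1 / 2) →
    (∀ c, IsCell p c → 0 ≤ low c ∧ high c - low c ≤ C * hs p c ∧
      ∀ z ∈ per p c, low c ≤ φ z ∧ φ z ≤ high c) →
    ∀ δ > 0, ∃ n0 : ℕ, ∀ n ≥ n0,
      ∑ c ∈ cellsLt p n, lp c * ((Y0 c + lp c) * low c - Y0 c * high c) ≤ δ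

noncomputable section

/-- Stretching density on the level-`n` grid. -/
def rho (p : ℕ) (lp : Idx → ℝ) (A : ℝ) (n j i : ℕ) : ℝ :=
  (if (own p n j i).1 < n then 1 else A) * (lp (own p n j i) / hs p (own p n j i))

/-- Midpoint of the lower edge of the level-`n` grid square `(j, i)`. -/
def gpt (p n j i : ℕ) : ℂ := ⟨((j:ℝ) + 1 / 2) / (p:ℝ) ^ n, (i:ℝ) / (p:ℝ) ^ n⟩

/-- Partial sums of `rho` along a column. -/
def colSum (p : ℕ) (lp : Idx → ℝ) (A : ℝ) (n j i : ℕ) : ℝ :=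
  1 / (p:ℝ) ^ n * ∑ i' ∈ Finset.range i, rho p lp A n j i'

end

section grid
variable {p : ℕ} {lp Y0 : Idx → ℝ} {Y : ℂ → ℝ} {A C₂ c₀ : ℝ} {n : ℕ}

lemma rho_of_mem_rng (hp : 3 ≤ p) {c : Idx} (hc : IsCell p c) (hn : c.1 < n) {j i : ℕ}
    (hj : j ∈ rng p n c c.2.1) (hi : i ∈ rng p n c c.2.2) :
    rho p lp A n j i = lp c / hs p c := by
  have hp0 : 0 < p := by omega
  have e := (own_eq_iff (j := j) (i := i) hp hc hn).2 ⟨(mem_rng hp0).1 hj, (mem_rng hp0).1 hi⟩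
  rw [rho, e, if_pos hn, one_mul]

lemma rho_of_cell (hp : 3 ≤ p) {j i : ℕ} (h : IsCell p (n, j, i)) :
    1 / (p:ℝ) ^ n * rho p lp A n j i = A * p * lp (n, j, i) := by
  have : (0:ℝ) < p := by positivity
  rw [rho, own_of_isCell h, if_neg (lt_irrefl _), hs]
  field_simp
  ring

lemma Core.rho_nonneg (H : Core p lp Y0 Y A C₂ c₀) (hp : 3 ≤ p) {j i : ℕ} (hj : j < p ^ n)
    (hi : i < p ^ n) : 0 ≤ rho p lp A n j i := by
  have h1 := (H.lp_pos _ (own_isCell hj hi).1).le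
  have h2 := (hs_pos (by omega : 0 < p) (own p n j i)).le
  have h3 := H.one_le_A
  unfold rho
  split_ifs <;> positivity

lemma pow_succ_mul_div (hp0 : 0 < p) {c : Idx} (hn : c.1 < n) (x : ℝ) :
    (p:ℝ) ^ (c.1 + 1) * (x / (p:ℝ) ^ n) = x / blk p n c := by
  have : (p:ℝ) ^ n = (p:ℝ) ^ (c.1 + 1) * blk p n c := by
    rw [blk]; push_cast; rw [← pow_add]; congr 1; omega
  have h0 : (0:ℝ) < p := by positivity
  have h1 : (0:ℝ) < blk p n c := by rw [blk]; positivity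
  rw [this]; field_simp

lemma gpt_mem_sq_mid (hp0 : 0 < p) {c : Idx} (hn : c.1 < n) {j i : ℕ} :
    gpt p n j i ∈ sq p (mid p c) ↔
      (((p * c.2.1 + p / 2 : ℕ) : ℝ) * blk p n c ≤ j + 1 / 2 ∧
        (j:ℝ) + 1 / 2 ≤ ((p * c.2.1 + p / 2 : ℕ) : ℝ) * blk p n c + blk p n c) ∧
      (((p * c.2.2 + p / 2 : ℕ) : ℝ) * blk p n c ≤ i ∧
        (i:ℝ) ≤ ((p * c.2.2 + p / 2 : ℕ) : ℝ) * blk p n c + blk p n c) := by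
  have h1 : (0:ℝ) < blk p n c := by rw [blk]; positivity
  simp only [sq, mid, gpt, mem_ofPred_eq, pow_succ_mul_div hp0 hn]
  rw [le_div_iff₀ h1, div_le_iff₀ h1, le_div_iff₀ h1, div_le_iff₀ h1, add_mul, one_mul, add_mul,
    one_mul, and_assoc]

lemma gpt_mem_osq_mid (hp0 : 0 < p) {c : Idx} (hn : c.1 < n) {j i : ℕ} :
    gpt p n j i ∈ osq p (mid p c) ↔
      (((p * c.2.1 + p / 2 : ℕ) : ℝ) * blk p n c < j + 1 / 2 ∧
        (j:ℝ) + 1 / 2 < ((p * c.2.1 + p / 2 : ℕ) : ℝ) * blk p n c + blk p n c) ∧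
      (((p * c.2.2 + p / 2 : ℕ) : ℝ) * blk p n c < i ∧
        (i:ℝ) < ((p * c.2.2 + p / 2 : ℕ) : ℝ) * blk p n c + blk p n c) := by
  have h1 : (0:ℝ) < blk p n c := by rw [blk]; positivity
  simp only [osq, mid, gpt, mem_ofPred_eq, pow_succ_mul_div hp0 hn]
  rw [lt_div_iff₀ h1, div_lt_iff₀ h1, lt_div_iff₀ h1, div_lt_iff₀ h1, add_mul, one_mul, add_mul,
    one_mul, and_assoc]

lemma rng_half {c : Idx} {a j : ℕ} (hj : j ∈ rng p n c a) :
    ((p * a + p / 2 : ℕ) : ℝ) * blk p n c < j + 1 / 2 ∧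
        (j:ℝ) + 1 / 2 < ((p * a + p / 2 : ℕ) : ℝ) * blk p n c + blk p n c := by
  rw [rng, Finset.mem_Ico] at hj
  have h1 : (((p * a + p / 2) * blk p n c : ℕ):ℝ) ≤ j := by exact_mod_cast hj.1
  have h2 : ((j + 1 : ℕ):ℝ) ≤ (((p * a + p / 2) * blk p n c + blk p n c : ℕ):ℝ) := by
    exact_mod_cast hj.2
  push_cast at h1 h2 ⊢
  constructor <;> linarith

lemma gpt_mem_per (hp0 : 0 < p) {c : Idx} (hn : c.1 < n) {j i : ℕ}
    (hj : j ∈ rng p n c c.2.1) (hi : i = (p * c.2.2 + p / 2) * blk p n c ∨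
      i = (p * c.2.2 + p / 2) * blk p n c + blk p n c) : gpt p n j i ∈ per p c := by
  have h := rng_half hj
  have h1 : (0:ℝ) < blk p n c := by rw [blk]; positivity
  rw [per, mem_sdiff, gpt_mem_sq_mid hp0 hn, gpt_mem_osq_mid hp0 hn]
  refine ⟨⟨⟨h.1.le, h.2.le⟩, ?_⟩, fun h' => ?_⟩
  · rcases hi with rfl | rfl
    · push_cast; constructor <;> linarith
    · push_cast; constructor <;> linarith
  · have := h'.2
    rcases hi with rfl | rfl
    · push_cast at this; linarith
    · push_cast at this; linarith

lemma gpt_mem_bd (hp0 : 0 < p) {j i : ℕ} :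
    gpt p n j i ∈ bd p (n, j, i) ∧ gpt p n j (i + 1) ∈ bd p (n, j, i) := by
  have h0 : (0:ℝ) < (p:ℝ) ^ n := by positivity
  have e : ∀ x : ℝ, (p:ℝ) ^ n * (x / (p:ℝ) ^ n) = x := fun x => by field_simp
  constructor
  · refine ⟨?_, fun h => ?_⟩
    · simp only [sq, gpt, mem_ofPred_eq, e]
      refine ⟨⟨?_, ?_⟩, ?_, ?_⟩ <;> linarith
    · simp only [osq, gpt, mem_ofPred_eq, e] at h
      linarith [h.2.1]
  · refine ⟨?_, fun h => ?_⟩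
    · simp only [sq, gpt, mem_ofPred_eq, e]
      push_cast
      refine ⟨⟨?_, ?_⟩, ?_, ?_⟩ <;> linarith
    · simp only [osq, gpt, mem_ofPred_eq, e] at h
      push_cast at h
      linarith [h.2.2]

lemma colSum_add_block (hp : 3 ≤ p) {c : Idx} (hc : IsCell p c) (hn : c.1 < n) {j m : ℕ}
    (hj : j ∈ rng p n c c.2.1) (hm : m ≤ blk p n c) :
    colSum p lp A n j ((p * c.2.2 + p / 2) * blk p n c + m) =
      colSum p lp A n j ((p * c.2.2 + p / 2) * blk p n c) +
        lp c / hs p c * (m * (1 / (p:ℝ) ^ n)) := by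
  unfold colSum
  rw [Finset.sum_range_add]
  have : ∑ x ∈ Finset.range m, rho p lp A n j ((p * c.2.2 + p / 2) * blk p n c + x) =
      m * (lp c / hs p c) := by
    rw [Finset.sum_congr rfl (g := fun _ => lp c / hs p c)]
    · simp
    · intro x hx
      rw [Finset.mem_range] at hx
      refine rho_of_mem_rng hp hc hn hj ?_
      rw [rng, Finset.mem_Ico]
      omega
  rw [this]; ring

/-- Heights of grid points are bounded by column sums of the density. -/
lemma Core.height_le (H : Core p lp Y0 Y A C₂ c₀) (hp : 3 ≤ p) (hop : Odd p) {j : ℕ}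
    (hj : j < p ^ n) : ∀ i ≤ p ^ n, gpt p n j i ∈ sierpinskiCarpet p →
      Y (gpt p n j i) ≤ colSum p lp A n j i := by
  have hp0 : 0 < p := by omega
  have hpr : (1:ℝ) ≤ p := by exact_mod_cast hp0
  intro i
  induction i using Nat.strong_induction_on with
  | _ i ih =>
    intro hi hz
    rcases i with _ | i
    · rw [H.bot _ hz (by simp [gpt])]; simp [colSum]
    have hi' : i < p ^ n := hi
    by_cases hl : (own p n j i).1 < n
    · set c := own p n j i with hcdef
      have hc : IsCell p c := (own_isCell hj hi').1
      obtain ⟨hcj, hci⟩ := (own_eq_iff hp hc hl).1 hcdef.symm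
      rw [← mem_rng hp0] at hcj hci
      have hnot := ((mem_carpet_iff hp hop _).1 hz).2 c
      rw [gpt_mem_osq_mid hp0 hl] at hnot
      have htop : i + 1 = (p * c.2.2 + p / 2) * blk p n c + blk p n c := by
        rw [rng, Finset.mem_Ico] at hci
        by_contra hne
        refine hnot ⟨rng_half hcj, ?_, ?_⟩
        · exact_mod_cast Nat.lt_succ_of_le hci.1
        · exact_mod_cast (by omega : i + 1 < (p * c.2.2 + p / 2) * blk p n c + blk p n c)
      have hb : gpt p n j ((p * c.2.2 + p / 2) * blk p n c) ∈ per p c :=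
        gpt_mem_per hp0 hl hcj (Or.inl rfl)
      have hk : 0 < blk p n c := by rw [blk]; positivity
      have h1 := ih _ (by omega) (by omega) (per_subset_carpet hp hop hc hb)
      have h2 := H.Y_ge c hc _ hb
      have h3 := H.Y_le c hc _ (gpt_mem_per hp0 hl hcj (Or.inr htop))
      rw [htop, colSum_add_block hp hc hl hcj le_rfl, blk_mul hp0 hl,
        div_mul_cancel₀ _ (hs_pos hp0 c).ne', ← htop]
      linarith
    · have hle := (own_isCell hj hi').2
      have hown := own_of_level (p := p) (n := n) (j := j) (i := i) (by omega)
      have hc : IsCell p (n, j, i) := hown ▸ (own_isCell hj hi').1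
      have hb := gpt_mem_bd (n := n) (j := j) (i := i) hp0
      have h1 := ih i (by omega) hi'.le (cell_boundary_subset hp hop hc hb.1)
      have h2 := (abs_le.1 (H.step _ hc _ hb.2 _ hb.1)).2
      have h3 : colSum p lp A n j (i + 1) = colSum p lp A n j i + A * p * lp (n, j, i) := by
        rw [← rho_of_cell hp hc]
        unfold colSum
        rw [Finset.sum_range_succ]; ring
      have h4 : A * lp (n, j, i) ≤ A * p * lp (n, j, i) := by
        have := (H.lp_pos _ hc)
        have := H.one_le_A
        have : 0 ≤ A * lp (n, j, i) := by positivity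
        nlinarith
      linarith

end grid

lemma ramp_sub {h H : ℝ} {K : ℕ} (hh : 0 < h) (hK : H = K * h) (i : ℕ) :
    max 0 (H - i * h) - max 0 (H - (i + 1 : ℕ) * h) = if i < K then h else 0 := by
  subst hK
  split_ifs with hi
  · have : ((i + 1 : ℕ) : ℝ) ≤ K := by exact_mod_cast hi
    have h2 : ((i + 1 : ℕ) : ℝ) * h ≤ K * h := by gcongr
    push_cast at *
    rw [max_eq_right (by nlinarith), max_eq_right (by linarith)]; ring
  · have : (K : ℝ) ≤ i := by exact_mod_cast not_lt.1 hi
    have h2 : (K : ℝ) * h ≤ i * h := by gcongr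
    push_cast
    rw [max_eq_left (by linarith), max_eq_left (by nlinarith)]; ring

lemma ramp_telescope {h H Y0 ρ : ℝ} {K : ℕ} (hh : 0 < h) (hK : H = K * h) (b0 m : ℕ) :
    (Y0 + ρ * (m * h)) * max 0 (H - (b0 + m : ℕ) * h) - Y0 * max 0 (H - b0 * h) =
      ∑ i ∈ Finset.range m, (h * ρ * max 0 (H - (b0 + i + 1 : ℕ) * h) -
        if b0 + i < K then h * (Y0 + ρ * (i * h)) else 0) := by
  induction m with
  | zero => simp
  | succ m ih =>
    rw [Finset.sum_range_succ, ← ih]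
    have := ramp_sub hh hK (b0 + m)
    rw [← add_assoc]
    set a := max 0 (H - ((b0 + m + 1 : ℕ):ℝ) * h)
    set b := max 0 (H - ((b0 + m : ℕ):ℝ) * h)
    push_cast
    split_ifs at this ⊢ with h1
    · have hb : b = a + h := by linarith
      rw [hb]; ring
    · have hb : b = a := by linarith
      rw [hb]; ring

lemma ramp_error {h H Y0 ρ : ℝ} {K : ℕ} (hh : 0 < h) (hK : H = K * h) (b0 k : ℕ)
    (hY : 0 ≤ Y0) (hρ : 0 ≤ ρ) (hk : k ≤ b0) :
    k * h * ((Y0 + ρ * (k * h)) * max 0 (H - (b0 + k : ℕ) * h) + Y0 * max 0 (H - b0 * h)) ≤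
      3 * H * ∑ i ∈ Finset.range k,
        if b0 + i < K then h * (Y0 + ρ * (i * h) + ρ * h) else 0 := by
  have hH : 0 ≤ H := by rw [hK]; positivity
  have hnn : ∀ i ∈ Finset.range k, 0 ≤ if b0 + i < K then h * (Y0 + ρ * (i * h) + ρ * h) else 0 := by
    intro i _; split_ifs <;> positivity
  rcases le_or_gt (b0 + k) K with h1 | h1
  · have hs : ∀ m : ℕ, m * h * (2 * Y0 + ρ * (m * h)) / 2 ≤
        ∑ i ∈ Finset.range m, h * (Y0 + ρ * (i * h) + ρ * h) := by
      intro m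
      induction m with
      | zero => simp
      | succ m ih =>
        rw [Finset.sum_range_succ]
        refine le_trans ?_ (add_le_add_left ih _)
        push_cast
        have : 0 ≤ ρ * (h * h) := by positivity
        nlinarith
    have e : ∑ i ∈ Finset.range k, (if b0 + i < K then h * (Y0 + ρ * (i * h) + ρ * h) else 0) =
        ∑ i ∈ Finset.range k, h * (Y0 + ρ * (i * h) + ρ * h) := by
      refine Finset.sum_congr rfl fun i hi => ?_
      rw [Finset.mem_range] at hi
      rw [if_pos (by omega)]
    rw [e]
    have h2 : max 0 (H - (b0 + k : ℕ) * h) ≤ H :=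
      max_le hH (by have : 0 ≤ ((b0 + k : ℕ):ℝ) * h := by positivity
                    linarith)
    have h3 : max 0 (H - b0 * h) ≤ H :=
      max_le hH (by have : 0 ≤ (b0:ℝ) * h := by positivity
                    linarith)
    calc _ ≤ k * h * ((Y0 + ρ * (k * h)) * H + Y0 * H) := by gcongr
      _ ≤ 3 * H * (k * h * (2 * Y0 + ρ * (k * h)) / 2) := by
        have : 0 ≤ H * (k * h * (2 * Y0 + ρ * (k * h))) := by positivity
        nlinarith
      _ ≤ _ := by gcongr; exact hs k
  · have hz : max 0 (H - (b0 + k : ℕ) * h) = 0 := by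
      apply max_eq_left
      have : (K:ℝ) * h ≤ ((b0 + k : ℕ):ℝ) * h := by gcongr
      linarith
    rw [hz, mul_zero, zero_add]
    rcases le_or_gt K b0 with h2 | h2
    · have hz' : max 0 (H - b0 * h) = 0 := by
        apply max_eq_left
        have : (K:ℝ) * h ≤ (b0:ℝ) * h := by gcongr
        linarith
      rw [hz', mul_zero, mul_zero]
      exact mul_nonneg (by positivity) (Finset.sum_nonneg hnn)
    · have h3 : max 0 (H - b0 * h) = ((K - b0 : ℕ):ℝ) * h := by
        rw [Nat.cast_sub h2.le, max_eq_right, hK]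
        · ring
        · have : (b0:ℝ) * h ≤ (K:ℝ) * h := by gcongr
          linarith
      have h4 : ((K - b0 : ℕ):ℝ) * (h * Y0) ≤ ∑ i ∈ Finset.range k,
          if b0 + i < K then h * (Y0 + ρ * (i * h) + ρ * h) else 0 := by
        calc ((K - b0 : ℕ):ℝ) * (h * Y0) = ∑ i ∈ Finset.range (K - b0), h * Y0 := by simp
          _ ≤ ∑ i ∈ Finset.range (K - b0),
              if b0 + i < K then h * (Y0 + ρ * (i * h) + ρ * h) else 0 := by
            refine Finset.sum_le_sum fun i hi => ?_
            rw [Finset.mem_range] at hi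
            rw [if_pos (by omega), add_assoc]
            gcongr
            have : 0 ≤ ρ * (i * h) + ρ * h := by positivity
            linarith
          _ ≤ _ := Finset.sum_le_sum_of_subset_of_nonneg
              (Finset.range_subset_range.2 (by omega)) (fun i hi _ => hnn i hi)
      have h5 : (k:ℝ) * h ≤ H := by
        rw [hK]; gcongr; omega
      rw [h3]
      calc (k:ℝ) * h * (Y0 * (((K - b0 : ℕ):ℝ) * h)) ≤ H * (((K - b0 : ℕ):ℝ) * (h * Y0)) := by
            have : 0 ≤ ((K - b0 : ℕ):ℝ) * (h * Y0) := by positivity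
            nlinarith
        _ ≤ 3 * H * (((K - b0 : ℕ):ℝ) * (h * Y0)) := by
            have : 0 ≤ H * (((K - b0 : ℕ):ℝ) * (h * Y0)) := by positivity
            linarith
        _ ≤ _ := by gcongr

/-- Column estimate inside one hole. -/
lemma ramp_column {h H Y0 ρ L χ χm χp : ℝ} {K : ℕ} (hh : 0 < h) (hK : H = K * h) (b0 k : ℕ)
    (hY : 0 ≤ Y0) (hρ : 0 ≤ ρ) (hk : k ≤ b0) (hL : 0 < L)
    (hm : χ - 2 * (k * h) / L ≤ χm) (hp : χp ≤ χ + 2 * (k * h) / L) :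
    ∑ i ∈ Finset.range k, (χ * (h * ρ * max 0 (H - (b0 + i + 1 : ℕ) * h)) -
        if b0 + i < K then h * ((χ + 6 * H / L) * (Y0 + ρ * (i * h)) + 6 * H / L * (ρ * h)) else 0) ≤
      (Y0 + ρ * (k * h)) * (χm * max 0 (H - (b0 + k : ℕ) * h)) -
        Y0 * (χp * max 0 (H - b0 * h)) := by
  have h1 := ramp_telescope (Y0 := Y0) (ρ := ρ) hh hK b0 k
  have h2 := ramp_error hh hK b0 k hY hρ hk
  set φ1 := max 0 (H - ((b0 + k : ℕ):ℝ) * h)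
  set φ0 := max 0 (H - (b0:ℝ) * h)
  have hφ1 : 0 ≤ φ1 := le_max_left _ _
  have hφ0 : 0 ≤ φ0 := le_max_left _ _
  have e : ∑ i ∈ Finset.range k, (χ * (h * ρ * max 0 (H - (b0 + i + 1 : ℕ) * h)) -
        if b0 + i < K then h * ((χ + 6 * H / L) * (Y0 + ρ * (i * h)) + 6 * H / L * (ρ * h)) else 0)
      = χ * ((Y0 + ρ * (k * h)) * φ1 - Y0 * φ0) - 2 / L * (3 * H * ∑ i ∈ Finset.range k,
        if b0 + i < K then h * (Y0 + ρ * (i * h) + ρ * h) else 0) := by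
    rw [h1, Finset.mul_sum, Finset.mul_sum, Finset.mul_sum, ← Finset.sum_sub_distrib]
    refine Finset.sum_congr rfl fun i _ => ?_
    split_ifs <;> ring
  rw [e]
  have h3 : 2 / L * (k * h * ((Y0 + ρ * (k * h)) * φ1 + Y0 * φ0)) ≤ 2 / L * (3 * H *
      ∑ i ∈ Finset.range k, if b0 + i < K then h * (Y0 + ρ * (i * h) + ρ * h) else 0) := by gcongr
  have h4 : (χ - 2 * (k * h) / L) * ((Y0 + ρ * (k * h)) * φ1) ≤ χm * ((Y0 + ρ * (k * h)) * φ1) := by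
    gcongr
  have h5 : χp * (Y0 * φ0) ≤ (χ + 2 * (k * h) / L) * (Y0 * φ0) := by gcongr
  have h6 : 2 / L * (k * h * ((Y0 + ρ * (k * h)) * φ1 + Y0 * φ0)) =
    2 * (k * h) / L * ((Y0 + ρ * (k * h)) * φ1) + 2 * (k * h) / L * (Y0 * φ0) := by ring
  linarith

lemma sum_cellsLt_succ {p : ℕ} (hp : 0 < p) (n : ℕ) (f : Idx → ℝ) :
    ∑ c ∈ cellsLt p (n + 1), f c = ∑ c ∈ cellsLt p n, f c + ∑ c ∈ cellsEq p n, f c := by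
  classical
  rw [← Finset.sum_union]
  · congr 1
    ext c
    rw [Finset.mem_union, mem_cellsLt hp, mem_cellsLt hp, mem_cellsEq hp]
    constructor
    · rintro ⟨h1, h2⟩
      rcases Nat.lt_succ_iff_lt_or_eq.1 h2 with h | h
      · exact Or.inl ⟨h1, h⟩
      · exact Or.inr ⟨h1, h⟩
    · rintro (⟨h1, h2⟩ | ⟨h1, h2⟩)
      · exact ⟨h1, by omega⟩
      · exact ⟨h1, by omega⟩
  · rw [Finset.disjoint_left]
    intro c h1 h2
    rw [mem_cellsLt hp] at h1
    rw [mem_cellsEq hp] at h2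
    omega

section
variable {p : ℕ} {lp Y0 : Idx → ℝ} {Y : ℂ → ℝ} {A C₂ c₀ : ℝ}

lemma Core.exists_level_small (H : Core p lp Y0 Y A C₂ c₀) (hp : 0 < p) {ε : ℝ} (hε : 0 < ε) :
    ∃ n0 : ℕ, ∀ n ≥ n0, ∑ c ∈ cellsEq p n, lp c ^ 2 ≤ ε := by
  have hs : Summable fun n => ∑ c ∈ cellsEq p n, lp c ^ 2 := by
    refine summable_of_sum_range_le (c := 1) (fun n => Finset.sum_nonneg fun c _ => sq_nonneg _)
      fun n => ?_
    have : ∀ n, ∑ i ∈ Finset.range n, ∑ c ∈ cellsEq p i, lp c ^ 2 =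
        ∑ c ∈ cellsLt p n, lp c ^ 2 := by
      intro n
      induction n with
      | zero =>
        rw [Finset.sum_range_zero]
        refine (Finset.sum_eq_zero fun c hc => ?_).symm
        rw [mem_cellsLt hp] at hc; omega
      | succ n ih => rw [Finset.sum_range_succ, ih, sum_cellsLt_succ hp]
    rw [this]
    exact H.sum_le _ fun c hc => ((mem_cellsLt hp).1 hc).1
  have := hs.tendsto_atTop_zero.eventually (gt_mem_nhds hε)
  obtain ⟨n0, h⟩ := Filter.eventually_atTop.1 this
  exact ⟨n0, fun n hn => (h n hn).le⟩

lemma sum_mul_partial (f : ℕ → ℝ) (K : ℕ) :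
    ∑ i ∈ Finset.range K, f i * (∑ i' ∈ Finset.range i, f i' + f i / 2) =
      (∑ i ∈ Finset.range K, f i) ^ 2 / 2 := by
  induction K with
  | zero => simp
  | succ K ih => rw [Finset.sum_range_succ, ih, Finset.sum_range_succ]; ring

end

section
variable {p : ℕ} {lp Y0 : Idx → ℝ} {Y : ℂ → ℝ} {A C₂ c₀ : ℝ}

/-- Left abscissa of the hole of `c`. -/
noncomputable def hx (p : ℕ) (c : Idx) : ℝ := ((p * c.2.1 + p / 2 : ℕ) : ℝ) * hs p c

/-- Bottom ordinate of the hole of `c`. -/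
noncomputable def hy (p : ℕ) (c : Idx) : ℝ := ((p * c.2.2 + p / 2 : ℕ) : ℝ) * hs p c

lemma mem_sq_mid_iff (hp0 : 0 < p) {c : Idx} {z : ℂ} : z ∈ sq p (mid p c) ↔
    (hx p c ≤ z.re ∧ z.re ≤ hx p c + hs p c) ∧ (hy p c ≤ z.im ∧ z.im ≤ hy p c + hs p c) := by
  have h0 : (0:ℝ) < (p:ℝ) ^ (c.1 + 1) := by positivity
  have e1 : ∀ a : ℕ, (a:ℝ) * hs p c = (a:ℝ) / (p:ℝ) ^ (c.1 + 1) := fun a => by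
    rw [hs, mul_one_div]
  have e2 : ∀ a : ℕ, (a:ℝ) * hs p c + hs p c = ((a:ℝ) + 1) / (p:ℝ) ^ (c.1 + 1) := fun a => by
    rw [hs]; ring
  simp only [sq, mid, mem_ofPred_eq]
  rw [hx, hy, e2, e2, e1, e1, div_le_iff₀' h0, le_div_iff₀' h0, div_le_iff₀' h0, le_div_iff₀' h0]

lemma hx_eq (hp0 : 0 < p) {n : ℕ} {c : Idx} (hn : c.1 < n) (a : ℕ) :
    ((p * a + p / 2 : ℕ) : ℝ) * hs p c =
      (((p * a + p / 2) * blk p n c : ℕ) : ℝ) * (1 / (p:ℝ) ^ n) := by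
  rw [← blk_mul hp0 hn]; push_cast; ring

lemma hs_le_hy (hp : 3 ≤ p) (c : Idx) : hs p c ≤ hy p c := by
  have h1 : (1:ℝ) ≤ ((p * c.2.2 + p / 2 : ℕ) : ℝ) := by
    exact_mod_cast (by have := Nat.zero_le (p * c.2.2); omega : 1 ≤ p * c.2.2 + p / 2)
  have := hs_pos (by omega : 0 < p) c
  unfold hy; nlinarith

lemma Core.hole_estimate (H : Core p lp Y0 Y A C₂ c₀) (hp : 3 ≤ p) (hop : Odd p) {n : ℕ}
    {c : Idx} (hc : IsCell p c) (hn : c.1 < n) {j m : ℕ} (hj : j ∈ rng p n c c.2.1)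
    (hm : m ≤ blk p n c) :
    Y0 c + lp c / hs p c * (m * (1 / (p:ℝ) ^ n)) ≤
      colSum p lp A n j ((p * c.2.2 + p / 2) * blk p n c + m) := by
  have hp0 : 0 < p := by omega
  have hb : gpt p n j ((p * c.2.2 + p / 2) * blk p n c) ∈ per p c :=
    gpt_mem_per hp0 hn hj (Or.inl rfl)
  have hk : 0 < blk p n c := by rw [blk]; positivity
  have hlt : (p * c.2.2 + p / 2) * blk p n c < p ^ n :=
    rng_lt hp hc.2.1 hn (by rw [rng, Finset.mem_Ico]; omega)
  have h1 := H.height_le hp hop (rng_lt hp hc.1 hn hj) _ hlt.le (per_subset_carpet hp hop hc hb)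
  have h2 := H.Y_ge c hc _ hb
  rw [colSum_add_block hp hc hn hj hm]
  linarith

lemma Core.hole_le (H : Core p lp Y0 Y A C₂ c₀) (hp : 3 ≤ p) (hop : Odd p) {n : ℕ}
    {c : Idx} (hc : IsCell p c) (hn : c.1 < n) {j K : ℕ} (hj : j ∈ rng p n c c.2.1)
    {h Ht L χ χm χp w : ℝ} (hh : h = 1 / (p:ℝ) ^ n) (hK : Ht = K * h) (hL : 0 < L)
    (hχ1 : χ ≤ 1)
    (hm : χ - 2 * hs p c / L ≤ χm) (hpl : χp ≤ χ + 2 * hs p c / L)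
    (hlL : 6 * Ht / L ≤ 1)
    (hw : w = 1 ∨ (w = 0 ∧ K ≤ (p * c.2.2 + p / 2) * blk p n c)) :
    ∑ i ∈ rng p n c c.2.2, (h ^ 2 * rho p lp A n j i ^ 2 * (χ * max 0 (Ht - (i + 1 : ℕ) * h)) -
        if i < K then w * ((1 + 6 * Ht / L) * (h ^ 2 * (rho p lp A n j i *
          (colSum p lp A n j i + h * rho p lp A n j i / 2)))) else 0) ≤
      h * (lp c / hs p c) * ((Y0 c + lp c) * (χm * max 0 (Ht - (hy p c + hs p c))) -
        Y0 c * (χp * max 0 (Ht - hy p c))) := by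
  have hp0 : 0 < p := by omega
  have hhp : 0 < h := by rw [hh]; positivity
  have hl := hs_pos hp0 c
  have hlp := H.lp_pos c hc
  have hY := H.y0_nonneg c hc
  set ρ := lp c / hs p c with hρ
  have hρ0 : 0 ≤ ρ := by positivity
  set b0 := (p * c.2.2 + p / 2) * blk p n c with hb0
  set k := blk p n c with hk
  have hkh : (k:ℝ) * h = hs p c := by rw [hh, hk, blk_mul hp0 hn]
  have hHt : 0 ≤ Ht := by rw [hK]; positivity
  have hkb : k ≤ b0 := by
    rw [hb0]
    exact Nat.le_mul_of_pos_left _ (by have := Nat.zero_le (p * c.2.2); omega)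
  have key := ramp_column (χ := χ) (χm := χm) (χp := χp) hhp hK b0 k hY hρ0 hkb hL
    (by rw [hkh]; exact hm) (by rw [hkh]; exact hpl)
  have e1 : ρ * (k * h) = lp c := by rw [hkh, hρ, div_mul_cancel₀ _ hl.ne']
  have e2 : (b0:ℝ) * h = hy p c := by rw [hy, hx_eq hp0 hn, hh]
  have e3 : ((b0 + k : ℕ):ℝ) * h = hy p c + hs p c := by push_cast; rw [add_mul, e2, hkh]
  rw [e1, e2, e3] at key
  have hsum : ∀ f : ℕ → ℝ, ∑ i ∈ rng p n c c.2.2, f i = ∑ i ∈ Finset.range k, f (b0 + i) := by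
    intro f
    rw [rng, Finset.sum_Ico_eq_sum_range, Nat.add_sub_cancel_left]
  rw [hsum]
  refine le_trans ?_ (mul_le_mul_of_nonneg_left key (by positivity : 0 ≤ h * ρ))
  rw [Finset.mul_sum]
  refine Finset.sum_le_sum fun i hi => ?_
  rw [Finset.mem_range] at hi
  have hr : rho p lp A n j (b0 + i) = ρ := by
    refine rho_of_mem_rng hp hc hn hj ?_
    rw [rng, Finset.mem_Ico]; omega
  rw [hr]
  split_ifs with hiK
  · have hw1 : w = 1 := by
      rcases hw with h1 | ⟨-, h2⟩
      · exact h1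
      · omega
    have hZ := H.hole_estimate hp hop hc hn hj hi.le
    rw [← hh, ← hρ, ← hk, ← hb0] at hZ
    set Z := colSum p lp A n j (b0 + i)
    set Yt := Y0 c + ρ * (i * h)
    have hYt : 0 ≤ Yt := by positivity
    set lam := 6 * Ht / L
    have hlam : 0 ≤ lam := by positivity
    have h1 : (χ + lam) * Yt + lam * (ρ * h) ≤ (1 + lam) * (Z + h * ρ / 2) := by
      have a1 : (χ + lam) * Yt ≤ (1 + lam) * Z := by gcongr
      have a2 : 0 ≤ ρ * h := by positivity
      nlinarith
    have h2 : h * ρ * (h * ((χ + lam) * Yt + lam * (ρ * h))) ≤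
        h * ρ * (h * ((1 + lam) * (Z + h * ρ / 2))) := by gcongr
    rw [hw1]
    have e4 : h * ρ * (h * ((1 + lam) * (Z + h * ρ / 2))) =
      1 * ((1 + lam) * (h ^ 2 * (ρ * (Z + h * ρ / 2)))) := by ring
    rw [mul_sub]
    rw [e4] at h2
    have e5 : h ^ 2 * ρ ^ 2 * (χ * max 0 (Ht - (b0 + i + 1 : ℕ) * h)) =
      h * ρ * (χ * (h * ρ * max 0 (Ht - (b0 + i + 1 : ℕ) * h))) := by ring
    rw [e5]
    linarith
  · apply le_of_eq; ring

/-- The energy inequality on the level-`n` grid for a cut-off `χ(x) (H - y)₊`. -/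
theorem Core.energy_le (H : Core p lp Y0 Y A C₂ c₀) (hp : 3 ≤ p) (hop : Odd p) {Ht L : ℝ}
    (χ : ℝ → ℝ) (hH : 0 < Ht) (hH2 : Ht ≤ 1 / 2) (hL : 0 < L) (hlL : 6 * Ht / L ≤ 1)
    (hχ0 : ∀ x, 0 ≤ χ x) (hχ1 : ∀ x, χ x ≤ 1) (hχL : ∀ x y, |χ x - χ y| ≤ |x - y| / L)
    (hχs : ∀ x, χ x ≠ 0 → 1 / 4 ≤ x ∧ x ≤ 3 / 4) {δ : ℝ} (hδ : 0 < δ) :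
    ∃ n0 : ℕ, ∀ n ≥ n0, ∀ K : ℕ, Ht = K * (1 / (p:ℝ) ^ n) → ∀ J : Finset ℕ,
      J ⊆ Finset.range (p ^ n) →
      (∀ c, IsCell p c → c.1 < n → (p * c.2.2 + p / 2) * blk p n c < K →
        (∃ x, hx p c ≤ x ∧ x ≤ hx p c + hs p c ∧ χ x ≠ 0) → rng p n c c.2.1 ⊆ J) →
      ∑ j ∈ Finset.range (p ^ n), ∑ i ∈ Finset.range (p ^ n),
        (1 / (p:ℝ) ^ n) ^ 2 * rho p lp A n j i ^ 2 *
          (χ (((j:ℝ) + 1 / 2) * (1 / (p:ℝ) ^ n)) *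
            max 0 (Ht - (i + 1 : ℕ) * (1 / (p:ℝ) ^ n))) ≤
      δ + (1 + 6 * Ht / L) / 2 * (1 / (p:ℝ) ^ n) ^ 3 *
        ∑ j ∈ J, (∑ i ∈ Finset.range K, rho p lp A n j i) ^ 2 := by
  classical
  have hp0 : 0 < p := by omega
  let E : Idx → Prop := fun c => ∃ x, hx p c ≤ x ∧ x ≤ hx p c + hs p c ∧ χ x ≠ 0
  let χm : Idx → ℝ := fun c => max 0 (χ (hx p c) - hs p c / L)
  let χp : Idx → ℝ := fun c => if E c then χ (hx p c) + hs p c / L else 0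
  let φ : ℂ → ℝ := fun z => χ z.re * max 0 (Ht - z.im)
  let low : Idx → ℝ := fun c => χm c * max 0 (Ht - (hy p c + hs p c))
  let high : Idx → ℝ := fun c => χp c * max 0 (Ht - hy p c)
  have hramp : ∀ a b : ℝ, |max 0 (Ht - a) - max 0 (Ht - b)| ≤ |a - b| := by
    intro a b
    refine (abs_max_sub_max_le_max _ _ _ _).trans ?_
    rw [sub_self, abs_zero, sub_sub_sub_cancel_left, abs_sub_comm]
    exact max_le (abs_nonneg _) le_rfl
  have hrle : ∀ a : ℝ, 0 ≤ a → max 0 (Ht - a) ≤ Ht := fun a ha => max_le hH.le (by linarith)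
  have hr0 : ∀ a : ℝ, 0 ≤ max 0 (Ht - a) := fun a => le_max_left _ _
  have hinS : ∀ z ∈ sierpinskiCarpet p, 0 ≤ z.im := fun z hz =>
    ((mem_carpet_iff hp hop z).1 hz).1.2.1
  have hχb : ∀ c x, hx p c ≤ x → x ≤ hx p c + hs p c →
      χ (hx p c) - hs p c / L ≤ χ x ∧ χ x ≤ χ (hx p c) + hs p c / L := by
    intro c x h1 h2
    have := hχL x (hx p c)
    have h3 : |x - hx p c| / L ≤ hs p c / L := by
      gcongr; rw [abs_le]; constructor <;> linarith
    have := abs_le.1 (this.trans h3)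
    constructor <;> linarith
  have hEx : ∀ c x, hx p c ≤ x → x ≤ hx p c + hs p c → ¬ E c → χ x = 0 := by
    intro c x h1 h2 h3
    by_contra h4
    exact h3 ⟨x, h1, h2, h4⟩
  have hχm0 : ∀ c, 0 ≤ χm c := fun c => le_max_left _ _
  have hχm1 : ∀ c, χm c ≤ 1 := fun c => max_le (by norm_num) (by
    have := hχ1 (hx p c); have : 0 ≤ hs p c / L := by have := hs_pos hp0 c; positivity
    linarith)
  have hhi : ∀ c, hx p c ≤ hx p c + hs p c := fun c => by have := hs_pos hp0 c; linarith
  have hyn : ∀ c, 0 ≤ hy p c := fun c => (hs_pos hp0 c).le.trans (hs_le_hy hp c)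
  obtain ⟨n1, hn1⟩ := H.key φ low high (2 * Ht / L + 1) (by
    intro u hu v hv
    have h1 : φ u - φ v = (χ u.re - χ v.re) * max 0 (Ht - u.im) +
        χ v.re * (max 0 (Ht - u.im) - max 0 (Ht - v.im)) := by simp only [φ]; ring
    have hre : |u.re - v.re| ≤ dist u v := by
      rw [Complex.dist_eq, ← Complex.sub_re]; exact Complex.abs_re_le_norm _
    have him : |u.im - v.im| ≤ dist u v := by
      rw [Complex.dist_eq, ← Complex.sub_im]; exact Complex.abs_im_le_norm _
    rw [h1]
    refine (abs_add_le _ _).trans ?_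
    rw [abs_mul, abs_mul, abs_of_nonneg (hr0 _), abs_of_nonneg (hχ0 _)]
    calc _ ≤ dist u v / L * Ht + 1 * dist u v := by
          gcongr
          · exact (hχL _ _).trans (by gcongr)
          · exact hrle _ (hinS u hu)
          · exact hχ1 _
          · exact (hramp _ _).trans him
      _ ≤ _ := by
          have : 0 ≤ dist u v / L * Ht := by positivity
          have e : (2 * Ht / L + 1) * dist u v = 2 * (dist u v / L * Ht) + dist u v := by ring
          linarith) (by
    intro z hz
    refine ⟨mul_nonneg (hχ0 _) (hr0 _), ?_⟩
    have h1 : φ z ≤ 1 * Ht := mul_le_mul (hχ1 _) (hrle _ (hinS z hz)) (hr0 _) (by norm_num)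
    have : 0 ≤ 2 * Ht / L := by positivity
    linarith) (by
    intro z hz hne
    have h1 := hχs z.re (left_ne_zero_of_mul hne)
    refine ⟨h1.1, h1.2, ?_⟩
    by_contra hlt
    exact right_ne_zero_of_mul hne (max_eq_left (by push Not at hlt; linarith))) (by
    intro c hc
    have hl := hs_pos hp0 c
    refine ⟨mul_nonneg (hχm0 c) (hr0 _), ?_, ?_⟩
    · have h1 : high c - low c = (χp c - χm c) * max 0 (Ht - hy p c) +
          χm c * (max 0 (Ht - hy p c) - max 0 (Ht - (hy p c + hs p c))) := by
        simp only [high, low]; ring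
      have h2 : χp c - χm c ≤ 2 * hs p c / L := by
        have hm : χ (hx p c) - hs p c / L ≤ χm c := le_max_right _ _
        have h3 : χp c ≤ χ (hx p c) + hs p c / L := by
          simp only [χp]
          split_ifs
          · exact le_rfl
          · have := hχ0 (hx p c); positivity
        have : 2 * hs p c / L = hs p c / L + hs p c / L := by ring
        linarith
      have h3 : max 0 (Ht - hy p c) - max 0 (Ht - (hy p c + hs p c)) ≤ hs p c := by
        have := (abs_le.1 (hramp (hy p c) (hy p c + hs p c))).2
        rw [sub_add_cancel_left, abs_neg, abs_of_pos hl] at this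
        exact this
      have h4 : 0 ≤ max 0 (Ht - hy p c) - max 0 (Ht - (hy p c + hs p c)) :=
        sub_nonneg.2 (max_le_max le_rfl (by linarith))
      rw [h1]
      calc _ ≤ 2 * hs p c / L * max 0 (Ht - hy p c) + 1 * hs p c := by
            gcongr
            exact hχm1 c
        _ ≤ 2 * hs p c / L * Ht + 1 * hs p c := by gcongr; exact hrle _ (hyn c)
        _ = _ := by ring
    · intro z hz
      obtain ⟨⟨h1, h2⟩, h3, h4⟩ := (mem_sq_mid_iff hp0).1 hz.1
      have h5 := hχb c z.re h1 h2
      constructor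
      · exact mul_le_mul (max_le (hχ0 _) h5.1) (max_le_max le_rfl (by linarith)) (hr0 _) (hχ0 _)
      · refine mul_le_mul ?_ (max_le_max le_rfl (by linarith)) (hr0 _) ?_
        · simp only [χp]
          split_ifs with he
          · exact h5.2
          · exact (hEx c _ h1 h2 he).le
        · simp only [χp]
          split_ifs with he
          · have := hχ0 (hx p c); positivity
          · exact le_rfl) (δ / 2) (by linarith)
  have hA := H.one_le_A
  have hAp : (0:ℝ) < (A * p) ^ 2 := by
    have : (0:ℝ) < p := by positivity
    positivity
  obtain ⟨n2, hn2⟩ := H.exists_level_small hp0 (ε := δ / 2 / (A * p) ^ 2) (by positivity)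
  refine ⟨max n1 n2, fun n hn K hK J hJ hJE => ?_⟩
  have hn1 := hn1 n (le_trans (le_max_left _ _) hn)
  have hn2 := hn2 n (le_trans (le_max_right _ _) hn)
  obtain ⟨h, hh⟩ : ∃ h : ℝ, h = 1 / (p:ℝ) ^ n := ⟨_, rfl⟩
  rw [← hh] at hK ⊢
  have hhp : 0 < h := by rw [hh]; positivity
  obtain ⟨lam, hlam⟩ : ∃ l : ℝ, l = 6 * Ht / L := ⟨_, rfl⟩
  have hlam0 : 0 ≤ lam := by rw [hlam]; positivity
  have hKN : K ≤ p ^ n := by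
    have : (K:ℝ) ≤ (p:ℝ) ^ n := by
      have h1 : (K:ℝ) = Ht * (p:ℝ) ^ n := by rw [hK, hh]; field_simp
      have : (0:ℝ) < (p:ℝ) ^ n := by positivity
      rw [h1]; nlinarith
    exact_mod_cast this
  let F : ℕ → ℕ → ℝ := fun j i => h ^ 2 * rho p lp A n j i ^ 2 *
    (χ (((j:ℝ) + 1 / 2) * h) * max 0 (Ht - (i + 1 : ℕ) * h))
  let G : ℕ → ℕ → ℝ := fun j i => if i < K then (if j ∈ J then 1 else 0) * ((1 + lam) *
    (h ^ 2 * (rho p lp A n j i * (colSum p lp A n j i + h * rho p lp A n j i / 2)))) else 0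
  have hG0 : ∀ j < p ^ n, ∀ i < p ^ n, 0 ≤ G j i := by
    intro j hj i hi
    have h1 := H.rho_nonneg hp hj hi
    have h2 : 0 ≤ colSum p lp A n j i := by
      refine mul_nonneg (by positivity) (Finset.sum_nonneg fun i' hi' => ?_)
      rw [Finset.mem_range] at hi'
      exact H.rho_nonneg hp hj (by omega)
    simp only [G]
    split_ifs <;> positivity
  have hGsum : ∑ j ∈ Finset.range (p ^ n), ∑ i ∈ Finset.range (p ^ n), G j i =
      (1 + lam) / 2 * h ^ 3 * ∑ j ∈ J, (∑ i ∈ Finset.range K, rho p lp A n j i) ^ 2 := by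
    rw [Finset.mul_sum, ← Finset.sum_subset hJ]
    · refine Finset.sum_congr rfl fun j hj => ?_
      rw [← Finset.sum_subset (Finset.range_subset_range.2 hKN)]
      · have := sum_mul_partial (fun i => rho p lp A n j i) K
        rw [mul_assoc, show (1 + lam) / 2 * (h ^ 3 * (∑ i ∈ Finset.range K, rho p lp A n j i) ^ 2)
          = (1 + lam) * h ^ 3 * ((∑ i ∈ Finset.range K, rho p lp A n j i) ^ 2 / 2) by ring, ← this,
          Finset.mul_sum]
        refine Finset.sum_congr rfl fun i hi => ?_
        rw [Finset.mem_range] at hi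
        simp only [G]
        rw [if_pos hi, if_pos hj, colSum, ← hh]; ring
      · intro i _ hi
        rw [Finset.mem_range] at hi
        simp only [G]; rw [if_neg hi]
    · intro j _ hj
      refine Finset.sum_eq_zero fun i _ => ?_
      simp only [G]; rw [if_neg hj]; simp
  have hF := sum_grid_eq hp n F
  have hG := sum_grid_eq hp n G
  have hsolid : ∑ c ∈ cellsEq p n, F c.2.1 c.2.2 ≤ δ / 2 := by
    calc ∑ c ∈ cellsEq p n, F c.2.1 c.2.2 ≤ ∑ c ∈ cellsEq p n, (A * p) ^ 2 * lp c ^ 2 := by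
          refine Finset.sum_le_sum fun c hcm => ?_
          obtain ⟨hc, hcn⟩ := (mem_cellsEq hp0).1 hcm
          clear hcm
          obtain ⟨m, j, i⟩ := c
          simp only at hcn
          subst hcn
          have := rho_of_cell (lp := lp) (A := A) hp hc
          rw [← hh] at this
          simp only [F]
          rw [← mul_pow, this]
          have h1 : χ (((j:ℝ) + 1 / 2) * h) * max 0 (Ht - (i + 1 : ℕ) * h) ≤ 1 := by
            have := hrle ((i + 1 : ℕ) * h) (by positivity)
            have := mul_le_mul (hχ1 (((j:ℝ) + 1 / 2) * h)) this (hr0 _) (by norm_num)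
            linarith
          calc _ ≤ (A * p * lp (m, j, i)) ^ 2 * 1 := by gcongr
            _ = _ := by ring
      _ ≤ (A * p) ^ 2 * (δ / 2 / (A * p) ^ 2) := by
          rw [← Finset.mul_sum]; gcongr
      _ = δ / 2 := by field_simp
  have hGsolid : 0 ≤ ∑ c ∈ cellsEq p n, G c.2.1 c.2.2 := by
    refine Finset.sum_nonneg fun c hc => ?_
    obtain ⟨hc, hcn⟩ := (mem_cellsEq hp0).1 hc
    exact hG0 _ (hcn ▸ hc.1) _ (hcn ▸ hc.2.1)
  have hholes : ∑ c ∈ cellsLt p n, ∑ j ∈ rng p n c c.2.1, ∑ i ∈ rng p n c c.2.2, F j i -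
      ∑ c ∈ cellsLt p n, ∑ j ∈ rng p n c c.2.1, ∑ i ∈ rng p n c c.2.2, G j i ≤ δ / 2 := by
    refine le_trans ?_ hn1
    rw [← Finset.sum_sub_distrib]
    refine Finset.sum_le_sum fun c hc => ?_
    obtain ⟨hc, hcn⟩ := (mem_cellsLt hp0).1 hc
    have hl := hs_pos hp0 c
    have hkh : (blk p n c:ℝ) * h = hs p c := by rw [hh, blk_mul hp0 hcn]
    have hlp : lp c * ((Y0 c + lp c) * low c - Y0 c * high c) = ∑ j ∈ rng p n c c.2.1,
        h * (lp c / hs p c) * ((Y0 c + lp c) * low c - Y0 c * high c) := by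
      rw [Finset.sum_const, rng, Nat.card_Ico, Nat.add_sub_cancel_left, nsmul_eq_mul]
      generalize (Y0 c + lp c) * low c - Y0 c * high c = t
      rw [← mul_assoc, ← mul_assoc, hkh, mul_div_cancel₀ _ hl.ne']
    rw [hlp, ← Finset.sum_sub_distrib]
    refine Finset.sum_le_sum fun j hj => ?_
    rw [← Finset.sum_sub_distrib]
    have hxj := rng_half hj
    have hb1 : hx p c ≤ ((j:ℝ) + 1 / 2) * h := by
      have := mul_le_mul_of_nonneg_right hxj.1.le hhp.le
      rwa [mul_assoc, hkh] at this
    have hb2 : ((j:ℝ) + 1 / 2) * h ≤ hx p c + hs p c := by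
      have := mul_le_mul_of_nonneg_right hxj.2.le hhp.le
      rwa [add_mul _ (blk p n c : ℝ) h, mul_assoc _ (blk p n c : ℝ) h, hkh] at this
    by_cases he : E c
    · have h5 := hχb c _ hb1 hb2
      have e2 : 2 * hs p c / L = hs p c / L + hs p c / L := by ring
      have := H.hole_le hp hop hc hcn hj hh hK hL (hχ1 (((j:ℝ) + 1 / 2) * h))
        (χm := χm c) (χp := χp c) (w := if j ∈ J then 1 else 0)
        (by have : χ (hx p c) - hs p c / L ≤ χm c := le_max_right _ _
            linarith)
        (by simp only [χp]; rw [if_pos he]; linarith) hlL (by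
          by_cases hb : (p * c.2.2 + p / 2) * blk p n c < K
          · exact Or.inl (if_pos (hJE c hc hcn hb he hj))
          · by_cases hjJ : j ∈ J
            · exact Or.inl (if_pos hjJ)
            · exact Or.inr ⟨if_neg hjJ, not_lt.1 hb⟩)
      rw [← hlam] at this
      exact this
    · have h0 : χ (((j:ℝ) + 1 / 2) * h) = 0 := hEx c _ hb1 hb2 he
      have hm0 : χm c = 0 := by
        have h1 := hEx c _ le_rfl (hhi c) he
        simp only [χm]; rw [h1, zero_sub]
        exact max_eq_left (by rw [Left.neg_nonpos_iff]; positivity)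
      have hp0' : χp c = 0 := if_neg he
      have : (Y0 c + lp c) * low c - Y0 c * high c = 0 := by
        simp only [low, high, hm0, hp0']; ring
      rw [this, mul_zero]
      refine Finset.sum_nonpos fun i hi => ?_
      have h1 : F j i = 0 := by simp only [F, h0]; ring
      rw [h1, zero_sub, neg_nonpos]
      exact hG0 j (rng_lt hp hc.1 hcn hj) i (rng_lt hp hc.2.1 hcn hi)
  change ∑ j ∈ Finset.range (p ^ n), ∑ i ∈ Finset.range (p ^ n), F j i ≤ _
  rw [← hlam, ← hGsum, hF, hG]
  linarith

end

lemma cauchy_schwarz_deficit (f : ℕ → ℝ) (K : ℕ) {S₁ S₂ : Finset ℕ} {v₁ v₂ : ℝ}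
    (h₁ : S₁ ⊆ Finset.range K) (h₂ : S₂ ⊆ Finset.range K) (hd : Disjoint S₁ S₂)
    (hv₁ : ∀ i ∈ S₁, f i = v₁) (hv₂ : ∀ i ∈ S₂, f i = v₂) :
    (∑ i ∈ Finset.range K, f i) ^ 2 + S₁.card * S₂.card * (v₁ - v₂) ^ 2 ≤
      K * ∑ i ∈ Finset.range K, f i ^ 2 := by
  classical
  let g : ℕ → ℝ := fun i => ∑ j ∈ Finset.range K, (f i - f j) ^ 2
  have e : ∑ i ∈ Finset.range K, g i =
      2 * (K * ∑ i ∈ Finset.range K, f i ^ 2) - 2 * (∑ i ∈ Finset.range K, f i) ^ 2 := by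
    have : ∀ i, g i = K * f i ^ 2 - 2 * f i * ∑ j ∈ Finset.range K, f j +
        ∑ j ∈ Finset.range K, f j ^ 2 := by
      intro i
      simp only [g, sub_sq, Finset.sum_add_distrib, Finset.sum_sub_distrib, Finset.sum_const,
        Finset.card_range, nsmul_eq_mul, ← Finset.mul_sum]
    simp only [this, Finset.sum_add_distrib, Finset.sum_sub_distrib, Finset.sum_const,
        Finset.card_range, nsmul_eq_mul, ← Finset.mul_sum, ← Finset.sum_mul]
    ring
  have hg0 : ∀ i, 0 ≤ g i := fun i => Finset.sum_nonneg fun j _ => sq_nonneg _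
  have hb : ∀ (S : Finset ℕ) (v i : _), S ⊆ Finset.range K → (∀ j ∈ S, f j = v) →
      S.card * (f i - v) ^ 2 ≤ g i := by
    intro S v i hS hv
    calc S.card * (f i - v) ^ 2 = ∑ j ∈ S, (f i - f j) ^ 2 := by
          rw [Finset.sum_congr rfl (g := fun _ => (f i - v) ^ 2) (fun j hj => by rw [hv j hj])]
          simp
      _ ≤ _ := Finset.sum_le_sum_of_subset_of_nonneg hS fun _ _ _ => sq_nonneg _
  have h3 : ∑ i ∈ S₁, g i + ∑ i ∈ S₂, g i ≤ ∑ i ∈ Finset.range K, g i := by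
    rw [← Finset.sum_union hd]
    exact Finset.sum_le_sum_of_subset_of_nonneg (Finset.union_subset h₁ h₂) fun _ _ _ => hg0 _
  have h4 : (S₁.card:ℝ) * (S₂.card * (v₁ - v₂) ^ 2) ≤ ∑ i ∈ S₁, g i := by
    rw [← nsmul_eq_mul]
    refine Finset.card_nsmul_le_sum _ _ _ fun i hi => ?_
    have := hb S₂ v₂ i h₂ hv₂
    rwa [hv₁ i hi] at this
  have h5 : (S₂.card:ℝ) * (S₁.card * (v₂ - v₁) ^ 2) ≤ ∑ i ∈ S₂, g i := by
    rw [← nsmul_eq_mul]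
    refine Finset.card_nsmul_le_sum _ _ _ fun i hi => ?_
    have := hb S₁ v₁ i h₁ hv₁
    rwa [hv₂ i hi] at this
  nlinarith

lemma isCell_bottom {p : ℕ} (hp : 3 ≤ p) {k β : ℕ} (h : β < p ^ k) : IsCell p (k, β, 0) := by
  refine ⟨h, by positivity, fun m _ hm => ?_⟩
  have := hm.2
  simp only [Nat.zero_div, Nat.zero_mod] at this
  omega

section
variable {p : ℕ} {lp Y0 : Idx → ℝ} {Y : ℂ → ℝ} {A C₂ c₀ : ℝ} {n : ℕ}

lemma Core.energy_filter_le (H : Core p lp Y0 Y A C₂ c₀) (hp : 3 ≤ p) (P : Idx → Prop)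
    [DecidablePred P] :
    ∑ j ∈ Finset.range (p ^ n), ∑ i ∈ Finset.range (p ^ n),
      (if P (own p n j i) then (1 / (p:ℝ) ^ n) ^ 2 * rho p lp A n j i ^ 2 else 0) ≤
    (A * p) ^ 2 * ∑ c ∈ (cellsLt p (n + 1)).filter P, lp c ^ 2 := by
  have hp0 : 0 < p := by omega
  have hpr : (1:ℝ) ≤ p := by exact_mod_cast hp0
  have hA := H.one_le_A
  have hAp : 1 ≤ (A * p) ^ 2 := one_le_pow₀ (one_le_mul_of_one_le_of_one_le hA hpr)
  rw [sum_grid_eq hp, Finset.sum_filter, sum_cellsLt_succ hp0, mul_add, Finset.mul_sum,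
    Finset.mul_sum]
  refine add_le_add (Finset.sum_le_sum fun c hc => ?_) (Finset.sum_le_sum fun c hc => ?_)
  · obtain ⟨hc, hcn⟩ := (mem_cellsLt hp0).1 hc
    have hl := hs_pos hp0 c
    have e : ∀ j ∈ rng p n c c.2.1, ∀ i ∈ rng p n c c.2.2,
        (if P (own p n j i) then (1 / (p:ℝ) ^ n) ^ 2 * rho p lp A n j i ^ 2 else 0) =
        if P c then (1 / (p:ℝ) ^ n) ^ 2 * (lp c / hs p c) ^ 2 else 0 := by
      intro j hj i hi
      rw [(own_eq_iff hp hc hcn).2 ⟨(mem_rng hp0).1 hj, (mem_rng hp0).1 hi⟩,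
        rho_of_mem_rng hp hc hcn hj hi]
    rw [Finset.sum_congr rfl fun j hj => Finset.sum_congr rfl fun i hi => e j hj i hi]
    simp only [Finset.sum_const, rng, Nat.card_Ico, Nat.add_sub_cancel_left, nsmul_eq_mul]
    split_ifs
    · have : (blk p n c : ℝ) * (blk p n c * ((1 / (p:ℝ) ^ n) ^ 2 * (lp c / hs p c) ^ 2)) =
          (blk p n c * (1 / (p:ℝ) ^ n) * (lp c / hs p c)) ^ 2 := by ring
      rw [this, blk_mul hp0 hcn, mul_div_cancel₀ _ hl.ne']
      nlinarith [sq_nonneg (lp c)]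
    · simp
  · obtain ⟨hc', hcn⟩ := (mem_cellsEq hp0).1 hc
    clear hc
    obtain ⟨m, j, i⟩ := c
    simp only at hcn
    subst hcn
    simp only [own_of_isCell hc']
    split_ifs
    · rw [← mul_pow, rho_of_cell hp hc', mul_pow]
    · simp

lemma own_sq_subset (hp : 3 ≤ p) {k j i β : ℕ} (hk : k ≤ n) (hj : j / p ^ (n - k) = β)
    (hi : i < p ^ (n - k)) : sq p (own p n j i) ⊆ sq p (k, β, 0) := by
  have hp0 : 0 < p := by omega
  obtain ⟨K, hK, e, h1, -⟩ := own_spec p n j i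
  rw [e]
  have hKk : K ≤ n - k := by
    by_contra hlt
    have h2 := (h1 (by omega)).2
    rw [Nat.div_eq_of_lt (hi.trans_le (Nat.pow_le_pow_right hp0 (by omega))), Nat.zero_mod] at h2
    omega
  have := sq_subset_of_div hp0 k (n - K - k) (j / p ^ K) (i / p ^ K)
  rw [Nat.div_div_eq_div_mul, Nat.div_div_eq_div_mul, ← pow_add,
    show K + (n - K - k) = n - k by omega, hj, Nat.div_eq_of_lt hi,
    show k + (n - K - k) = n - K by omega] at this
  exact this

/-- Columns below the bottom square `(k, β, 0)`. -/
def cols (p n k β : ℕ) : Finset ℕ := Finset.Ico (β * p ^ (n - k)) (β * p ^ (n - k) + p ^ (n - k))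

lemma mem_cols (hp0 : 0 < p) {k β j : ℕ} : j ∈ cols p n k β ↔ j / p ^ (n - k) = β := by
  have : 0 < p ^ (n - k) := by positivity
  rw [cols, Finset.mem_Ico, Nat.div_eq_iff this]
  omega

lemma cols_lt {k β j : ℕ} (hk : k ≤ n) (hβ : β < p ^ k) (hj : j ∈ cols p n k β) : j < p ^ n := by
  rw [cols, Finset.mem_Ico] at hj
  have : (β + 1) * p ^ (n - k) ≤ p ^ k * p ^ (n - k) := Nat.mul_le_mul_right _ hβ
  rw [← pow_add, Nat.add_sub_cancel' hk, add_mul, one_mul] at this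
  omega

lemma Core.local_energy_le (H : Core p lp Y0 Y A C₂ c₀) (hp : 3 ≤ p) {k β K : ℕ} (hk : 1 ≤ k)
    (hkn : k ≤ n) (hβ : β < p ^ k) (hK : K ≤ p ^ (n - k + 1)) :
    (1 / (p:ℝ) ^ n) ^ 2 * ∑ j ∈ cols p n k β, ∑ i ∈ Finset.range K, rho p lp A n j i ^ 2 ≤
      (A * p) ^ 2 * (C₂ * lp (k, β, 0) ^ 2) := by
  classical
  have hp0 : 0 < p := by omega
  obtain ⟨k, rfl⟩ : ∃ m, k = m + 1 := ⟨k - 1, by omega⟩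
  have hexp : n - (k + 1) + 1 = n - k := by omega
  rw [hexp] at hK
  refine le_trans ?_ ((H.energy_filter_le (n := n) hp (fun c => sq p c ⊆ sq p (k, β / p, 0))).trans ?_)
  · rw [Finset.mul_sum]
    have hsub : cols p n (k + 1) β ⊆ Finset.range (p ^ n) := fun j hj =>
      Finset.mem_range.2 (cols_lt hkn hβ hj)
    have hKN : K ≤ p ^ n := hK.trans (Nat.pow_le_pow_right hp0 (by omega))
    have hnn : ∀ j i, 0 ≤ (if sq p (own p n j i) ⊆ sq p (k, β / p, 0) then
        (1 / (p:ℝ) ^ n) ^ 2 * rho p lp A n j i ^ 2 else 0) := by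
      intro j i; split_ifs <;> positivity
    refine le_trans (Finset.sum_le_sum fun j hj => ?_)
      (Finset.sum_le_sum_of_subset_of_nonneg hsub fun j _ _ => Finset.sum_nonneg fun i _ => hnn j i)
    rw [Finset.mul_sum]
    refine le_trans (Finset.sum_le_sum fun i hi => ?_)
      (Finset.sum_le_sum_of_subset_of_nonneg (Finset.range_subset_range.2 hKN) fun i _ _ => hnn j i)
    rw [if_pos]
    refine own_sq_subset hp (by omega) ?_ ((Finset.mem_range.1 hi).trans_le hK)
    rw [← (mem_cols hp0).1 hj, Nat.div_div_eq_div_mul, ← pow_succ, hexp]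
  · gcongr
    refine H.loc k β hβ _ fun c hc => ?_
    rw [Finset.mem_filter, mem_cellsLt hp0] at hc
    exact ⟨hc.1.1, hc.2⟩

lemma Core.gain (H : Core p lp Y0 Y A C₂ c₀) (hp : 3 ≤ p) {k β K : ℕ} (hk : 1 ≤ k)
    (hkn : k + 2 ≤ n) (hβ : β < p ^ k) (hK : K ≤ p ^ (n - k + 1)) (hK' : p ^ (n - k) ≤ K)
    {ε : ℝ} (hε : ε * ((p:ℝ) ^ 4 * (p + 1) ^ 2 * ((A * p) ^ 2 * C₂)) = 1) :
    ∑ j ∈ cols p n k β, (∑ i ∈ Finset.range K, rho p lp A n j i) ^ 2 ≤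
      (1 - ε) * (K * ∑ j ∈ cols p n k β, ∑ i ∈ Finset.range K, rho p lp A n j i ^ 2) := by
  classical
  have hp0 : 0 < p := by omega
  have hpr : (0:ℝ) < p := by positivity
  have hA := H.one_le_A
  have hC := H.C₂_pos
  have hε0 : 0 < ε := by
    by_contra h0
    have : ε * ((p:ℝ) ^ 4 * (p + 1) ^ 2 * ((A * p) ^ 2 * C₂)) ≤ 0 :=
      mul_nonpos_of_nonpos_of_nonneg (not_lt.1 h0) (by positivity)
    linarith
  have hloc := H.local_energy_le (n := n) hp hk (by omega) hβ hK
  set c1 : Idx := (k, β, 0) with hc1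
  set c2 : Idx := (k + 1, p * β + p / 2, 0) with hc2
  have hcell1 : IsCell p c1 := isCell_bottom hp hβ
  have hcell2 : IsCell p c2 := isCell_bottom hp (mul_add_mid_lt hp hβ)
  have hn1 : c1.1 < n := by simp only [hc1]; omega
  have hn2 : c2.1 < n := by simp only [hc2]; omega
  have hb1 : blk p n c1 = p ^ (n - k - 1) := rfl
  have hb2 : blk p n c2 = p ^ (n - k - 2) := by
    simp only [blk, hc2]; congr 1
  have hb12 : blk p n c1 = p * blk p n c2 := by
    rw [hb1, hb2, ← pow_succ']; congr 1; omega
  have hpw : p ^ (n - k) = p * blk p n c1 := by rw [hb1, ← pow_succ']; congr 1; omega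
  -- columns of the small hole
  have hcols2 : rng p n c2 c2.2.1 ⊆ rng p n c1 c1.2.1 := by
    intro j hj
    rw [mem_rng hp0] at hj ⊢
    simp only [hc1, hc2] at hj ⊢
    have : p ^ (n - k - 1) = p ^ (n - (k + 1) - 1) * p := by rw [← pow_succ]; congr 1; omega
    rw [this, ← Nat.div_div_eq_div_mul, hj, Nat.mul_add_div hp0, Nat.div_eq_of_lt (Nat.div_lt_self hp0 one_lt_two), add_zero]
  have hcols1 : rng p n c1 c1.2.1 ⊆ cols p n k β := by
    intro j hj
    rw [mem_rng hp0] at hj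
    rw [mem_cols hp0]
    simp only [hc1] at hj
    have : p ^ (n - k) = p ^ (n - k - 1) * p := by rw [← pow_succ]; congr 1; omega
    rw [this, ← Nat.div_div_eq_div_mul, hj, Nat.mul_add_div hp0, Nat.div_eq_of_lt (Nat.div_lt_self hp0 one_lt_two), add_zero]
  have hrow : ∀ c : Idx, c.2.2 = 0 → c = c1 ∨ c = c2 → rng p n c c.2.2 ⊆ Finset.range K := by
    intro c h0 hc i hi
    rw [h0, rng, Finset.mem_Ico, mul_zero, zero_add] at hi
    rw [Finset.mem_range]
    refine lt_of_lt_of_le hi.2 (le_trans ?_ hK')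
    rw [hpw]
    have h1 : p / 2 + 1 ≤ p := by omega
    have h2 : (p / 2 + 1) * blk p n c ≤ p * blk p n c := Nat.mul_le_mul_right _ h1
    rcases hc with rfl | rfl
    · linarith
    · rw [hb12]; nlinarith
  have hdisj : Disjoint (rng p n c1 c1.2.2) (rng p n c2 c2.2.2) := by
    rw [Finset.disjoint_left]
    intro i h1 h2
    rw [rng, Finset.mem_Ico] at h1 h2
    simp only [hc1, hc2, mul_zero, zero_add] at h1 h2
    rw [← hc1, ← hc2] at *
    have h3 : (p / 2 + 1) * blk p n c2 ≤ p / 2 * blk p n c1 := by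
      rw [hb12, ← mul_assoc]
      refine Nat.mul_le_mul_right _ ?_
      have : 1 ≤ p / 2 := by omega
      nlinarith
    nlinarith
  have hdef : ∀ j ∈ cols p n k β, (∑ i ∈ Finset.range K, rho p lp A n j i) ^ 2 +
      (if j ∈ rng p n c2 c2.2.1 then (blk p n c1 : ℝ) * blk p n c2 *
        (lp c1 / hs p c1 - lp c2 / hs p c2) ^ 2 else 0) ≤
        K * ∑ i ∈ Finset.range K, rho p lp A n j i ^ 2 := by
    intro j hj
    split_ifs with hj2
    · have := cauchy_schwarz_deficit (fun i => rho p lp A n j i) K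
        (hrow c1 rfl (Or.inl rfl)) (hrow c2 rfl (Or.inr rfl)) hdisj
        (fun i hi => rho_of_mem_rng hp hcell1 hn1 (hcols2 hj2) hi)
        (fun i hi => rho_of_mem_rng hp hcell2 hn2 hj2 hi)
      simpa [rng, Nat.card_Ico] using this
    · have := cauchy_schwarz_deficit (fun i => rho p lp A n j i) K (S₁ := ∅) (S₂ := ∅) (v₁ := 0)
        (v₂ := 0) (by simp) (by simp) (by simp) (by simp) (by simp)
      simpa using this
  have hsum := Finset.sum_le_sum hdef
  rw [Finset.sum_add_distrib, ← Finset.sum_filter,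
    Finset.filter_mem_eq_inter, Finset.inter_eq_right.2 (hcols2.trans hcols1), Finset.sum_const,
    ← Finset.mul_sum] at hsum
  rw [show (rng p n c2 c2.2.1).card = blk p n c2 by simp [rng, Nat.card_Ico], nsmul_eq_mul] at hsum
  set Etot := ∑ j ∈ cols p n k β, ∑ i ∈ Finset.range K, rho p lp A n j i ^ 2 with hE
  suffices hfin : ε * (K * Etot) ≤ (blk p n c2 : ℝ) * ((blk p n c1 : ℝ) * blk p n c2 *
        (lp c1 / hs p c1 - lp c2 / hs p c2) ^ 2) by linarith
  have hgap := H.gap k β hβ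
  have hlp1 := H.lp_pos c1 hcell1
  have hgap2 : (lp c1 / (p + 1)) ^ 2 ≤ (lp c1 - p * lp c2) ^ 2 := by
    rw [← sq_abs (lp c1 - p * lp c2)]
    have : 0 ≤ lp c1 / (p + 1) := by positivity
    gcongr
  -- rewrite everything in terms of `P = p ^ k` and `B = blk p n c2`
  obtain ⟨B, hB⟩ : ∃ B : ℝ, B = blk p n c2 := ⟨_, rfl⟩
  have hBpos : 0 < B := by rw [hB, hb2]; positivity
  obtain ⟨P, hP⟩ : ∃ P : ℝ, P = (p:ℝ) ^ k := ⟨_, rfl⟩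
  have hPpos : 0 < P := by rw [hP]; positivity
  have hB1 : (blk p n c1 : ℝ) = p * B := by rw [hb12, hB]; push_cast; ring
  have hN : (p:ℝ) ^ n = P * p ^ 2 * B := by
    rw [hP, hB, hb2]; push_cast; rw [← pow_add, ← pow_add]; congr 1; omega
  have hs1 : hs p c1 = 1 / (P * p) := by rw [hs, hP, ← pow_succ]
  have hs2 : hs p c2 = 1 / (P * p ^ 2) := by rw [hs, hP, ← pow_add]
  have hKr : (K:ℝ) ≤ p ^ 3 * B := by
    have : (K:ℝ) ≤ ((p ^ (n - k + 1) : ℕ) : ℝ) := by exact_mod_cast hK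
    refine this.trans (le_of_eq ?_)
    rw [hB, hb2]; push_cast; rw [← pow_add]; congr 1; omega
  rw [hN] at hloc
  have hEn : 0 ≤ Etot := Finset.sum_nonneg fun j _ => Finset.sum_nonneg fun i _ => sq_nonneg _
  have hE2 : Etot ≤ (P * p ^ 2 * B) ^ 2 * ((A * p) ^ 2 * (C₂ * lp c1 ^ 2)) := by
    have h1 : Etot = (P * p ^ 2 * B) ^ 2 * ((1 / (P * p ^ 2 * B)) ^ 2 * Etot) := by field_simp
    rw [h1]; gcongr
  rw [← hB, hB1, hs1, hs2]
  have e1 : lp c1 / (1 / (P * p)) - lp c2 / (1 / (P * p ^ 2)) = P * p * (lp c1 - p * lp c2) := by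
    field_simp
  rw [e1]
  calc ε * (K * Etot) ≤ ε * (p ^ 3 * B * ((P * p ^ 2 * B) ^ 2 * ((A * p) ^ 2 * (C₂ * lp c1 ^ 2)))) := by
        gcongr
    _ = (ε * ((p:ℝ) ^ 4 * (p + 1) ^ 2 * ((A * p) ^ 2 * C₂))) *
          (B ^ 3 * P ^ 2 * p ^ 3 * (lp c1 / (p + 1)) ^ 2) := by field_simp
    _ ≤ B ^ 3 * P ^ 2 * p ^ 3 * (lp c1 - p * lp c2) ^ 2 := by
        rw [hε, one_mul]; gcongr
    _ = _ := by ring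

end

/-- A trapezoidal cut-off around `1/2`. -/
noncomputable def trap (W L x : ℝ) : ℝ := max 0 (min 1 ((W - |x - 1 / 2|) / L))

lemma trap_nonneg (W L x : ℝ) : 0 ≤ trap W L x := le_max_left _ _

lemma trap_le_one (W L x : ℝ) : trap W L x ≤ 1 := max_le (by norm_num) (min_le_left _ _)

lemma trap_lipschitz {W L : ℝ} (hL : 0 < L) (x y : ℝ) :
    |trap W L x - trap W L y| ≤ |x - y| / L := by
  unfold trap
  refine (abs_max_sub_max_le_max _ _ _ _).trans (max_le (by simp; positivity) ?_)
  refine (abs_min_sub_min_le_max _ _ _ _).trans (max_le (by simp; positivity) ?_)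
  rw [← sub_div, abs_div, abs_of_pos hL, sub_sub_sub_cancel_left]
  refine div_le_div_of_nonneg_right ?_ hL.le
  have h := abs_abs_sub_abs_le (y - 1 / 2) (x - 1 / 2)
  rwa [sub_sub_sub_cancel_right, abs_sub_comm y x] at h

lemma abs_lt_of_trap_ne_zero {W L x : ℝ} (hL : 0 < L) (h : trap W L x ≠ 0) : |x - 1 / 2| < W := by
  by_contra hlt
  refine h (max_eq_left ((min_le_right _ _).trans ?_))
  exact div_nonpos_of_nonpos_of_nonneg (by linarith) hL.le

lemma trap_eq_one {W L x : ℝ} (hL : 0 < L) (h : |x - 1 / 2| ≤ W - L) : trap W L x = 1 := by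
  unfold trap
  rw [min_eq_left, max_eq_right zero_le_one]
  rw [le_div_iff₀ hL]; linarith

/-- Weighted energy below height `Ht` on the level-`n` grid. -/
noncomputable def energy (p : ℕ) (lp : Idx → ℝ) (A : ℝ) (χ : ℝ → ℝ) (n : ℕ) (Ht : ℝ) : ℝ :=
  ∑ j ∈ Finset.range (p ^ n), ∑ i ∈ Finset.range (p ^ n),
    (1 / (p:ℝ) ^ n) ^ 2 * rho p lp A n j i ^ 2 *
      (χ (((j:ℝ) + 1 / 2) * (1 / (p:ℝ) ^ n)) * max 0 (Ht - (i + 1 : ℕ) * (1 / (p:ℝ) ^ n)))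

section
variable {p : ℕ} {lp Y0 : Idx → ℝ} {Y : ℂ → ℝ} {A C₂ c₀ : ℝ}

lemma col_near (hp0 : 0 < p) {n k : ℕ} (hk : k ≤ n) (j : ℕ) :
    |((j / p ^ (n - k) : ℕ) : ℝ) / (p:ℝ) ^ k - ((j:ℝ) + 1 / 2) * (1 / (p:ℝ) ^ n)| ≤
      1 / (p:ℝ) ^ k := by
  have h0 : 0 < p ^ (n - k) := by positivity
  set β := j / p ^ (n - k) with hβ
  have h1 : β * p ^ (n - k) ≤ j ∧ j + 1 ≤ β * p ^ (n - k) + p ^ (n - k) := by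
    have := (Nat.div_eq_iff h0 (x := j) (y := β)).1 rfl
    omega
  have hN : (p:ℝ) ^ n = (p:ℝ) ^ k * (p:ℝ) ^ (n - k) := by rw [← pow_add]; congr 1; omega
  have h2 : (β:ℝ) * (p:ℝ) ^ (n - k) ≤ j := by exact_mod_cast h1.1
  have h3 : (j:ℝ) + 1 ≤ β * (p:ℝ) ^ (n - k) + (p:ℝ) ^ (n - k) := by exact_mod_cast h1.2
  have hP : (0:ℝ) < (p:ℝ) ^ k := by positivity
  have hQ : (0:ℝ) < (p:ℝ) ^ (n - k) := by positivity
  have e : ((j:ℝ) + 1 / 2) * (1 / (p:ℝ) ^ n) = ((j:ℝ) + 1 / 2) / (p:ℝ) ^ (n - k) / (p:ℝ) ^ k := by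
    rw [hN]; field_simp
  rw [e, ← sub_div, abs_div, abs_of_pos hP]
  gcongr
  rw [abs_le]
  have h4 : (β:ℝ) ≤ ((j:ℝ) + 1 / 2) / (p:ℝ) ^ (n - k) := by rw [le_div_iff₀ hQ]; linarith
  have h5 : ((j:ℝ) + 1 / 2) / (p:ℝ) ^ (n - k) ≤ β + 1 := by rw [div_le_iff₀ hQ]; linarith
  constructor <;> linarith

lemma exists_scale (hp : 3 ≤ p) {x : ℝ} (hx : 0 < x) (hx1 : x < 1) :
    ∃ k : ℕ, 1 ≤ k ∧ 1 / (p:ℝ) ^ k ≤ x ∧ x < p * (1 / (p:ℝ) ^ k) := by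
  classical
  have hpr : (1:ℝ) < p := by exact_mod_cast (by omega : 1 < p)
  have hex : ∃ k : ℕ, 1 / (p:ℝ) ^ k ≤ x := by
    obtain ⟨k, hk⟩ := exists_pow_lt_of_lt_one hx (inv_lt_one_of_one_lt₀ hpr)
    exact ⟨k, by rw [one_div, ← inv_pow]; exact hk.le⟩
  obtain ⟨k, h1, hmin⟩ : ∃ k : ℕ, 1 / (p:ℝ) ^ k ≤ x ∧ ∀ m < k, ¬ 1 / (p:ℝ) ^ m ≤ x :=
    ⟨Nat.find hex, Nat.find_spec hex, fun m hm => Nat.find_min hex hm⟩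
  obtain _ | k := k
  · simp at h1; linarith
  refine ⟨k + 1, by omega, h1, ?_⟩
  have := hmin k (by omega)
  push Not at this
  refine this.trans_eq ?_
  rw [pow_succ']; field_simp

/-- Energies at heights `Ht` and `(1 + r) Ht` for nested windows. -/
lemma energy_succ_ge {n K : ℕ} {Ht r : ℝ} {χ χ' : ℝ → ℝ} (hr : 0 ≤ r)
    (hK : Ht = K * (1 / (p:ℝ) ^ n)) (hKN : K ≤ p ^ n) (hp0 : 0 < p)
    (hχ1 : ∀ x, χ x ≤ 1) (hχ' : ∀ x, 0 ≤ χ' x)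
    {J : Finset ℕ} (hJ : J ⊆ Finset.range (p ^ n))
    (hJ0 : ∀ j < p ^ n, χ (((j:ℝ) + 1 / 2) * (1 / (p:ℝ) ^ n)) ≠ 0 → j ∈ J)
    (hJ1 : ∀ j ∈ J, χ' (((j:ℝ) + 1 / 2) * (1 / (p:ℝ) ^ n)) = 1) :
    energy p lp A χ n Ht + r * Ht * ((1 / (p:ℝ) ^ n) ^ 2 *
      ∑ j ∈ J, ∑ i ∈ Finset.range K, rho p lp A n j i ^ 2) ≤
      energy p lp A χ' n ((1 + r) * Ht) := by
  classical
  obtain ⟨h, hh⟩ : ∃ h : ℝ, h = 1 / (p:ℝ) ^ n := ⟨_, rfl⟩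
  have hhp : 0 < h := by rw [hh]; positivity
  unfold energy
  rw [← hh] at hK ⊢
  simp only [← hh] at hJ0 hJ1
  have hHt : 0 ≤ Ht := by rw [hK]; positivity
  have e : r * Ht * (h ^ 2 * ∑ j ∈ J, ∑ i ∈ Finset.range K, rho p lp A n j i ^ 2) =
      ∑ j ∈ Finset.range (p ^ n), ∑ i ∈ Finset.range (p ^ n), h ^ 2 * rho p lp A n j i ^ 2 *
        (if j ∈ J then if i < K then r * Ht else 0 else 0) := by
    rw [← Finset.sum_subset hJ]
    · rw [Finset.mul_sum, Finset.mul_sum]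
      refine Finset.sum_congr rfl fun j hj => ?_
      rw [← Finset.sum_subset (Finset.range_subset_range.2 hKN), Finset.mul_sum, Finset.mul_sum]
      · refine Finset.sum_congr rfl fun i hi => ?_
        rw [if_pos hj, if_pos (Finset.mem_range.1 hi)]; ring
      · intro i _ hi
        rw [Finset.mem_range] at hi
        rw [if_neg hi]; simp
    · intro j _ hj
      refine Finset.sum_eq_zero fun i _ => ?_
      rw [if_neg hj, mul_zero]
  rw [e, ← Finset.sum_add_distrib]
  refine Finset.sum_le_sum fun j hj => ?_
  rw [← Finset.sum_add_distrib]
  refine Finset.sum_le_sum fun i _ => ?_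
  rw [← mul_add]
  gcongr
  by_cases hjJ : j ∈ J
  · rw [if_pos hjJ, hJ1 j hjJ, one_mul]
    have h1 : χ (((j:ℝ) + 1 / 2) * h) * max 0 (Ht - (i + 1 : ℕ) * h) ≤
        max 0 (Ht - (i + 1 : ℕ) * h) := by
      have := mul_le_mul_of_nonneg_right (hχ1 (((j:ℝ) + 1 / 2) * h))
        (le_max_left 0 (Ht - (i + 1 : ℕ) * h))
      rwa [one_mul] at this
    have h0 : 0 ≤ r * Ht := by positivity
    split_ifs with hi
    · have h2 : ((i + 1 : ℕ):ℝ) * h ≤ Ht := by rw [hK]; gcongr; exact hi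
      rw [max_eq_right (sub_nonneg.2 h2)] at h1 ⊢
      refine le_trans ?_ (le_max_right _ _)
      linarith
    · rw [add_zero]
      exact h1.trans (max_le_max le_rfl (by linarith))
  · rw [if_neg hjJ, add_zero]
    have : χ (((j:ℝ) + 1 / 2) * h) = 0 := by
      by_contra hne
      exact hjJ (hJ0 j (Finset.mem_range.1 hj) hne)
    rw [this, zero_mul]
    exact mul_nonneg (hχ' _) (le_max_left _ _)

lemma Core.energy_le_total (H : Core p lp Y0 Y A C₂ c₀) (hp : 3 ≤ p) {χ : ℝ → ℝ} {n : ℕ} {Ht : ℝ}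
    (hχ1 : ∀ x, χ x ≤ 1) (hH1 : Ht ≤ 1) : energy p lp A χ n Ht ≤ (A * p) ^ 2 := by
  classical
  have hp0 : 0 < p := by omega
  have h1 := H.energy_filter_le (n := n) hp (fun _ => True)
  have h2 := H.sum_le ((cellsLt p (n + 1)).filter fun _ => True) (by
    intro c hc; rw [Finset.mem_filter, mem_cellsLt hp0] at hc; exact hc.1.1)
  refine le_trans ?_ (h1.trans (mul_le_of_le_one_right (by positivity) h2))
  refine Finset.sum_le_sum fun j _ => Finset.sum_le_sum fun i _ => ?_
  rw [if_pos trivial]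
  refine mul_le_of_le_one_right (by positivity) ?_
  have h3 : max 0 (Ht - (i + 1 : ℕ) * (1 / (p:ℝ) ^ n)) ≤ 1 := max_le zero_le_one (by
    have : 0 ≤ ((i + 1 : ℕ):ℝ) * (1 / (p:ℝ) ^ n) := by positivity
    linarith)
  calc _ ≤ 1 * max 0 (Ht - (i + 1 : ℕ) * (1 / (p:ℝ) ^ n)) := by
        gcongr; exact hχ1 _
    _ ≤ 1 := by linarith

lemma Core.energy_ge (H : Core p lp Y0 Y A C₂ c₀) (hp : 3 ≤ p) (hop : Odd p) {χ : ℝ → ℝ} {n b : ℕ}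
    (hb : 1 ≤ b) (hbn : b < n) (hχ0 : ∀ x, 0 ≤ χ x)
    (hχ1 : ∀ x : ℝ, |x - 1 / 2| ≤ 1 / (2 * p) → χ x = 1) :
    c₀ / p * (1 / (p:ℝ) ^ b) ^ 2 ≤ energy p lp A χ n (1 / (p:ℝ) ^ b) := by
  classical
  have hp0 : 0 < p := by omega
  have hpr : (0:ℝ) < p := by positivity
  obtain ⟨h, hh⟩ : ∃ h : ℝ, h = 1 / (p:ℝ) ^ n := ⟨_, rfl⟩
  have hhp : 0 < h := by rw [hh]; positivity
  unfold energy
  rw [sum_grid_eq hp, ← hh]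
  have hS : 0 ≤ ∑ c ∈ cellsEq p n, h ^ 2 * rho p lp A n c.2.1 c.2.2 ^ 2 *
      (χ (((c.2.1:ℝ) + 1 / 2) * h) * max 0 (1 / (p:ℝ) ^ b - (c.2.2 + 1 : ℕ) * h)) :=
    Finset.sum_nonneg fun c _ => mul_nonneg (by positivity) (mul_nonneg (hχ0 _) (le_max_left _ _))
  refine le_trans ?_ (le_add_of_nonneg_right hS)
  set I := Finset.Ico ((p / 2) * p ^ (b - 1)) ((p / 2 + 1) * p ^ (b - 1)) with hI
  have hIlt : ∀ β ∈ I, β < p ^ b := by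
    intro β hβ
    rw [hI, Finset.mem_Ico] at hβ
    have h1 : (p / 2 + 1) * p ^ (b - 1) ≤ p * p ^ (b - 1) := Nat.mul_le_mul_right _ (by omega)
    rw [← pow_succ', Nat.sub_add_cancel hb] at h1
    omega
  have hinj : Set.InjOn (fun β : ℕ => ((b, β, 0) : Idx)) (I : Set ℕ) := by
    intro x _ y _ hxy
    exact congrArg (fun c : Idx => c.2.1) hxy
  have hsub : I.image (fun β : ℕ => ((b, β, 0) : Idx)) ⊆ cellsLt p n := by
    intro c hc
    rw [Finset.mem_image] at hc
    obtain ⟨β, hβ, rfl⟩ := hc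
    exact (mem_cellsLt hp0).2 ⟨isCell_bottom hp (hIlt β hβ), hbn⟩
  refine le_trans ?_ (Finset.sum_le_sum_of_subset_of_nonneg hsub fun c _ _ =>
    Finset.sum_nonneg fun j _ => Finset.sum_nonneg fun i _ =>
      mul_nonneg (by positivity) (mul_nonneg (hχ0 _) (le_max_left _ _)))
  rw [Finset.sum_image hinj]
  have hlow := H.lower b hb
  have e0 : c₀ / p * (1 / (p:ℝ) ^ b) ^ 2 = 1 / (p:ℝ) ^ (b + 1) * (c₀ / (p:ℝ) ^ b) := by
    field_simp; ring
  rw [e0]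
  refine (mul_le_mul_of_nonneg_left hlow (by positivity)).trans ?_
  rw [Finset.mul_sum]
  refine Finset.sum_le_sum fun β hβ => ?_
  set c : Idx := (b, β, 0) with hc
  have hcell : IsCell p c := isCell_bottom hp (hIlt β hβ)
  have hcn : c.1 < n := hbn
  have hl := hs_pos hp0 c
  have hkh : (blk p n c:ℝ) * h = hs p c := by rw [hh, blk_mul hp0 hcn]
  have hterm : ∀ j ∈ rng p n c c.2.1, ∀ i ∈ rng p n c c.2.2,
      h ^ 2 * (lp c / hs p c) ^ 2 * (1 / (p:ℝ) ^ (b + 1)) ≤ h ^ 2 * rho p lp A n j i ^ 2 *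
      (χ (((j:ℝ) + 1 / 2) * h) * max 0 (1 / (p:ℝ) ^ b - (i + 1 : ℕ) * h)) := by
    intro j hj i hi
    rw [rho_of_mem_rng hp hcell hcn hj hi]
    gcongr
    have hj' : j < p ^ n := rng_lt hp hcell.1 hcn hj
    have hχj : χ (((j:ℝ) + 1 / 2) * h) = 1 := by
      apply hχ1
      -- the column lies over the central `1/p` interval
      have hx1 := rng_half hj
      have hx2 : ((p / 2 : ℕ):ℝ) / p ≤ ((j:ℝ) + 1 / 2) * h ∧
          ((j:ℝ) + 1 / 2) * h ≤ (((p / 2 : ℕ):ℝ) + 1) / p := by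
        have hjd : j / p ^ (n - 1) = p / 2 := by
          rw [mem_rng hp0] at hj
          have e1 : p ^ (n - 1) = p ^ (n - b - 1) * (p * p ^ (b - 1)) := by
            rw [← pow_succ', ← pow_add]; congr 1; omega
          rw [e1, ← Nat.div_div_eq_div_mul]
          have hj1 : j / p ^ (n - b - 1) = p * β + p / 2 := hj
          rw [hj1, ← Nat.div_div_eq_div_mul, Nat.mul_add_div hp0,
            Nat.div_eq_of_lt (Nat.div_lt_self hp0 one_lt_two), add_zero]
          rw [Finset.mem_Ico] at hβ
          have hq : 0 < p ^ (b - 1) := by positivity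
          rw [Nat.div_eq_iff hq]
          rw [add_mul, one_mul] at hβ
          omega
        have hq : 0 < p ^ (n - 1) := by positivity
        rw [Nat.div_eq_iff hq] at hjd
        have h1 : ((p / 2 : ℕ):ℝ) * (p:ℝ) ^ (n - 1) ≤ j := by exact_mod_cast hjd.1
        have h2 : (j:ℝ) + 1 ≤ ((p / 2 : ℕ):ℝ) * (p:ℝ) ^ (n - 1) + (p:ℝ) ^ (n - 1) := by
          exact_mod_cast (by omega : j + 1 ≤ p / 2 * p ^ (n - 1) + p ^ (n - 1))
        have hQ : (0:ℝ) < (p:ℝ) ^ (n - 1) := by positivity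
        have hN : (p:ℝ) ^ n = p * (p:ℝ) ^ (n - 1) := by rw [← pow_succ']; congr 1; omega
        rw [hh, hN, mul_one_div, div_le_div_iff₀ hpr (by positivity),
          div_le_div_iff₀ (by positivity) hpr]
        constructor <;> nlinarith
      obtain ⟨m, hm⟩ := hop
      have hm2 : ((p / 2 : ℕ):ℝ) = (p - 1) / 2 := by
        have : p / 2 = m := by omega
        rw [this, hm]; push_cast; ring
      rw [hm2] at hx2
      have e1 : ((p:ℝ) - 1) / 2 / p = 1 / 2 - 1 / (2 * p) := by field_simp
      have e2 : (((p:ℝ) - 1) / 2 + 1) / p = 1 / 2 + 1 / (2 * p) := by field_simp; ring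
      rw [e1, e2] at hx2
      rw [abs_le]; constructor <;> linarith [hx2.1, hx2.2]
    rw [hχj, one_mul]
    refine le_trans ?_ (le_max_right _ _)
    have hi2 : ((i + 1 : ℕ):ℝ) * h ≤ ((p / 2 : ℕ) + 1) * hs p c := by
      rw [rng, Finset.mem_Ico] at hi
      have h1 : i + 1 ≤ (p / 2) * blk p n c + blk p n c := by
        have := hi.2
        simp only [hc, mul_zero, zero_add] at this
        exact this
      have h2 : ((i + 1 : ℕ):ℝ) ≤ ((p / 2 : ℕ):ℝ) * blk p n c + blk p n c := by exact_mod_cast h1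
      calc ((i + 1 : ℕ):ℝ) * h ≤ (((p / 2 : ℕ):ℝ) * blk p n c + blk p n c) * h := by gcongr
        _ = _ := by rw [add_mul, mul_assoc, hkh]; ring
    have hp3 : ((p / 2 : ℕ):ℝ) + 2 ≤ p := by exact_mod_cast (by omega : p / 2 + 2 ≤ p)
    have e1 : 1 / (p:ℝ) ^ b = p * hs p c := by
      rw [hs, pow_succ]; field_simp; simp [hc]
    have e2 : 1 / (p:ℝ) ^ (b + 1) = hs p c := rfl
    rw [e1, e2]
    nlinarith
  refine le_trans (le_of_eq ?_) (Finset.sum_le_sum fun j hj => Finset.sum_le_sum fun i hi => hterm j hj i hi)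
  simp only [Finset.sum_const, rng, Nat.card_Ico, Nat.add_sub_cancel_left, nsmul_eq_mul]
  have : (blk p n c:ℝ) * (blk p n c * (h ^ 2 * (lp c / hs p c) ^ 2 * (1 / (p:ℝ) ^ (b + 1)))) =
    (blk p n c * h * (lp c / hs p c)) ^ 2 * (1 / (p:ℝ) ^ (b + 1)) := by ring
  rw [this, hkh, mul_div_cancel₀ _ hl.ne', mul_comm]

end

/-- The cut-off attached to height `Ht`. -/
noncomputable def win (p : ℕ) (Λ lam Ht : ℝ) : ℝ → ℝ :=
  trap (1 / (2 * p) + Λ * Ht - 3 * Ht) (6 * Ht / lam)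

section
variable {p : ℕ} {lp Y0 : Idx → ℝ} {Y : ℂ → ℝ} {A C₂ c₀ : ℝ}

/-- Comparison of the energies at heights `Ht` and `(1 + r) * Ht`. -/
lemma Core.energy_step (H : Core p lp Y0 Y A C₂ c₀) (hp : 3 ≤ p) (hop : Odd p)
    {ε lam Λ r Ht δ : ℝ} (hε : ε * ((p:ℝ) ^ 4 * (p + 1) ^ 2 * ((A * p) ^ 2 * C₂)) = 1)
    (hl0 : 0 < lam) (hl1 : lam ≤ 1) (hr : 0 ≤ r) (hH : 0 < Ht) (hH2 : Ht ≤ 1 / 2)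
    (hΛ : Λ * Ht ≤ 1 / 12) (hΛr : Λ + 1 ≤ (1 + r) * (Λ - 3 - 6 / lam)) (hδ : 0 < δ) :
    ∃ n0 : ℕ, ∀ n ≥ n0, ∀ K : ℕ, Ht = K * (1 / (p:ℝ) ^ n) → ∃ m : ℝ,
      energy p lp A (win p Λ lam Ht) n Ht ≤ δ + (1 + lam) * (1 - ε) / 2 * m ∧
      energy p lp A (win p Λ lam Ht) n Ht + r * m ≤
        energy p lp A (win p Λ lam ((1 + r) * Ht)) n ((1 + r) * Ht) := by
  classical
  have hp0 : 0 < p := by omega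
  have hpr : (0:ℝ) < p := by positivity
  have hp3 : (3:ℝ) ≤ p := by exact_mod_cast hp
  have hL : 0 < 6 * Ht / lam := by positivity
  have hL' : 0 < 6 * ((1 + r) * Ht) / lam := by positivity
  have elL : 6 * Ht / (6 * Ht / lam) = lam := by field_simp
  have hinv : 1 / (2 * (p:ℝ)) ≤ 1 / 6 := by
    apply one_div_le_one_div_of_le <;> linarith
  obtain ⟨k, hk1, hkH, hHk⟩ := exists_scale hp hH (by linarith)
  obtain ⟨n0, hn0⟩ := H.energy_le hp hop (win p Λ lam Ht) hH hH2 hL (by rw [elL]; exact hl1)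
    (fun x => trap_nonneg _ _ x) (fun x => trap_le_one _ _ x) (fun x y => trap_lipschitz hL x y)
    (fun x hx => by
      have := abs_lt_of_trap_ne_zero hL hx
      rw [abs_lt] at this
      constructor <;> linarith) hδ
  refine ⟨max n0 (k + 2), fun n hn K hK => ?_⟩
  have hkn : k + 2 ≤ n := (le_max_right _ _).trans hn
  have hkn' : k ≤ n := by omega
  have hPn : (0:ℝ) < (p:ℝ) ^ n := by positivity
  have hPk : (0:ℝ) < (p:ℝ) ^ k := by positivity
  have hKr : (K:ℝ) = Ht * (p:ℝ) ^ n := by rw [hK]; field_simp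
  have hN : (p:ℝ) ^ n = (p:ℝ) ^ k * (p:ℝ) ^ (n - k) := by rw [← pow_add]; congr 1; omega
  have hQ : (0:ℝ) < (p:ℝ) ^ (n - k) := by positivity
  have hK1 : p ^ (n - k) ≤ K := by
    have : (p:ℝ) ^ (n - k) ≤ K := by
      rw [hKr, hN, ← mul_assoc]
      rw [div_le_iff₀ hPk] at hkH
      nlinarith
    exact_mod_cast this
  have hK2 : K ≤ p ^ (n - k + 1) := by
    have : (K:ℝ) ≤ (p:ℝ) ^ (n - k + 1) := by
      rw [hKr, hN, ← mul_assoc, pow_succ']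
      rw [mul_one_div, lt_div_iff₀ hPk] at hHk
      nlinarith
    exact_mod_cast this
  have hKN : K ≤ p ^ n := hK2.trans (Nat.pow_le_pow_right hp0 (by omega))
  set B := (Finset.range (p ^ k)).filter
    fun β : ℕ => |(β:ℝ) / (p:ℝ) ^ k - 1 / 2| ≤ 1 / (2 * p) + Λ * Ht with hB
  set J := B.biUnion (cols p n k) with hJ
  have hmemJ : ∀ j, j < p ^ n → |((j:ℝ) + 1 / 2) * (1 / (p:ℝ) ^ n) - 1 / 2| ≤
      1 / (2 * p) + Λ * Ht - Ht → j ∈ J := by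
    intro j hj hx
    rw [hJ, Finset.mem_biUnion]
    refine ⟨j / p ^ (n - k), ?_, (mem_cols hp0).2 rfl⟩
    rw [hB, Finset.mem_filter, Finset.mem_range]
    constructor
    · rw [Nat.div_lt_iff_lt_mul (by positivity), ← pow_add, Nat.add_sub_cancel' hkn']; exact hj
    · have h1 := col_near hp0 hkn' j
      have h2 := abs_sub_le (((j / p ^ (n - k) : ℕ) : ℝ) / (p:ℝ) ^ k)
        (((j:ℝ) + 1 / 2) * (1 / (p:ℝ) ^ n)) (1 / 2)
      linarith
  have hJsub : J ⊆ Finset.range (p ^ n) := by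
    intro j hj
    rw [hJ, Finset.mem_biUnion] at hj
    obtain ⟨β, hβ, hj⟩ := hj
    rw [hB, Finset.mem_filter, Finset.mem_range] at hβ
    exact Finset.mem_range.2 (cols_lt hkn' hβ.1 hj)
  have hdisj : (B : Set ℕ).PairwiseDisjoint (cols p n k) := by
    intro β _ β' _ hne
    refine Finset.disjoint_left.2 fun j hj hj' => hne ?_
    rw [mem_cols hp0] at hj hj'
    exact hj.symm.trans hj'
  have hen := hn0 n ((le_max_left _ _).trans hn) K hK J hJsub (by
    intro c hc hcn hcK hx j hj
    obtain ⟨x, hx1, hx2, hx0⟩ := hx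
    have hyH : hy p c < Ht := by
      rw [hy, hx_eq hp0 hcn, hK]
      gcongr
    have hsH : hs p c < Ht := (hs_le_hy hp c).trans_lt hyH
    have hxw := abs_lt_of_trap_ne_zero hL hx0
    have hjb := rng_half hj
    have e1 := hx_eq hp0 hcn c.2.1
    have e2 := blk_mul hp0 hcn
    have hh : (0:ℝ) < 1 / (p:ℝ) ^ n := by positivity
    have hj1 : hx p c ≤ ((j:ℝ) + 1 / 2) * (1 / (p:ℝ) ^ n) := by
      rw [hx, e1]; push_cast at hjb ⊢; gcongr; exact hjb.1.le
    have hj2 : ((j:ℝ) + 1 / 2) * (1 / (p:ℝ) ^ n) ≤ hx p c + hs p c := by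
      rw [hx, e1, ← e2, ← add_mul]; push_cast at hjb ⊢
      exact mul_le_mul_of_nonneg_right hjb.2.le hh.le
    refine hmemJ j (rng_lt hp hc.1 hcn hj) ?_
    rw [abs_lt] at hxw
    rw [abs_le]; constructor <;> linarith)
  rw [elL] at hen
  refine ⟨Ht * ((1 / (p:ℝ) ^ n) ^ 2 * ∑ j ∈ J, ∑ i ∈ Finset.range K, rho p lp A n j i ^ 2), ?_, ?_⟩
  · refine hen.trans (add_le_add le_rfl ?_)
    have hsum : ∑ j ∈ J, (∑ i ∈ Finset.range K, rho p lp A n j i) ^ 2 ≤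
        (1 - ε) * (K * ∑ j ∈ J, ∑ i ∈ Finset.range K, rho p lp A n j i ^ 2) := by
      rw [hJ, Finset.sum_biUnion hdisj, Finset.sum_biUnion hdisj, Finset.mul_sum, Finset.mul_sum]
      refine Finset.sum_le_sum fun β hβ => ?_
      rw [hB, Finset.mem_filter, Finset.mem_range] at hβ
      exact H.gain hp hk1 hkn hβ.1 hK2 hK1 hε
    refine (mul_le_mul_of_nonneg_left hsum (by positivity)).trans (le_of_eq ?_)
    rw [hK]; ring
  · have := energy_succ_ge (lp := lp) (A := A) (χ := win p Λ lam Ht)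
      (χ' := win p Λ lam ((1 + r) * Ht)) hr hK hKN hp0
      (fun x => trap_le_one _ _ x) (fun x => trap_nonneg _ _ x) hJsub
      (fun j hj hne => hmemJ j hj (by
        have := abs_lt_of_trap_ne_zero hL hne
        linarith))
      (fun j hj => by
        rw [hJ, Finset.mem_biUnion] at hj
        obtain ⟨β, hβ, hj⟩ := hj
        rw [hB, Finset.mem_filter, Finset.mem_range] at hβ
        rw [mem_cols hp0] at hj
        have h1 := col_near hp0 hkn' j
        rw [hj, abs_sub_comm] at h1
        have h2 := abs_sub_le (((j:ℝ) + 1 / 2) * (1 / (p:ℝ) ^ n)) ((β:ℝ) / (p:ℝ) ^ k) (1 / 2)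
        apply trap_eq_one hL'
        have e : 1 / (2 * (p:ℝ)) + Λ * ((1 + r) * Ht) - 3 * ((1 + r) * Ht) -
            6 * ((1 + r) * Ht) / lam = 1 / (2 * p) + (1 + r) * (Λ - 3 - 6 / lam) * Ht := by
          field_simp; ring
        rw [e]
        have h3 := mul_le_mul_of_nonneg_right hΛr hH.le
        linarith [hβ.2])
    rw [← mul_assoc]
    exact this

lemma growth_factor {ε r δ E m E' : ℝ} (hε0 : 0 < ε) (hε1 : ε < 1) (hr0 : 0 < r) (hr : r ≤ ε / 2)
    (hE : 0 ≤ E) (hδ : δ ≤ ε / 8 * E) (h1 : E ≤ δ + (1 + ε / 8) * (1 - ε) / 2 * m)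
    (h2 : E + r * m ≤ E') : (1 + r) ^ 2 * (1 + r * ε / 8) * E ≤ E' := by
  have h3 : 2 * (1 + ε / 2) * E ≤ m := by
    have hpos : 0 < (1 + ε / 8) * (1 - ε) := mul_pos (by linarith) (by linarith)
    refine le_of_mul_le_mul_left ?_ hpos
    have h4 : (1 - ε / 8) * E ≤ (1 + ε / 8) * (1 - ε) / 2 * m := by linarith
    have h5 : (1 + ε / 2) * ((1 + ε / 8) * (1 - ε)) ≤ 1 - ε / 8 := by
      nlinarith [pow_pos hε0 2, pow_pos hε0 3]
    have h6 := mul_le_mul_of_nonneg_right h5 hE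
    linarith
  have h7 := mul_le_mul_of_nonneg_left h3 hr0.le
  have h8 : (1 + r) ^ 2 * (1 + r * ε / 8) ≤ 1 + 2 * r + r * ε := by
    have h9 : (1 + r) ^ 2 ≤ 4 := by nlinarith
    have h10 : 0 ≤ r * ε / 8 := by positivity
    have h11 := mul_le_mul_of_nonneg_right h9 h10
    nlinarith
  have h12 := mul_le_mul_of_nonneg_right h8 hE
  linarith

theorem Core.false (H : Core p lp Y0 Y A C₂ c₀) (hp : 3 ≤ p) (hop : Odd p) : False := by
  have hp0 : 0 < p := by omega
  have hpr : (0:ℝ) < p := by positivity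
  have hp3 : (3:ℝ) ≤ p := by exact_mod_cast hp
  have hA := H.one_le_A
  have hC := H.C₂_pos
  have hc0 := H.c₀_pos
  obtain ⟨Q, hQ⟩ : ∃ Q : ℝ, Q = (p:ℝ) ^ 4 * (p + 1) ^ 2 * ((A * p) ^ 2 * C₂) := ⟨_, rfl⟩
  have hQ1 : 1 < Q := by
    have a1 : (1:ℝ) ≤ (p:ℝ) ^ 4 := one_le_pow₀ (by linarith)
    have a2 : (1:ℝ) < ((p:ℝ) + 1) ^ 2 := one_lt_pow₀ (by linarith) (by norm_num)
    have a3 : (1:ℝ) ≤ (A * p) ^ 2 := one_le_pow₀ (by nlinarith)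
    have a4 : (1:ℝ) ≤ (A * p) ^ 2 * C₂ := one_le_mul_of_one_le_of_one_le a3 hC
    rw [hQ]
    calc (1:ℝ) < (p:ℝ) ^ 4 * (p + 1) ^ 2 := by nlinarith
      _ ≤ _ := le_mul_of_one_le_right (by positivity) a4
  obtain ⟨ε, hεdef⟩ : ∃ ε : ℝ, ε = 1 / Q := ⟨_, rfl⟩
  have hε0 : 0 < ε := by rw [hεdef]; positivity
  have hε1 : ε < 1 := by rw [hεdef, div_lt_one (by linarith)]; exact hQ1
  have hε : ε * ((p:ℝ) ^ 4 * (p + 1) ^ 2 * ((A * p) ^ 2 * C₂)) = 1 := by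
    rw [← hQ, hεdef]; field_simp
  obtain ⟨a, _, har, _⟩ := exists_scale hp (x := ε / 2) (by linarith) (by linarith)
  obtain ⟨r, hrdef⟩ : ∃ r : ℝ, r = 1 / (p:ℝ) ^ a := ⟨_, rfl⟩
  rw [← hrdef] at har
  have hr0 : 0 < r := by rw [hrdef]; positivity
  obtain ⟨Λ, hΛdef⟩ : ∃ Λ : ℝ, Λ = (1 + (1 + r) * (3 + 6 / (ε / 8))) / r := ⟨_, rfl⟩
  have hΛr : Λ * r = 1 + (1 + r) * (3 + 6 / (ε / 8)) := by rw [hΛdef]; field_simp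
  have hu : 0 < 6 / (ε / 8) := by positivity
  have hΛ3 : 3 + 6 / (ε / 8) ≤ Λ := by
    refine le_of_mul_le_mul_right ?_ hr0
    rw [hΛr]; nlinarith
  have hΛ0 : 0 < Λ := by linarith
  obtain ⟨Hm, hHm⟩ : ∃ Hm : ℝ, Hm = min (1 / 2) (1 / (12 * Λ)) := ⟨_, rfl⟩
  have hHm0 : 0 < Hm := by rw [hHm]; positivity
  have hHm2 : Hm ≤ 1 / 2 := by rw [hHm]; exact min_le_left _ _
  have hHmΛ : Λ * Hm ≤ 1 / 12 := by
    have : Hm ≤ 1 / (12 * Λ) := by rw [hHm]; exact min_le_right _ _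
    rw [le_div_iff₀ (by positivity)] at this
    linarith
  obtain ⟨T, hT⟩ := pow_unbounded_of_one_lt ((A * p) ^ 2 / (c₀ / p * (Hm / p) ^ 2))
    (show 1 < 1 + r * ε / 8 by linarith [mul_pos hr0 hε0])
  have h1r : 1 ≤ 1 + r := by linarith
  obtain ⟨b, hb1, hbx, hxb⟩ := exists_scale hp (x := Hm / (1 + r) ^ T) (by positivity) (by
    rw [div_lt_one (by positivity)]
    exact lt_of_lt_of_le (by linarith) (one_le_pow₀ h1r))
  rw [le_div_iff₀ (by positivity)] at hbx
  rw [div_lt_iff₀ (by positivity)] at hxb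
  obtain ⟨e, he⟩ : ∃ e : ℝ, e = c₀ / p * (1 / (p:ℝ) ^ b) ^ 2 := ⟨_, rfl⟩
  have he0 : 0 < e := by rw [he]; positivity
  let Hh : ℕ → ℝ := fun t => 1 / (p:ℝ) ^ b * (1 + r) ^ t
  have hHh0 : ∀ t, 0 < Hh t := fun t => by positivity
  have hHhm : ∀ t ≤ T, Hh t ≤ Hm := fun t ht => by
    refine le_trans ?_ hbx
    exact mul_le_mul_of_nonneg_left (pow_le_pow_right₀ h1r ht) (by positivity)
  have hstep : ∀ t, ∃ n0 : ℕ, t < T → ∀ n ≥ n0, ∀ K : ℕ, Hh t = K * (1 / (p:ℝ) ^ n) → ∃ m : ℝ,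
      energy p lp A (win p Λ (ε / 8) (Hh t)) n (Hh t) ≤
        ε / 8 * e + (1 + ε / 8) * (1 - ε) / 2 * m ∧
      energy p lp A (win p Λ (ε / 8) (Hh t)) n (Hh t) + r * m ≤
        energy p lp A (win p Λ (ε / 8) ((1 + r) * Hh t)) n ((1 + r) * Hh t) := by
    intro t
    by_cases ht : t < T
    · have hm := hHhm t ht.le
      obtain ⟨n0, h⟩ := H.energy_step hp hop (lam := ε / 8) (Λ := Λ) (r := r) (Ht := Hh t)
        (δ := ε / 8 * e) hε (by positivity) (by linarith) hr0.le (hHh0 t) (hm.trans hHm2)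
        ((mul_le_mul_of_nonneg_left hm hΛ0.le).trans hHmΛ) (by linarith) (by positivity)
      exact ⟨n0, fun _ => h⟩
    · exact ⟨0, fun h => absurd h ht⟩
  choose n0 hn0 using hstep
  obtain ⟨n, hn⟩ : ∃ n : ℕ, n = b + a * T + 1 + ∑ t ∈ Finset.range T, n0 t := ⟨_, rfl⟩
  have hgrow : ∀ t ≤ T, e * ((1 + r) ^ 2 * (1 + r * ε / 8)) ^ t ≤
      energy p lp A (win p Λ (ε / 8) (Hh t)) n (Hh t) := by
    intro t
    induction t with
    | zero =>
      intro _
      have hH0 : Hh 0 = 1 / (p:ℝ) ^ b := by simp [Hh]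
      rw [pow_zero, mul_one, hH0, he]
      refine H.energy_ge hp hop hb1 (by omega) (fun x => trap_nonneg _ _ x) fun x hx => ?_
      refine trap_eq_one (by positivity) (hx.trans ?_)
      have h1 := mul_le_mul_of_nonneg_right hΛ3 (show 0 ≤ 1 / (p:ℝ) ^ b by positivity)
      have h2 : 6 * (1 / (p:ℝ) ^ b) / (ε / 8) = 6 / (ε / 8) * (1 / (p:ℝ) ^ b) := by ring
      rw [h2]; linarith
    | succ t ih =>
      intro ht
      have ih := ih (by omega)
      have hnn : n ≥ n0 t := by
        have := Finset.single_le_sum (f := n0) (fun _ _ => Nat.zero_le _)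
          (Finset.mem_range.2 ht : t ∈ Finset.range T)
        omega
      have hat : a * t ≤ a * T := Nat.mul_le_mul_left _ (by omega)
      obtain ⟨m, hm1, hm2⟩ := hn0 t ht n hnn ((p ^ a + 1) ^ t * p ^ (n - b - a * t)) (by
        have hN : (p:ℝ) ^ n = (p:ℝ) ^ b * ((p:ℝ) ^ a) ^ t * (p:ℝ) ^ (n - b - a * t) := by
          rw [← pow_mul, ← pow_add, ← pow_add]; congr 1; omega
        have h1 : 1 + r = ((p:ℝ) ^ a + 1) / (p:ℝ) ^ a := by rw [hrdef]; field_simp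
        simp only [Hh]
        rw [hN, h1, div_pow]; push_cast; field_simp)
      have hone : 1 ≤ (1 + r) ^ 2 * (1 + r * ε / 8) :=
        one_le_mul_of_one_le_of_one_le (one_le_pow₀ h1r) (by linarith [mul_pos hr0 hε0])
      have hEe : e ≤ energy p lp A (win p Λ (ε / 8) (Hh t)) n (Hh t) :=
        (le_mul_of_one_le_right he0.le (one_le_pow₀ hone)).trans ih
      have hg := growth_factor hε0 hε1 hr0 har (he0.le.trans hEe)
        (mul_le_mul_of_nonneg_left hEe (by positivity)) hm1 hm2
      have hHs : Hh (t + 1) = (1 + r) * Hh t := by simp only [Hh]; ring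
      rw [hHs, pow_succ']
      refine le_trans ?_ hg
      calc _ = (1 + r) ^ 2 * (1 + r * ε / 8) * (e * ((1 + r) ^ 2 * (1 + r * ε / 8)) ^ t) := by ring
        _ ≤ _ := mul_le_mul_of_nonneg_left ih (by linarith)
  have hup := (hgrow T le_rfl).trans (H.energy_le_total hp (fun x => trap_le_one _ _ x)
    ((hHhm T le_rfl).trans (by linarith)))
  rw [div_lt_iff₀ (by positivity)] at hT
  have hlow : c₀ / p * (Hm / p) ^ 2 ≤ e * ((1 + r) ^ T) ^ 2 := by
    rw [he, mul_assoc, ← mul_pow]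
    gcongr
    rw [div_le_iff₀ hpr]
    nlinarith
  have e1 : e * ((1 + r) ^ 2 * (1 + r * ε / 8)) ^ T =
      (1 + r * ε / 8) ^ T * (e * ((1 + r) ^ T) ^ 2) := by
    rw [mul_pow, ← pow_mul, ← pow_mul, mul_comm 2 T]; ring
  rw [e1] at hup
  have := mul_le_mul_of_nonneg_left hlow (show 0 ≤ (1 + r * ε / 8) ^ T by positivity)
  linarith

end

/-- A quasisymmetric embedding of carpets matching holes with holes (via `τ`) and sending the
bottom side into the bottom side. -/
structure Setup (p q : ℕ) (g : ℂ → ℂ) (τ : Idx → Idx) : Prop where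
  maps : ∀ z ∈ sierpinskiCarpet p, g z ∈ sierpinskiCarpet q
  inj : InjOn g (sierpinskiCarpet p)
  cont : ContinuousOn g (sierpinskiCarpet p)
  wqs : WQS (sierpinskiCarpet p) g
  wqsInv : ∀ t : ℝ, ∃ T : ℝ, 0 < T ∧ ∀ u ∈ sierpinskiCarpet p, ∀ v ∈ sierpinskiCarpet p,
    ∀ w ∈ sierpinskiCarpet p, dist (g u) (g v) ≤ t * dist (g u) (g w) → dist u v ≤ T * dist u w
  bot : ∀ z ∈ sierpinskiCarpet p, z.im = 0 → (g z).im = 0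
  top : ∀ z ∈ sierpinskiCarpet p, (g z).im < 1
  hole : ∀ c, IsCell p c → IsCell q (τ c) ∧ g '' per p c = per q (τ c)
  hinv : ∀ c', IsCell q c' → (∃ c, IsCell p c ∧ τ c = c') ∨
    ∀ z ∈ sierpinskiCarpet p, 0 < z.re → z.re < 1 → z.im < 1 → g z ∉ per q c'
  hopen : ∃ U : Set ℂ, IsOpen U ∧
    g '' {z | z ∈ sierpinskiCarpet p ∧ 0 < z.re ∧ z.re < 1 ∧ z.im < 1} = U ∩ sierpinskiCarpet q

section
variable {p q : ℕ} {g : ℂ → ℂ} {τ : Idx → Idx}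

lemma dist_le_abs_add_abs (u v : ℂ) : dist u v ≤ |u.re - v.re| + |u.im - v.im| := by
  rw [dist_eq_norm]
  exact Complex.norm_le_abs_re_add_abs_im (u - v)

lemma abs_im_sub_le_dist (u v : ℂ) : |u.im - v.im| ≤ dist u v := by
  rw [dist_eq_norm]
  exact Complex.abs_im_le_norm (u - v)

lemma abs_re_sub_le_dist (u v : ℂ) : |u.re - v.re| ≤ dist u v := by
  rw [dist_eq_norm]
  exact Complex.abs_re_le_norm (u - v)

lemma dist_le_of_mem_sq (hp0 : 0 < p) {c : Idx} {u v : ℂ} (hu : u ∈ sq p c) (hv : v ∈ sq p c) :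
    dist u v ≤ 2 * (1 / (p:ℝ) ^ c.1) := by
  have hP : (0:ℝ) < (p:ℝ) ^ c.1 := by positivity
  obtain ⟨⟨a1, a2⟩, a3, a4⟩ := hu
  obtain ⟨⟨b1, b2⟩, b3, b4⟩ := hv
  have key : ∀ x y a : ℝ, a ≤ (p:ℝ) ^ c.1 * x → (p:ℝ) ^ c.1 * x ≤ a + 1 → a ≤ (p:ℝ) ^ c.1 * y →
      (p:ℝ) ^ c.1 * y ≤ a + 1 → |x - y| ≤ 1 / (p:ℝ) ^ c.1 := by
    intro x y a h1 h2 h3 h4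
    rw [le_div_iff₀ hP, ← abs_of_pos hP, ← abs_mul, abs_le]
    constructor <;> linarith
  have h1 := key _ _ _ a1 a2 b1 b2
  have h2 := key _ _ _ a3 a4 b3 b4
  linarith [dist_le_abs_add_abs u v]

lemma hs_eq (hp0 : 0 < p) (c : Idx) : 1 / (p:ℝ) ^ c.1 = p * hs p c := by
  have : (0:ℝ) < p := by positivity
  rw [hs, pow_succ]; field_simp

/-- Lower left corner of the hole of `c`. -/
noncomputable def corner (p : ℕ) (c : Idx) : ℂ := ⟨hx p c, hy p c⟩

lemma mem_osq_mid_iff (hp0 : 0 < p) {c : Idx} {z : ℂ} : z ∈ osq p (mid p c) ↔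
    (hx p c < z.re ∧ z.re < hx p c + hs p c) ∧ (hy p c < z.im ∧ z.im < hy p c + hs p c) := by
  have h0 : (0:ℝ) < (p:ℝ) ^ (c.1 + 1) := by positivity
  have e1 : ∀ a : ℕ, (a:ℝ) * hs p c = (a:ℝ) / (p:ℝ) ^ (c.1 + 1) := fun a => by
    rw [hs, mul_one_div]
  have e2 : ∀ a : ℕ, (a:ℝ) * hs p c + hs p c = ((a:ℝ) + 1) / (p:ℝ) ^ (c.1 + 1) := fun a => by
    rw [hs]; field_simp
  simp only [osq, mid, mem_ofPred_eq, hx, hy, e2]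
  rw [e1, e1, div_lt_iff₀' h0, div_lt_iff₀' h0, lt_div_iff₀' h0, lt_div_iff₀' h0]

lemma corner_mem_per (hp0 : 0 < p) (c : Idx) : corner p c ∈ per p c := by
  have := (hs_pos hp0 c).le
  rw [per, mem_sdiff, mem_sq_mid_iff hp0, mem_osq_mid_iff hp0]
  simp [corner, this]

lemma exists_opposite (hp0 : 0 < p) (c : Idx) : ∃ w ∈ per p c, dist (corner p c) w = hs p c := by
  have h := hs_pos hp0 c
  refine ⟨⟨hx p c + hs p c, hy p c⟩, ?_, ?_⟩
  · rw [per, mem_sdiff, mem_sq_mid_iff hp0, mem_osq_mid_iff hp0]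
    simp [h.le]
  · rw [Complex.dist_of_im_eq (by rfl), Real.dist_eq, abs_sub_comm]
    simp [corner, abs_of_pos h]

lemma per_subset_sq (hp : 3 ≤ p) (c : Idx) : per p c ⊆ sq p c :=
  sdiff_subset.trans ((sq_mid_subset hp c).trans (osq_subset_sq p c))

lemma dist_le_of_mem_per (hp0 : 0 < p) {c : Idx} {u v : ℂ} (hu : u ∈ per p c) (hv : v ∈ per p c) :
    dist u v ≤ 2 * hs p c := dist_le_of_mem_sq hp0 hu.1 hv.1

/-- Points near a hole have images near the image of the hole. -/
lemma Setup.dist_le (S : Setup p q g τ) (hp : 3 ≤ p) (hop : Odd p) (hq : 3 ≤ q) (t : ℝ) :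
    ∃ A : ℝ, 0 < A ∧ ∀ c, IsCell p c → ∀ u ∈ sierpinskiCarpet p,
      dist (corner p c) u ≤ t * hs p c → dist (g (corner p c)) (g u) ≤ A * hs q (τ c) := by
  have hp0 : 0 < p := by omega
  have hq0 : 0 < q := by omega
  obtain ⟨T, hT0, hT⟩ := S.wqs t
  refine ⟨T * 2, by positivity, fun c hc u hu hd => ?_⟩
  obtain ⟨w, hw, hdw⟩ := exists_opposite hp0 c
  have hper := per_subset_carpet hp hop hc
  have hco := corner_mem_per hp0 c
  have h1 := hT _ (hper hco) u hu w (hper hw) (by rw [hdw]; exact hd)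
  have him := (S.hole c hc).2
  have h2 := dist_le_of_mem_per hq0 (him ▸ mem_image_of_mem g hco) (him ▸ mem_image_of_mem g hw)
  calc _ ≤ _ := h1
    _ ≤ T * (2 * hs q (τ c)) := by gcongr
    _ = _ := by ring

/-- Points whose images are near the image of a hole are near the hole. -/
lemma Setup.dist_inv_le (S : Setup p q g τ) (hp : 3 ≤ p) (hop : Odd p) (hq : 3 ≤ q) (t : ℝ) :
    ∃ A : ℝ, 0 < A ∧ ∀ c, IsCell p c → ∀ u ∈ sierpinskiCarpet p,
      dist (corner q (τ c)) (g u) ≤ t * hs q (τ c) →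
      ∃ w ∈ per p c, dist w u ≤ A * hs p c := by
  have hp0 : 0 < p := by omega
  have hq0 : 0 < q := by omega
  obtain ⟨T, hT0, hT⟩ := S.wqsInv t
  refine ⟨T * 2, by positivity, fun c hc u hu hd => ?_⟩
  have him := (S.hole c hc).2
  have hper := per_subset_carpet hp hop hc
  obtain ⟨w', hw', hdw⟩ := exists_opposite hq0 (τ c)
  obtain ⟨w, hw, rfl⟩ : w' ∈ g '' per p c := him ▸ hw'
  obtain ⟨v, hv, hvc⟩ : corner q (τ c) ∈ g '' per p c := him ▸ corner_mem_per hq0 (τ c)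
  rw [← hvc] at hd hdw
  have h1 := hT _ (hper hv) u hu w (hper hw) (by rw [hdw]; exact hd)
  refine ⟨v, hv, h1.trans ?_⟩
  have := dist_le_of_mem_per hp0 hv hw
  calc _ ≤ T * (2 * hs p c) := by gcongr
    _ = _ := by ring

lemma Setup.tau_inj (S : Setup p q g τ) (hp : 3 ≤ p) (hop : Odd p) {c c' : Idx} (hc : IsCell p c)
    (hc' : IsCell p c') (h : τ c = τ c') : c = c' := by
  have hp0 : 0 < p := by omega
  have h1 : g (corner p c) ∈ g '' per p c' := by
    rw [(S.hole c' hc').2, ← h, ← (S.hole c hc).2]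
    exact mem_image_of_mem g (corner_mem_per hp0 c)
  obtain ⟨z, hz, e⟩ := h1
  have := S.inj (per_subset_carpet hp hop hc' hz)
    (per_subset_carpet hp hop hc (corner_mem_per hp0 c)) e
  subst this
  exact mid_eq_of_mem hp hc hc' (corner_mem_per hp0 c).1 hz.1

lemma Setup.sum_sq_le (S : Setup p q g τ) (hp : 3 ≤ p) (hop : Odd p) (hq : 3 ≤ q) {E : Finset Idx}
    (hE : ∀ c ∈ E, IsCell p c) {x y D : ℝ} (hD : 0 ≤ D)
    (hbox : ∀ c ∈ E, ∀ z ∈ per p c,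
      (x ≤ (g z).re ∧ (g z).re ≤ x + D) ∧ (y ≤ (g z).im ∧ (g z).im ≤ y + D)) :
    ∑ c ∈ E, hs q (τ c) ^ 2 ≤ D ^ 2 := by
  classical
  have hq0 : 0 < q := by omega
  rw [← Finset.sum_image (f := fun c' => hs q c' ^ 2) (g := τ)
    (fun c hc c' hc' h => S.tau_inj hp hop (hE c hc) (hE c' hc') h)]
  refine sum_sq_hs_le hq _ ?_ (x := x) (y := y) hD ?_
  · intro c' hc'
    obtain ⟨c, hc, rfl⟩ := Finset.mem_image.1 hc'
    exact (S.hole c (hE c hc)).1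
  · intro c' hc' w hw
    obtain ⟨c, hc, rfl⟩ := Finset.mem_image.1 hc'
    have key : ∀ w ∈ per q (τ c), (x ≤ w.re ∧ w.re ≤ x + D) ∧ (y ≤ w.im ∧ w.im ≤ y + D) := by
      intro w hw
      obtain ⟨z, hz, rfl⟩ : w ∈ g '' per p c := (S.hole c (hE c hc)).2 ▸ hw
      exact hbox c hc z hz
    have hh := hs_pos hq0 (τ c)
    have k1 := key _ (corner_mem_per hq0 (τ c))
    have k2 := key ⟨hx q (τ c) + hs q (τ c), hy q (τ c) + hs q (τ c)⟩ (by
      rw [per, mem_sdiff, mem_sq_mid_iff hq0, mem_osq_mid_iff hq0]; simp [hh.le])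
    rw [mem_osq_mid_iff hq0] at hw
    simp only [corner] at k1 k2
    refine ⟨⟨?_, ?_⟩, ?_, ?_⟩ <;> linarith [hw.1.1, hw.1.2, hw.2.1, hw.2.2, k1.1.1, k1.2.1, k2.1.2, k2.2.2]

lemma not_small_gap {p q s t : ℕ} (hp : 3 ≤ p) (hq : 3 ≤ q) (hne : ∀ j : ℕ, p ≠ q ^ j) :
    1 / (q:ℝ) ^ s / (p + 1) ≤ |1 / (q:ℝ) ^ s - p * (1 / (q:ℝ) ^ t)| := by
  have hq1 : (1:ℝ) ≤ q := by exact_mod_cast (by omega : 1 ≤ q)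
  have hpr : (3:ℝ) ≤ p := by exact_mod_cast hp
  have hqs : (0:ℝ) < (q:ℝ) ^ s := by positivity
  have hqt : (0:ℝ) < (q:ℝ) ^ t := by positivity
  rcases le_total t s with h | h
  · obtain ⟨j, rfl⟩ := Nat.exists_eq_add_of_le h
    have hj : (1:ℝ) ≤ (q:ℝ) ^ j := one_le_pow₀ hq1
    have hjp : (0:ℝ) < (q:ℝ) ^ j := by linarith
    have e : 1 / (q:ℝ) ^ (t + j) - p * (1 / (q:ℝ) ^ t) = -((p * (q:ℝ) ^ j - 1) / (q:ℝ) ^ (t + j)) := by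
      rw [pow_add]; field_simp; ring
    rw [e, abs_neg, div_right_comm, abs_of_nonneg (div_nonneg (by nlinarith) (by positivity))]
    gcongr
    rw [div_le_iff₀ (by positivity)]
    have h2 : 2 ≤ p * (q:ℝ) ^ j - 1 := by nlinarith
    nlinarith
  · obtain ⟨j, rfl⟩ := Nat.exists_eq_add_of_le h
    have hjp : (0:ℝ) < (q:ℝ) ^ j := by positivity
    have e : 1 / (q:ℝ) ^ s - p * (1 / (q:ℝ) ^ (s + j)) = (1 - p / (q:ℝ) ^ j) / (q:ℝ) ^ s := by
      rw [pow_add]; field_simp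
    rw [e, abs_div, abs_of_pos hqs, div_right_comm]
    gcongr
    rcases lt_or_gt_of_ne (hne j) with h1 | h1
    · have h2 : (p:ℝ) + 1 ≤ (q:ℝ) ^ j := by exact_mod_cast h1
      refine le_trans ?_ (le_abs_self _)
      have : (p:ℝ) / (q:ℝ) ^ j ≤ p / (p + 1) := by gcongr
      have e2 : 1 / ((p:ℝ) + 1) = 1 - p / (p + 1) := by field_simp; ring
      linarith
    · have h2 : (q:ℝ) ^ j + 1 ≤ p := by exact_mod_cast h1
      refine le_trans ?_ (neg_le_abs _)
      have e2 : -(1 - (p:ℝ) / (q:ℝ) ^ j) = (p - (q:ℝ) ^ j) / (q:ℝ) ^ j := by field_simp; ring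
      rw [e2]
      apply div_le_div₀ <;> linarith

end

section
variable {p q : ℕ} {g : ℂ → ℂ} {τ : Idx → Idx}

lemma Setup.step (S : Setup p q g τ) (hp : 3 ≤ p) (hop : Odd p) (hq : 3 ≤ q) :
    ∃ A : ℝ, 1 ≤ A ∧ ∀ c, IsCell p c → ∀ u ∈ bd p c, ∀ v ∈ bd p c,
      dist (g u) (g v) ≤ A * hs q (τ c) := by
  have hp0 : 0 < p := by omega
  have hq0 : 0 < q := by omega
  obtain ⟨A, hA, h⟩ := S.dist_le hp hop hq (2 * p)
  refine ⟨2 * A + 1, by linarith, fun c hc u hu v hv => ?_⟩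
  have key : ∀ u ∈ bd p c, dist (g (corner p c)) (g u) ≤ A * hs q (τ c) := fun u hu => by
    refine h c hc u (cell_boundary_subset hp hop hc hu) ?_
    have := dist_le_of_mem_sq hp0 (per_subset_sq hp c (corner_mem_per hp0 c)) hu.1
    rw [hs_eq hp0] at this
    linarith
  have h1 := key u hu
  have h2 := key v hv
  have h3 := dist_triangle_left (g u) (g v) (g (corner p c))
  have := hs_pos hq0 (τ c)
  linarith

lemma Setup.sum_le_one (S : Setup p q g τ) (hp : 3 ≤ p) (hop : Odd p) (hq : 3 ≤ q) (hoq : Odd q)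
    {E : Finset Idx} (hE : ∀ c ∈ E, IsCell p c) : ∑ c ∈ E, hs q (τ c) ^ 2 ≤ 1 := by
  have := S.sum_sq_le hp hop hq hE (x := 0) (y := 0) zero_le_one (fun c hc z hz => by
    have := ((mem_carpet_iff hq hoq _).1 (S.maps z (per_subset_carpet hp hop (hE c hc) hz))).1
    simpa [unitSq] using this)
  simpa using this

lemma Setup.loc (S : Setup p q g τ) (hp : 3 ≤ p) (hop : Odd p) (hq : 3 ≤ q) :
    ∃ C₂ : ℝ, 1 ≤ C₂ ∧ ∀ k β : ℕ, β < p ^ (k + 1) → ∀ E : Finset Idx,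
      (∀ c ∈ E, IsCell p c ∧ sq p c ⊆ sq p (k, β / p, 0)) →
      ∑ c ∈ E, hs q (τ c) ^ 2 ≤ C₂ * hs q (τ (k + 1, β, 0)) ^ 2 := by
  have hp0 : 0 < p := by omega
  have hq0 : 0 < q := by omega
  have hpr : (0:ℝ) < p := by positivity
  obtain ⟨A, hA, h⟩ := S.dist_le hp hop hq (2 * p * p)
  refine ⟨(2 * A) ^ 2 + 1, by nlinarith, fun k β hβ E hE => ?_⟩
  have hc0 : IsCell p (k + 1, β, 0) := isCell_bottom hp hβ
  set c0 : Idx := (k + 1, β, 0) with hc0d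
  set R := A * hs q (τ c0) with hR
  have hl := hs_pos hq0 (τ c0)
  have hsub : sq p c0 ⊆ sq p (k, β / p, 0) := by
    have := sq_subset_of_div hp0 k 1 β 0
    simpa using this
  have := S.sum_sq_le hp hop hq (E := E) (fun c hc => (hE c hc).1) (x := (g (corner p c0)).re - R)
    (y := (g (corner p c0)).im - R) (D := 2 * R) (by positivity) (fun c hc z hz => by
      have hd := dist_le_of_mem_sq hp0 (hsub (per_subset_sq hp c0 (corner_mem_per hp0 c0)))
        ((hE c hc).2 (per_subset_sq hp c hz))
      have h1 := h c0 hc0 z (per_subset_carpet hp hop (hE c hc).1 hz) (by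
        refine hd.trans (le_of_eq ?_)
        simp only [hs, c0, pow_succ]; field_simp)
      have h2 := (abs_re_sub_le_dist _ _).trans h1
      have h3 := (abs_im_sub_le_dist _ _).trans h1
      rw [abs_le] at h2 h3
      refine ⟨⟨?_, ?_⟩, ?_, ?_⟩ <;> linarith [h2.1, h2.2, h3.1, h3.2])
  refine this.trans ?_
  rw [hR]
  nlinarith [pow_pos hl 2]

lemma bottom_mem_bd (hp0 : 0 < p) (k β : ℕ) {x : ℝ} (h1 : (β:ℝ) / (p:ℝ) ^ k ≤ x)
    (h2 : x ≤ ((β:ℝ) + 1) / (p:ℝ) ^ k) : (⟨x, 0⟩ : ℂ) ∈ bd p (k, β, 0) := by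
  have hP : (0:ℝ) < (p:ℝ) ^ k := by positivity
  rw [div_le_iff₀' hP] at h1
  rw [le_div_iff₀' hP] at h2
  refine ⟨?_, fun h => ?_⟩
  · simp [sq, h1, h2]
  · simp [osq] at h

lemma Setup.lower (S : Setup p q g τ) (hp : 3 ≤ p) (hop : Odd p) (hq : 3 ≤ q) :
    ∃ c₀ : ℝ, 0 < c₀ ∧ ∀ b : ℕ, 1 ≤ b → c₀ / (p:ℝ) ^ b ≤
      ∑ β ∈ Finset.Ico ((p / 2) * p ^ (b - 1)) ((p / 2 + 1) * p ^ (b - 1)),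
        hs q (τ (b, β, 0)) ^ 2 := by
  have hp0 : 0 < p := by omega
  have hpr : (0:ℝ) < p := by positivity
  obtain ⟨A, hA, hstep⟩ := S.step hp hop hq
  let x : ℕ → ℕ → ℂ := fun b β => ⟨(β:ℝ) / (p:ℝ) ^ b, 0⟩
  have hxmem : ∀ b β, β < p ^ b → x b β ∈ bd p (b, β, 0) ∧ x b (β + 1) ∈ bd p (b, β, 0) := by
    intro b β _
    constructor
    · exact bottom_mem_bd hp0 b β le_rfl (by gcongr; linarith)
    · exact bottom_mem_bd hp0 b β (by push_cast; gcongr; linarith) (by push_cast; exact le_rfl)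
  have hm : p / 2 + 1 < p := (mid_bounds hp).2
  have hd0 : 0 < dist (g (x 1 (p / 2))) (g (x 1 (p / 2 + 1))) := by
    rw [dist_pos]
    intro h
    have hmem := hxmem 1 (p / 2) (by rw [pow_one]; omega)
    have hc : IsCell p (1, p / 2, 0) := isCell_bottom hp (by rw [pow_one]; omega)
    have := S.inj (cell_boundary_subset hp hop hc hmem.1) (cell_boundary_subset hp hop hc hmem.2) h
    have := congrArg Complex.re this
    simp only [x] at this
    rw [div_left_inj' (by positivity)] at this
    push_cast at this; linarith
  set d0 := dist (g (x 1 (p / 2))) (g (x 1 (p / 2 + 1))) with hd0d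
  refine ⟨(d0 / A) ^ 2, by positivity, fun b hb => ?_⟩
  obtain ⟨b, rfl⟩ : ∃ m, b = m + 1 := ⟨b - 1, by omega⟩
  simp only [Nat.add_sub_cancel]
  have hle : p / 2 * p ^ b ≤ (p / 2 + 1) * p ^ b := Nat.mul_le_mul_right _ (by omega)
  have hxe : ∀ m : ℕ, x (b + 1) (m * p ^ b) = x 1 m := by
    intro m
    have : (0:ℝ) < (p:ℝ) ^ b := by positivity
    simp only [x]; push_cast; congr 1; rw [pow_succ, pow_one]; field_simp
  have h1 : d0 ≤ ∑ β ∈ Finset.Ico ((p / 2) * p ^ b) ((p / 2 + 1) * p ^ b),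
      dist (g (x (b + 1) β)) (g (x (b + 1) (β + 1))) := by
    have := dist_le_Ico_sum_dist (fun β => g (x (b + 1) β)) hle
    rwa [hxe, hxe] at this
  have h2 : d0 ≤ A * ∑ β ∈ Finset.Ico ((p / 2) * p ^ b) ((p / 2 + 1) * p ^ b),
      hs q (τ (b + 1, β, 0)) := by
    refine h1.trans ?_
    rw [Finset.mul_sum]
    refine Finset.sum_le_sum fun β hβ => ?_
    rw [Finset.mem_Ico] at hβ
    have hβ' : β < p ^ (b + 1) := by
      have : (p / 2 + 1) * p ^ b ≤ p * p ^ b := Nat.mul_le_mul_right _ hm.le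
      rw [← pow_succ'] at this
      omega
    exact hstep _ (isCell_bottom hp hβ') _ (hxmem _ _ hβ').1 _ (hxmem _ _ hβ').2
  have h3 := sq_sum_le_card_mul_sum_sq (s := Finset.Ico ((p / 2) * p ^ b) ((p / 2 + 1) * p ^ b))
    (f := fun β => hs q (τ (b + 1, β, 0)))
  have hcard : (Finset.Ico ((p / 2) * p ^ b) ((p / 2 + 1) * p ^ b)).card = p ^ b := by
    rw [Nat.card_Ico, add_mul, one_mul, Nat.add_sub_cancel_left]
  rw [hcard] at h3
  set s1 := ∑ β ∈ Finset.Ico ((p / 2) * p ^ b) ((p / 2 + 1) * p ^ b), hs q (τ (b + 1, β, 0))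
  set s2 := ∑ β ∈ Finset.Ico ((p / 2) * p ^ b) ((p / 2 + 1) * p ^ b), hs q (τ (b + 1, β, 0)) ^ 2
    with hs2
  have h4 : d0 / A ≤ s1 := by rw [div_le_iff₀ (by linarith)]; linarith
  have h5 : (d0 / A) ^ 2 ≤ s1 ^ 2 := pow_le_pow_left₀ (by positivity) h4 2
  have hP : (0:ℝ) < (p:ℝ) ^ b := by positivity
  have hs0 : 0 ≤ s2 := Finset.sum_nonneg fun _ _ => by positivity
  rw [div_le_iff₀ (by positivity)]
  push_cast at h3
  calc _ ≤ (p:ℝ) ^ b * s2 := h5.trans h3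
    _ ≤ (p:ℝ) ^ (b + 1) * s2 := by
      gcongr
      · exact_mod_cast (by omega : 1 ≤ p)
      · omega
    _ = _ := mul_comm _ _

end

lemma isCompact_carpet {p : ℕ} (hp : 3 ≤ p) (hop : Odd p) : IsCompact (sierpinskiCarpet p) := by
  refine Metric.isCompact_of_isClosed_isBounded (isClosed_carpet hp hop)
    ((Metric.isBounded_closedBall (x := (0:ℂ)) (r := 2)).subset fun z hz => ?_)
  have h := ((mem_carpet_iff hp hop z).1 hz).1
  simp only [unitSq, mem_ofPred_eq] at h
  rw [mem_closedBall, dist_zero_right]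
  refine (Complex.norm_le_abs_re_add_abs_im z).trans ?_
  rw [abs_of_nonneg h.1.1, abs_of_nonneg h.2.1]
  linarith [h.1.2, h.2.2]

/-- Telescoping along the columns of the level-`n` grid, grouped by holes. -/
lemma sum_vertical {q : ℕ} (hq : 3 ≤ q) {ψ : ℂ → ℝ} (h0 : ∀ z : ℂ, z.im = 0 → ψ z = 0)
    (h1 : ∀ z : ℂ, z.im = 1 → ψ z = 0) (n : ℕ) :
    ∑ c ∈ cellsLt q n, ∑ j ∈ rng q n c c.2.1,
      (ψ (gpt q n j ((q * c.2.2 + q / 2) * blk q n c + blk q n c)) -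
        ψ (gpt q n j ((q * c.2.2 + q / 2) * blk q n c))) +
    ∑ c ∈ cellsEq q n, (ψ (gpt q n c.2.1 (c.2.2 + 1)) - ψ (gpt q n c.2.1 c.2.2)) = 0 := by
  have hq0 : (q:ℝ) ≠ 0 := by positivity
  have h := sum_grid_eq hq n (fun j i => ψ (gpt q n j (i + 1)) - ψ (gpt q n j i))
  have e1 : ∀ j, ∑ i ∈ Finset.range (q ^ n), (ψ (gpt q n j (i + 1)) - ψ (gpt q n j i)) = 0 := by
    intro j
    rw [Finset.sum_range_sub (fun i => ψ (gpt q n j i)), h0 (gpt q n j 0) (by simp [gpt]),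
      h1 (gpt q n j (q ^ n)) (by simp [gpt, hq0]), sub_zero]
  rw [Finset.sum_eq_zero (fun j _ => e1 j)] at h
  rw [h]
  congr 1
  refine Finset.sum_congr rfl fun c _ => Finset.sum_congr rfl fun j _ => ?_
  rw [rng, Finset.sum_Ico_sub (fun i => ψ (gpt q n j i)) (Nat.le_add_right _ _)]

section
variable {p q : ℕ} {g : ℂ → ℂ} {τ : Idx → Idx}

open Classical in
/-- Transport of `φ` by `g`, extended by zero. -/
noncomputable def push (p : ℕ) (g : ℂ → ℂ) (φ : ℂ → ℝ) (w : ℂ) : ℝ :=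
  if h : ∃ z ∈ sierpinskiCarpet p, g z = w then φ h.choose else 0

lemma Setup.push_apply (S : Setup p q g τ) (φ : ℂ → ℝ) {z : ℂ} (hz : z ∈ sierpinskiCarpet p) :
    push p g φ (g z) = φ z := by
  have h : ∃ z' ∈ sierpinskiCarpet p, g z' = g z := ⟨z, hz, rfl⟩
  rw [push, dif_pos h, S.inj h.choose_spec.1 hz h.choose_spec.2]

lemma exists_of_push_ne_zero {φ : ℂ → ℝ} {w : ℂ} (h : push p g φ w ≠ 0) :
    ∃ z ∈ sierpinskiCarpet p, g z = w ∧ φ z ≠ 0 := by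
  unfold push at h
  split_ifs at h with hz
  · exact ⟨_, hz.choose_spec.1, hz.choose_spec.2, h⟩
  · exact absurd rfl h

/-- Small cells of the target meeting the support of the transported function are matched. -/
lemma Setup.exists_level (S : Setup p q g τ) (hp : 3 ≤ p) (hop : Odd p) (hq : 3 ≤ q) (hoq : Odd q)
    {φ : ℂ → ℝ} (hsupp : ∀ z ∈ sierpinskiCarpet p, φ z ≠ 0 →
      1 / 4 ≤ z.re ∧ z.re ≤ 3 / 4 ∧ z.im ≤ 1 / 2) :
    ∃ n1 : ℕ, ∀ c', IsCell q c' → n1 ≤ c'.1 → ∀ w ∈ bd q c', push p g φ w ≠ 0 →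
      (∀ w' ∈ bd q c', ∃ z ∈ sierpinskiCarpet p, g z = w') ∧ ∃ c, IsCell p c ∧ τ c = c' := by
  have hq0 : 0 < q := by omega
  have hqr : (1:ℝ) < q := by exact_mod_cast (by omega : 1 < q)
  obtain ⟨U, hU, hgU⟩ := S.hopen
  set K := sierpinskiCarpet p ∩ {z : ℂ | 1 / 4 ≤ z.re ∧ z.re ≤ 3 / 4 ∧ z.im ≤ 1 / 2} with hK
  have hKc : IsCompact K := by
    refine (isCompact_carpet hp hop).inter_right ?_
    refine (isClosed_le continuous_const Complex.continuous_re).inter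
      ((isClosed_le Complex.continuous_re continuous_const).inter
        (isClosed_le Complex.continuous_im continuous_const))
  have hgK : IsCompact (g '' K) := hKc.image_of_continuousOn (S.cont.mono inter_subset_left)
  have hKU : g '' K ⊆ U := by
    rintro _ ⟨z, ⟨hz, h1, h2, h3⟩, rfl⟩
    have : g z ∈ U ∩ sierpinskiCarpet q := by
      rw [← hgU]
      exact ⟨z, ⟨hz, by linarith, by linarith, by linarith⟩, rfl⟩
    exact this.1
  obtain ⟨ρ, hρ, hthick⟩ := hgK.exists_thickening_subset_open hU hKU
  obtain ⟨n1, hn1⟩ := exists_pow_lt_of_lt_one (half_pos hρ) (inv_lt_one_of_one_lt₀ hqr)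
  refine ⟨n1, fun c' hc' hn w hw hne => ?_⟩
  obtain ⟨z, hz, rfl, hφ⟩ := exists_of_push_ne_zero hne
  have hsmall : 2 * (1 / (q:ℝ) ^ c'.1) < ρ := by
    have h1 : 1 / (q:ℝ) ^ c'.1 ≤ 1 / (q:ℝ) ^ n1 :=
      one_div_le_one_div_of_le (by positivity) (pow_le_pow_right₀ hqr.le hn)
    rw [inv_pow, ← one_div] at hn1
    linarith
  have himg : ∀ w' ∈ sq q c', w' ∈ sierpinskiCarpet q →
      ∃ z, (z ∈ sierpinskiCarpet p ∧ 0 < z.re ∧ z.re < 1 ∧ z.im < 1) ∧ g z = w' := by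
    intro w' hw' hw'S
    have : w' ∈ U := hthick (mem_thickening_iff.2 ⟨g z, mem_image_of_mem g ⟨hz, hsupp z hz hφ⟩,
      (dist_le_of_mem_sq hq0 hw' hw.1).trans_lt hsmall⟩)
    have h2 : w' ∈ U ∩ sierpinskiCarpet q := ⟨this, hw'S⟩
    rw [← hgU] at h2
    exact h2
  refine ⟨fun w' hw' => ?_, ?_⟩
  · obtain ⟨z', h1, h2⟩ := himg w' hw'.1 (cell_boundary_subset hq hoq hc' hw')
    exact ⟨z', h1.1, h2⟩
  · rcases S.hinv c' hc' with h | h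
    · exact h
    · have hco := corner_mem_per hq0 c'
      obtain ⟨z', ⟨h1, h2, h3, h4⟩, h5⟩ := himg _ (per_subset_sq hq c' hco)
        (per_subset_carpet hq hoq hc' hco)
      exact absurd (h5 ▸ hco) (h z' h1 h2 h3 h4)

lemma Setup.dist_preimage_le (S : Setup p q g τ) (hp : 3 ≤ p) (hop : Odd p) (hq : 3 ≤ q) :
    ∃ D : ℝ, 0 < D ∧ ∀ c, IsCell p c → ∀ u ∈ sierpinskiCarpet p, ∀ v ∈ sierpinskiCarpet p,
      g u ∈ bd q (τ c) → g v ∈ bd q (τ c) → dist u v ≤ D * hs p c := by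
  have hp0 : 0 < p := by omega
  have hq0 : 0 < q := by omega
  obtain ⟨A, hA, h⟩ := S.dist_inv_le hp hop hq (2 * q)
  refine ⟨2 * A + 2, by positivity, fun c hc u hu v hv hgu hgv => ?_⟩
  have key : ∀ u ∈ sierpinskiCarpet p, g u ∈ bd q (τ c) → ∃ w ∈ per p c, dist w u ≤ A * hs p c := by
    intro u hu hgu
    refine h c hc u hu ?_
    have := dist_le_of_mem_sq hq0 (per_subset_sq hq _ (corner_mem_per hq0 (τ c))) hgu.1
    rw [hs_eq hq0] at this
    linarith
  obtain ⟨w, hw, h1⟩ := key u hu hgu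
  obtain ⟨w', hw', h2⟩ := key v hv hgv
  have h3 := dist_le_of_mem_per hp0 hw hw'
  have h4 := dist_triangle4 u w w' v
  rw [dist_comm] at h1
  linarith

end

section
variable {p q : ℕ} {g : ℂ → ℂ} {τ : Idx → Idx}

lemma gpt_im_add_blk (hq0 : 0 < q) {n : ℕ} {c : Idx} (hn : c.1 < n) (j : ℕ) :
    (gpt q n j ((q * c.2.2 + q / 2) * blk q n c)).im = hy q c ∧
    (gpt q n j ((q * c.2.2 + q / 2) * blk q n c + blk q n c)).im = hy q c + hs q c := by
  have h1 := hx_eq hq0 hn c.2.2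
  have h2 := blk_mul hq0 hn
  constructor
  · rw [hy, h1, gpt]
    exact div_eq_mul_one_div _ _
  · rw [hy, h1, ← h2, gpt, ← add_mul, ← Nat.cast_add]
    exact div_eq_mul_one_div _ _

lemma Setup.exists_finset (S : Setup p q g τ) (hp : 3 ≤ p) (hop : Odd p) (E : Finset Idx) :
    ∃ R : Finset Idx, ∀ c, c ∈ R ↔ IsCell p c ∧ τ c ∈ E := by
  have hfin : {c | IsCell p c ∧ τ c ∈ E}.Finite := by
    refine Set.Finite.of_finite_image (f := τ) (E.finite_toSet.subset ?_) ?_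
    · rintro _ ⟨c, hc, rfl⟩; exact hc.2
    · intro c hc c' hc' h
      exact S.tau_inj hp hop hc.1 hc'.1 h
  exact ⟨hfin.toFinset, fun c => by simp⟩

lemma Setup.sum_eq (S : Setup p q g τ) (hp : 3 ≤ p) (hop : Odd p) {E R : Finset Idx}
    (hR : ∀ c, c ∈ R ↔ IsCell p c ∧ τ c ∈ E) {G : Idx → ℝ}
    (h0 : ∀ c' ∈ E, (∀ c, IsCell p c → τ c ≠ c') → G c' = 0) :
    ∑ c' ∈ E, G c' = ∑ c ∈ R, G (τ c) := by
  classical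
  rw [← Finset.sum_image (f := G) (g := τ) (s := R)
    (fun c hc c' hc' h => S.tau_inj hp hop ((hR c).1 hc).1 ((hR c').1 hc').1 h)]
  refine (Finset.sum_subset ?_ ?_).symm
  · intro c' hc'
    obtain ⟨c, hc, rfl⟩ := Finset.mem_image.1 hc'
    exact ((hR c).1 hc).2
  · intro c' hc' hn
    refine h0 c' hc' fun c hc h => hn (Finset.mem_image.2 ⟨c, (hR c).2 ⟨hc, h ▸ hc'⟩, h⟩)

open Classical in
/-- Total squared size of the holes matched through `τ`. -/
noncomputable def wt (p q : ℕ) (τ : Idx → Idx) (c : Idx) : ℝ :=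
  if IsCell p c then hs q (τ c) ^ 2 + hs p c ^ 2 else 0

lemma wt_nonneg (c : Idx) : 0 ≤ wt p q τ c := by
  unfold wt; split_ifs <;> positivity

lemma Setup.exists_tail (S : Setup p q g τ) (hp : 3 ≤ p) (hop : Odd p) (hq : 3 ≤ q) (hoq : Odd q)
    {δ : ℝ} (hδ : 0 < δ) :
    ∃ s : Finset Idx, ∀ t : Finset Idx, Disjoint t s → ∑ c ∈ t, wt p q τ c < δ := by
  classical
  have hsum : Summable (wt p q τ) := by
    refine summable_of_sum_le (c := 2) wt_nonneg fun u => ?_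
    have e : ∑ c ∈ u, wt p q τ c = ∑ c ∈ u with IsCell p c, (hs q (τ c) ^ 2 + hs p c ^ 2) := by
      rw [Finset.sum_filter]; rfl
    rw [e, Finset.sum_add_distrib]
    have h1 := S.sum_le_one hp hop hq hoq (E := u.filter (IsCell p))
      (fun c hc => (Finset.mem_filter.1 hc).2)
    have h2 : ∑ c ∈ u with IsCell p c, hs p c ^ 2 ≤ 1 := by
      have := sum_sq_hs_le hp (u.filter (IsCell p)) (fun c hc => (Finset.mem_filter.1 hc).2)
        (x := 0) (y := 0) (D := 1) zero_le_one (fun c hc z hz => by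
          have := sq_mid_subset_osq_zero hp (Finset.mem_filter.1 hc).2 (osq_subset_sq p _ hz)
          simp only [osq, pow_zero, one_mul, Nat.cast_zero, zero_add, mem_ofPred_eq] at this ⊢
          exact ⟨⟨this.1.1.le, this.1.2.le⟩, this.2.1.le, this.2.2.le⟩)
      simpa using this
    linarith
  obtain ⟨s, hs⟩ := summable_iff_vanishing_norm.1 hsum δ hδ
  refine ⟨s, fun t ht => (le_abs_self _).trans_lt (by simpa [Real.norm_eq_abs] using hs t ht)⟩

lemma Setup.hole_term_le (S : Setup p q g τ) (hp : 3 ≤ p) (hop : Odd p) (hq : 3 ≤ q)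
    {φ : ℂ → ℝ} {c : Idx} (hc : IsCell p c) {l u : ℝ}
    (hlu : ∀ z ∈ per p c, l ≤ φ z ∧ φ z ≤ u) {n : ℕ} (hn : (τ c).1 < n) :
    hs q (τ c) * ((hy q (τ c) + hs q (τ c)) * l - hy q (τ c) * u) ≤
      1 / (q:ℝ) ^ n * ∑ j ∈ rng q n (τ c) (τ c).2.1,
        ((gpt q n j ((q * (τ c).2.2 + q / 2) * blk q n (τ c) + blk q n (τ c))).im *
          push p g φ (gpt q n j ((q * (τ c).2.2 + q / 2) * blk q n (τ c) + blk q n (τ c))) -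
        (gpt q n j ((q * (τ c).2.2 + q / 2) * blk q n (τ c))).im *
          push p g φ (gpt q n j ((q * (τ c).2.2 + q / 2) * blk q n (τ c)))) := by
  have hq0 : 0 < q := by omega
  set c' := τ c with hc'
  have hs0 := hs_pos hq0 c'
  have hy0 := hs_le_hy hq c'
  have hpush : ∀ w ∈ per q c', l ≤ push p g φ w ∧ push p g φ w ≤ u := by
    intro w hw
    rw [hc', ← (S.hole c hc).2] at hw
    obtain ⟨z, hz, rfl⟩ := hw
    rw [S.push_apply φ (per_subset_carpet hp hop hc hz)]
    exact hlu z hz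
  have hcard : (rng q n c' c'.2.1).card = blk q n c' := by simp [rng]
  have hterm : ∀ j ∈ rng q n c' c'.2.1, (hy q c' + hs q c') * l - hy q c' * u ≤
      ((gpt q n j ((q * c'.2.2 + q / 2) * blk q n c' + blk q n c')).im *
          push p g φ (gpt q n j ((q * c'.2.2 + q / 2) * blk q n c' + blk q n c')) -
        (gpt q n j ((q * c'.2.2 + q / 2) * blk q n c')).im *
          push p g φ (gpt q n j ((q * c'.2.2 + q / 2) * blk q n c'))) := by
    intro j hj
    have h1 := (hpush _ (gpt_mem_per hq0 hn hj (Or.inr rfl))).1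
    have h2 := (hpush _ (gpt_mem_per hq0 hn hj (Or.inl rfl))).2
    rw [(gpt_im_add_blk hq0 hn j).1, (gpt_im_add_blk hq0 hn j).2]
    have h3 := mul_le_mul_of_nonneg_left h1 (by linarith : 0 ≤ hy q c' + hs q c')
    have h4 := mul_le_mul_of_nonneg_left h2 (by linarith : 0 ≤ hy q c')
    linarith
  have hsum := Finset.card_nsmul_le_sum _ _ _ hterm
  rw [hcard, nsmul_eq_mul] at hsum
  have := mul_le_mul_of_nonneg_left hsum (by positivity : 0 ≤ 1 / (q:ℝ) ^ n)
  rw [← mul_assoc, mul_comm (1 / (q:ℝ) ^ n) (blk q n c' : ℝ), blk_mul hq0 hn] at this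
  exact this

lemma Setup.push_eq_zero (S : Setup p q g τ) {φ : ℂ → ℝ}
    (hsupp : ∀ z ∈ sierpinskiCarpet p, φ z ≠ 0 → 1 / 4 ≤ z.re ∧ z.re ≤ 3 / 4 ∧ z.im ≤ 1 / 2)
    {c' : Idx} (hc' : IsCell q c') (hne : ∀ c, IsCell p c → τ c ≠ c') {w : ℂ} (hw : w ∈ per q c') :
    push p g φ w = 0 := by
  by_contra h
  obtain ⟨z, hz, rfl, hφ⟩ := exists_of_push_ne_zero h
  have h1 := hsupp z hz hφ
  rcases S.hinv c' hc' with ⟨c, hc, e⟩ | h2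
  · exact hne c hc e
  · exact h2 z hz (by linarith) (by linarith) (by linarith) hw

lemma Setup.cell_term_le (S : Setup p q g τ) (hp : 3 ≤ p) (hop : Odd p) (hq : 3 ≤ q)
    (hoq : Odd q) {φ : ℂ → ℝ} {C : ℝ}
    (hL : ∀ u ∈ sierpinskiCarpet p, ∀ v ∈ sierpinskiCarpet p, |φ u - φ v| ≤ C * dist u v)
    (hC : ∀ z ∈ sierpinskiCarpet p, 0 ≤ φ z ∧ φ z ≤ C)
    (hsupp : ∀ z ∈ sierpinskiCarpet p, φ z ≠ 0 → 1 / 4 ≤ z.re ∧ z.re ≤ 3 / 4 ∧ z.im ≤ 1 / 2) :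
    ∃ (n1 : ℕ) (B : ℝ), 0 ≤ B ∧ ∀ n ≥ n1, ∀ c' ∈ cellsEq q n,
      ((∀ c, IsCell p c → τ c ≠ c') →
        (gpt q n c'.2.1 (c'.2.2 + 1)).im * push p g φ (gpt q n c'.2.1 (c'.2.2 + 1)) -
          (gpt q n c'.2.1 c'.2.2).im * push p g φ (gpt q n c'.2.1 c'.2.2) = 0) ∧
      ∀ c, IsCell p c → τ c = c' → 1 / (q:ℝ) ^ n *
        |(gpt q n c'.2.1 (c'.2.2 + 1)).im * push p g φ (gpt q n c'.2.1 (c'.2.2 + 1)) -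
          (gpt q n c'.2.1 c'.2.2).im * push p g φ (gpt q n c'.2.1 c'.2.2)| ≤ B * wt p q τ c := by
  have hp0 : 0 < p := by omega
  have hq0 : 0 < q := by omega
  have hqr : (0:ℝ) < q := by positivity
  have hC0 : 0 ≤ C := by
    have := hC _ (per_subset_carpet hp hop (isCell_zero p) (corner_mem_per hp0 (0, 0, 0)))
    linarith
  obtain ⟨n1, hn1⟩ := S.exists_level hp hop hq hoq hsupp
  obtain ⟨D, hD, hpre⟩ := S.dist_preimage_le hp hop hq
  refine ⟨n1, C * q ^ 2 + C * q * D, by positivity, ?_⟩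
  rintro n hn ⟨m, j, i⟩ hc'
  obtain ⟨hcell, rfl⟩ := (mem_cellsEq hq0).1 hc'
  dsimp only at hn ⊢
  obtain ⟨hb0, hb1⟩ := gpt_mem_bd (n := m) (j := j) (i := i) hq0
  by_cases hz : push p g φ (gpt q m j (i + 1)) = 0 ∧ push p g φ (gpt q m j i) = 0
  · refine ⟨fun _ => by rw [hz.1, hz.2]; ring, fun c _ _ => ?_⟩
    rw [hz.1, hz.2]
    simp only [mul_zero, sub_zero, abs_zero]
    exact mul_nonneg (by positivity) (wt_nonneg c)
  have hex : (∀ w' ∈ bd q (m, j, i), ∃ z ∈ sierpinskiCarpet p, g z = w') ∧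
      ∃ c, IsCell p c ∧ τ c = (m, j, i) := by
    rw [not_and_or] at hz
    rcases hz with hz | hz
    · exact hn1 _ hcell hn _ hb1 hz
    · exact hn1 _ hcell hn _ hb0 hz
  refine ⟨fun h => ?_, fun c hc e => ?_⟩
  · obtain ⟨c, hc, e⟩ := hex.2
    exact absurd e (h c hc)
  obtain ⟨z1, hz1, e1⟩ := hex.1 _ hb1
  obtain ⟨z0, hz0, e0⟩ := hex.1 _ hb0
  have hd := hpre c hc z1 hz1 z0 hz0 (by rw [e1, e]; exact hb1) (by rw [e0, e]; exact hb0)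
  have him : (gpt q m j i).im ∈ Icc (0:ℝ) 1 := by
    have := ((mem_carpet_iff hq hoq _).1 (e0 ▸ S.maps z0 hz0 : gpt q m j i ∈ _)).1
    exact this.2
  have hdiff : (gpt q m j (i + 1)).im = (gpt q m j i).im + q * hs q (τ c) := by
    rw [e, ← hs_eq hq0]; simp only [gpt]; push_cast; ring
  have hN : 1 / (q:ℝ) ^ m = q * hs q (τ c) := by rw [e, ← hs_eq hq0]
  rw [hN, ← e1, S.push_apply φ hz1, e1, ← e0, S.push_apply φ hz0, e0, hdiff, wt, if_pos hc]
  have h1 := hC z1 hz1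
  have h2 := hL z1 hz1 z0 hz0
  have hh' := hs_pos hq0 (τ c)
  have hh := hs_pos hp0 c
  set h' := hs q (τ c)
  set h := hs p c
  set y := (gpt q m j i).im
  have h3 : |(y + q * h') * φ z1 - y * φ z0| ≤ q * h' * C + C * D * h := by
    have e3 : (y + q * h') * φ z1 - y * φ z0 = q * h' * φ z1 + y * (φ z1 - φ z0) := by ring
    rw [e3]
    refine (abs_add_le _ _).trans (add_le_add ?_ ?_)
    · rw [abs_of_nonneg (mul_nonneg (by positivity) h1.1)]
      exact mul_le_mul_of_nonneg_left h1.2 (by positivity)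
    · rw [abs_mul, abs_of_nonneg him.1]
      calc y * |φ z1 - φ z0| ≤ 1 * |φ z1 - φ z0| :=
            mul_le_mul_of_nonneg_right him.2 (abs_nonneg _)
        _ ≤ C * dist z1 z0 := by rw [one_mul]; exact h2
        _ ≤ C * (D * h) := mul_le_mul_of_nonneg_left hd hC0
        _ = C * D * h := by ring
  calc q * h' * |(y + q * h') * φ z1 - y * φ z0| ≤ q * h' * (q * h' * C + C * D * h) :=
        mul_le_mul_of_nonneg_left h3 (by positivity)
    _ = C * q ^ 2 * h' ^ 2 + C * q * D * (h' * h) := by ring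
    _ ≤ C * q ^ 2 * (h' ^ 2 + h ^ 2) + C * q * D * (h' ^ 2 + h ^ 2) := by
        refine add_le_add (mul_le_mul_of_nonneg_left ?_ (by positivity))
          (mul_le_mul_of_nonneg_left ?_ (by positivity))
        · nlinarith
        · nlinarith [sq_nonneg (h' - h), mul_pos hh hh']
    _ = _ := by ring

end

section
variable {p q : ℕ} {g : ℂ → ℂ} {τ : Idx → Idx}

lemma Setup.per_im (S : Setup p q g τ) (hq0 : 0 < q) {c : Idx} (hc : IsCell p c) {z : ℂ}
    (hz : z ∈ per p c) : hy q (τ c) ≤ (g z).im ∧ (g z).im ≤ hy q (τ c) + hs q (τ c) := by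
  have h : g z ∈ per q (τ c) := by rw [← (S.hole c hc).2]; exact mem_image_of_mem g hz
  exact ((mem_sq_mid_iff hq0).1 h.1).2

lemma Setup.key (S : Setup p q g τ) (hp : 3 ≤ p) (hop : Odd p) (hq : 3 ≤ q) (hoq : Odd q)
    {φ : ℂ → ℝ} {low high : Idx → ℝ} {C : ℝ}
    (hL : ∀ u ∈ sierpinskiCarpet p, ∀ v ∈ sierpinskiCarpet p, |φ u - φ v| ≤ C * dist u v)
    (hC : ∀ z ∈ sierpinskiCarpet p, 0 ≤ φ z ∧ φ z ≤ C)
    (hsupp : ∀ z ∈ sierpinskiCarpet p, φ z ≠ 0 → 1 / 4 ≤ z.re ∧ z.re ≤ 3 / 4 ∧ z.im ≤ 1 / 2)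
    (hlh : ∀ c, IsCell p c → 0 ≤ low c ∧ high c - low c ≤ C * hs p c ∧
      ∀ z ∈ per p c, low c ≤ φ z ∧ φ z ≤ high c) {δ : ℝ} (hδ : 0 < δ) :
    ∃ n0 : ℕ, ∀ n ≥ n0, ∑ c ∈ cellsLt p n,
      hs q (τ c) * ((hy q (τ c) + hs q (τ c)) * low c - hy q (τ c) * high c) ≤ δ := by
  classical
  have hp0 : 0 < p := by omega
  have hq0 : 0 < q := by omega
  have hC0 : 0 ≤ C := by
    have := hC _ (per_subset_carpet hp hop (isCell_zero p) (corner_mem_per hp0 (0, 0, 0)))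
    linarith
  obtain ⟨n1, B, hB, hcell⟩ := S.cell_term_le hp hop hq hoq hL hC hsupp
  obtain ⟨s, hs'⟩ := S.exists_tail hp hop hq hoq
    (div_pos hδ (by positivity : 0 < B + C + 1))
  refine ⟨1 + s.sup (fun c => c.1), fun n hn => ?_⟩
  set n' := n1 + 1 + ∑ c ∈ cellsLt p n ∪ s, (τ c).1 with hn'
  have hlt : ∀ c ∈ cellsLt p n ∪ s, (τ c).1 < n' := by
    intro c hc
    have := Finset.single_le_sum (f := fun c => (τ c).1) (fun c _ => Nat.zero_le _) hc
    omega
  obtain ⟨P, hP⟩ := S.exists_finset hp hop (cellsLt q n')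
  obtain ⟨R, hR⟩ := S.exists_finset hp hop (cellsEq q n')
  set ψ : ℂ → ℝ := fun w => w.im * push p g φ w with hψ
  set T : Idx → ℝ := fun c =>
    hs q (τ c) * ((hy q (τ c) + hs q (τ c)) * low c - hy q (τ c) * high c) with hT
  set G : Idx → ℝ := fun c => ∑ j ∈ rng q n' c c.2.1,
      (ψ (gpt q n' j ((q * c.2.2 + q / 2) * blk q n' c + blk q n' c)) -
        ψ (gpt q n' j ((q * c.2.2 + q / 2) * blk q n' c))) with hG
  set F : Idx → ℝ := fun c => ψ (gpt q n' c.2.1 (c.2.2 + 1)) - ψ (gpt q n' c.2.1 c.2.2) with hF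
  have htot : ∑ c ∈ cellsLt q n', G c + ∑ c ∈ cellsEq q n', F c = 0 := by
    refine sum_vertical hq (fun z hz => by simp [hψ, hz]) (fun z hz => ?_) n'
    have : push p g φ z = 0 := by
      by_contra h
      obtain ⟨z', hz', rfl, -⟩ := exists_of_push_ne_zero h
      exact (S.top z' hz').ne hz
    simp [hψ, this]
  rw [S.sum_eq hp hop hP (G := G), S.sum_eq hp hop hR (G := F)] at htot
  rotate_left
  · intro c' hc' h
    exact (hcell n' (by omega) c' hc').1 h
  · intro c' hc' h
    obtain ⟨h1, h2⟩ := (mem_cellsLt hq0).1 hc'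
    refine Finset.sum_eq_zero fun j hj => ?_
    simp only [hψ]
    rw [S.push_eq_zero hsupp h1 h (gpt_mem_per hq0 h2 hj (Or.inr rfl)),
      S.push_eq_zero hsupp h1 h (gpt_mem_per hq0 h2 hj (Or.inl rfl))]
    ring
  have hTP : ∑ c ∈ P, T c ≤ 1 / (q:ℝ) ^ n' * ∑ c ∈ P, G (τ c) := by
    rw [Finset.mul_sum]
    refine Finset.sum_le_sum fun c hc => ?_
    obtain ⟨h1, h2⟩ := (hP c).1 hc
    exact S.hole_term_le hp hop hq h1 (hlh c h1).2.2 ((mem_cellsLt hq0).1 h2).2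
  have hFR : -(1 / (q:ℝ) ^ n' * ∑ c ∈ R, F (τ c)) ≤ B * ∑ c ∈ R, wt p q τ c := by
    rw [Finset.mul_sum, Finset.mul_sum, ← Finset.sum_neg_distrib]
    refine Finset.sum_le_sum fun c hc => ?_
    obtain ⟨h1, h2⟩ := (hR c).1 hc
    refine le_trans ?_ ((hcell n' (by omega) (τ c) h2).2 c h1 rfl)
    rw [← mul_neg]
    exact mul_le_mul_of_nonneg_left (neg_le_abs _) (by positivity)
  have hT_ge : ∀ c, IsCell p c → -(C * wt p q τ c) ≤ T c := by
    intro c hc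
    obtain ⟨h1, h2, -⟩ := hlh c hc
    have hh' := hs_pos hq0 (τ c)
    have hh := hs_pos hp0 c
    have hy0 := hs_le_hy hq (τ c)
    have hy1 : hy q (τ c) ≤ 1 := by
      have e := (S.per_im hq0 hc (corner_mem_per hp0 c)).1
      exact e.trans (S.top _ (per_subset_carpet hp hop hc (corner_mem_per hp0 c))).le
    rw [wt, if_pos hc]
    simp only [hT]
    set h' := hs q (τ c)
    set h := hs p c
    set y := hy q (τ c)
    have h3 : -(C * h) ≤ (y + h') * low c - y * high c := by
      have : y * (high c - low c) ≤ C * h := by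
        calc y * (high c - low c) ≤ y * (C * h) := mul_le_mul_of_nonneg_left h2 (by linarith)
          _ ≤ 1 * (C * h) := mul_le_mul_of_nonneg_right hy1 (by positivity)
          _ = C * h := one_mul _
      nlinarith [mul_nonneg hh'.le h1]
    have h4 := mul_le_mul_of_nonneg_left h3 hh'.le
    have h5 : h' * h ≤ h' ^ 2 + h ^ 2 := by nlinarith [sq_nonneg (h' - h), mul_pos hh hh']
    have h6 := mul_le_mul_of_nonneg_left h5 hC0
    linarith
  have hsub : cellsLt p n ⊆ P := by
    intro c hc
    have h1 := ((mem_cellsLt hp0).1 hc).1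
    exact (hP c).2 ⟨h1, (mem_cellsLt hq0).2 ⟨(S.hole c h1).1,
      hlt c (Finset.mem_union_left _ hc)⟩⟩
  have hdec := Finset.sum_sdiff (f := T) hsub
  have hrest : -(C * ∑ c ∈ P \ cellsLt p n, wt p q τ c) ≤ ∑ c ∈ P \ cellsLt p n, T c := by
    rw [Finset.mul_sum, ← Finset.sum_neg_distrib]
    exact Finset.sum_le_sum fun c hc => hT_ge c ((hP c).1 (Finset.mem_sdiff.1 hc).1).1
  have hd1 : Disjoint (P \ cellsLt p n) s := by
    rw [Finset.disjoint_left]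
    intro c hc hcs
    obtain ⟨h1, h2⟩ := Finset.mem_sdiff.1 hc
    refine h2 ((mem_cellsLt hp0).2 ⟨((hP c).1 h1).1, ?_⟩)
    have := Finset.le_sup (f := fun c : Idx => c.1) hcs
    omega
  have hd2 : Disjoint R s := by
    rw [Finset.disjoint_left]
    intro c hc hcs
    have h1 := ((mem_cellsEq hq0).1 ((hR c).1 hc).2).2
    have h2 := hlt c (Finset.mem_union_right _ hcs)
    omega
  have hw1 := mul_le_mul_of_nonneg_left (hs' _ hd1).le hC0
  have hw2 := mul_le_mul_of_nonneg_left (hs' _ hd2).le hB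
  have hGF : 1 / (q:ℝ) ^ n' * ∑ c ∈ P, G (τ c) = -(1 / (q:ℝ) ^ n' * ∑ c ∈ R, F (τ c)) := by
    rw [← mul_neg]; congr 1; linarith
  have hfin : (B + C) * (δ / (B + C + 1)) ≤ δ := by
    rw [mul_div_assoc', div_le_iff₀ (by positivity)]
    nlinarith
  change ∑ c ∈ cellsLt p n, T c ≤ δ
  linarith

theorem Setup.exists_pow (S : Setup p q g τ) (hp : 3 ≤ p) (hop : Odd p) (hq : 3 ≤ q)
    (hoq : Odd q) : ∃ j : ℕ, p = q ^ j := by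
  by_contra! hne
  have hq0 : 0 < q := by omega
  obtain ⟨A, hA, hstep⟩ := S.step hp hop hq
  obtain ⟨C₂, hC₂, hloc⟩ := S.loc hp hop hq
  obtain ⟨c₀, hc₀, hlower⟩ := S.lower hp hop hq
  have H : Core p (fun c => hs q (τ c)) (fun c => hy q (τ c)) (fun z => (g z).im) A C₂ c₀ :=
    { one_le_A := hA
      C₂_pos := hC₂
      c₀_pos := hc₀
      lp_pos := fun c _ => hs_pos hq0 _
      y0_nonneg := fun c _ => (hs_pos hq0 _).le.trans (hs_le_hy hq _)
      bot := S.bot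
      Y_ge := fun c hc z hz => (S.per_im hq0 hc hz).1
      Y_le := fun c hc z hz => (S.per_im hq0 hc hz).2
      step := fun c hc u hu v hv => (abs_im_sub_le_dist _ _).trans (hstep c hc u hu v hv)
      sum_le := fun E hE => S.sum_le_one hp hop hq hoq hE
      loc := hloc
      gap := fun k β _ => not_small_gap hp hq hne
      lower := hlower
      key := fun φ low high C h1 h2 h3 h4 δ hδ => S.key hp hop hq hoq h1 h2 h3 h4 hδ }
  exact H.false hp hop

end

section comp
variable {p : ℕ}

/-- The subsquare of `d` corresponding to the grid square `c`. -/
def comp (p : ℕ) (d c : Idx) : Idx :=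
  (d.1 + c.1, p ^ c.1 * d.2.1 + c.2.1, p ^ c.1 * d.2.2 + c.2.2)

/-- The similarity from the unit square onto the grid square `d`. -/
noncomputable def sim (p : ℕ) (d : Idx) (z : ℂ) : ℂ :=
  ⟨(d.2.1 + z.re) / (p:ℝ) ^ d.1, (d.2.2 + z.im) / (p:ℝ) ^ d.1⟩

/-- The inverse of `sim`. -/
noncomputable def unsim (p : ℕ) (d : Idx) (z : ℂ) : ℂ :=
  ⟨(p:ℝ) ^ d.1 * z.re - d.2.1, (p:ℝ) ^ d.1 * z.im - d.2.2⟩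

lemma unsim_sim (hp0 : 0 < p) (d : Idx) (z : ℂ) : unsim p d (sim p d z) = z := by
  have : (p:ℝ) ^ d.1 ≠ 0 := by positivity
  apply Complex.ext <;> simp only [unsim, sim] <;> field_simp <;> ring

lemma sim_unsim (hp0 : 0 < p) (d : Idx) (z : ℂ) : sim p d (unsim p d z) = z := by
  have : (p:ℝ) ^ d.1 ≠ 0 := by positivity
  apply Complex.ext <;> simp only [unsim, sim] <;> field_simp <;> ring

lemma dist_unsim (hp0 : 0 < p) (d : Idx) (u v : ℂ) :
    dist (unsim p d u) (unsim p d v) = (p:ℝ) ^ d.1 * dist u v := by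
  have h0 : (0:ℝ) < (p:ℝ) ^ d.1 := by positivity
  have e : unsim p d u - unsim p d v = (((p:ℝ) ^ d.1 : ℝ) : ℂ) * (u - v) := by
    apply Complex.ext <;>
      simp only [unsim, Complex.sub_re, Complex.sub_im, Complex.re_ofReal_mul,
        Complex.im_ofReal_mul] <;> ring
  rw [dist_eq_norm, e, norm_mul, Complex.norm_real, Real.norm_of_nonneg h0.le, dist_eq_norm]

lemma dist_sim (hp0 : 0 < p) (d : Idx) (u v : ℂ) :
    dist u v = (p:ℝ) ^ d.1 * dist (sim p d u) (sim p d v) := by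
  rw [← dist_unsim hp0, unsim_sim hp0, unsim_sim hp0]

lemma continuous_sim (p : ℕ) (d : Idx) : Continuous (sim p d) := by
  have : sim p d = fun z => Complex.equivRealProdCLM.symm
      ((d.2.1 + z.re) / (p:ℝ) ^ d.1, (d.2.2 + z.im) / (p:ℝ) ^ d.1) := by
    ext z; apply Complex.ext <;> simp [sim]
  rw [this]
  fun_prop

lemma continuous_unsim (p : ℕ) (d : Idx) : Continuous (unsim p d) := by
  have : unsim p d = fun z => Complex.equivRealProdCLM.symm
      ((p:ℝ) ^ d.1 * z.re - d.2.1, (p:ℝ) ^ d.1 * z.im - d.2.2) := by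
    ext z; apply Complex.ext <;> simp [unsim]
  rw [this]
  fun_prop

lemma sim_scale (hp0 : 0 < p) (d c : Idx) (z : ℂ) :
    (p:ℝ) ^ (d.1 + c.1) * (sim p d z).re = (p:ℝ) ^ c.1 * d.2.1 + (p:ℝ) ^ c.1 * z.re ∧
    (p:ℝ) ^ (d.1 + c.1) * (sim p d z).im = (p:ℝ) ^ c.1 * d.2.2 + (p:ℝ) ^ c.1 * z.im := by
  have : (p:ℝ) ^ d.1 ≠ 0 := by positivity
  constructor <;> simp only [sim, pow_add] <;> field_simp

lemma sim_mem_sq_comp (hp0 : 0 < p) {d c : Idx} {z : ℂ} :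
    sim p d z ∈ sq p (comp p d c) ↔ z ∈ sq p c := by
  obtain ⟨e1, e2⟩ := sim_scale hp0 d c z
  simp only [sq, comp, mem_ofPred_eq, e1, e2, Nat.cast_add, Nat.cast_mul, Nat.cast_pow, add_assoc,
    add_le_add_iff_left]

lemma sim_mem_osq_comp (hp0 : 0 < p) {d c : Idx} {z : ℂ} :
    sim p d z ∈ osq p (comp p d c) ↔ z ∈ osq p c := by
  obtain ⟨e1, e2⟩ := sim_scale hp0 d c z
  simp only [osq, comp, mem_ofPred_eq, e1, e2, Nat.cast_add, Nat.cast_mul, Nat.cast_pow, add_assoc,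
    add_lt_add_iff_left]

lemma mid_comp (d c : Idx) : mid p (comp p d c) = comp p d (mid p c) := by
  simp only [mid, comp, pow_succ, Prod.mk.injEq]
  refine ⟨rfl, ?_, ?_⟩ <;> ring

lemma sim_mem_per_comp (hp0 : 0 < p) {d c : Idx} {z : ℂ} :
    sim p d z ∈ per p (comp p d c) ↔ z ∈ per p c := by
  rw [per, per, mem_sdiff, mem_sdiff, mid_comp, sim_mem_sq_comp hp0, sim_mem_osq_comp hp0]

lemma sim_mem_sq (hp0 : 0 < p) {d : Idx} {z : ℂ} : sim p d z ∈ sq p d ↔ z ∈ unitSq := by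
  rw [← sq_zero p, ← sim_mem_sq_comp hp0 (d := d) (c := (0, 0, 0)) (z := z)]
  simp [comp]

lemma comp_digit_lt (hp0 : 0 < p) (a c : ℕ) {m k : ℕ} (hk : k < m) :
    (p ^ m * a + c) / p ^ k % p = c / p ^ k % p := by
  obtain ⟨r, rfl⟩ : ∃ r, m = k + (r + 1) := ⟨m - k - 1, by omega⟩
  rw [pow_add, mul_assoc, Nat.mul_add_div (by positivity), pow_succ', mul_assoc, Nat.mul_add_mod]

lemma comp_digit_ge (a : ℕ) {c m : ℕ} (hc : c < p ^ m) (r : ℕ) :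
    (p ^ m * a + c) / p ^ (m + r) = a / p ^ r := by
  rw [pow_add, ← Nat.div_div_eq_div_mul, Nat.mul_add_div (by omega), Nat.div_eq_of_lt hc, add_zero]

lemma comp_lt {a c n m : ℕ} (ha : a < p ^ n) (hc : c < p ^ m) : p ^ m * a + c < p ^ (n + m) := by
  have : p ^ m * (a + 1) ≤ p ^ m * p ^ n := Nat.mul_le_mul_left _ ha
  rw [add_comm n m, pow_add]
  rw [mul_add] at this
  omega

lemma isCell_comp (hp0 : 0 < p) {d c : Idx} (hd : IsCell p d) (hc : IsCell p c) :
    IsCell p (comp p d c) := by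
  refine ⟨comp_lt hd.1 hc.1, comp_lt hd.2.1 hc.2.1, fun k hk => ?_⟩
  simp only [comp] at hk ⊢
  by_cases h : k < c.1
  · rw [comp_digit_lt hp0 _ _ h, comp_digit_lt hp0 _ _ h]
    exact hc.2.2 k h
  · obtain ⟨r, rfl⟩ : ∃ r, k = c.1 + r := ⟨k - c.1, by omega⟩
    rw [comp_digit_ge _ hc.1, comp_digit_ge _ hc.2.1]
    exact hd.2.2 r (by omega)

lemma isCell_of_comp (hp0 : 0 < p) {d c : Idx} (h1 : c.2.1 < p ^ c.1) (h2 : c.2.2 < p ^ c.1)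
    (h : IsCell p (comp p d c)) : IsCell p c := by
  refine ⟨h1, h2, fun k hk => ?_⟩
  have := h.2.2 k (by simp only [comp]; omega)
  simp only [comp] at this
  rwa [comp_digit_lt hp0 _ _ hk, comp_digit_lt hp0 _ _ hk] at this

/-- A grid square meeting a coarser one is a subsquare of it. -/
lemma exists_comp (hp0 : 0 < p) {d c : Idx} (hle : d.1 ≤ c.1) {z : ℂ} (hz : z ∈ osq p c)
    (hz' : z ∈ sq p d) : ∃ c', c'.2.1 < p ^ c'.1 ∧ c'.2.2 < p ^ c'.1 ∧ c = comp p d c' := by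
  obtain ⟨n, a, b⟩ := d
  obtain ⟨m, A, B⟩ := c
  obtain ⟨k, rfl⟩ : ∃ k, m = n + k := ⟨m - n, by simp only at hle; omega⟩
  obtain ⟨h1, h2, -⟩ := div_eq_of_osq_sq hp0 hz hz'
  have hk : 0 < p ^ k := by positivity
  refine ⟨(k, A % p ^ k, B % p ^ k), Nat.mod_lt _ hk, Nat.mod_lt _ hk, ?_⟩
  simp only [comp, ← h1, ← h2, Nat.div_add_mod]

lemma sim_mem_carpet_iff (hp : 3 ≤ p) (hop : Odd p) {d : Idx} (hd : IsCell p d) {z : ℂ}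
    (hz : z ∈ unitSq) : sim p d z ∈ sierpinskiCarpet p ↔ z ∈ sierpinskiCarpet p := by
  have hp0 : 0 < p := by omega
  have hsq : sim p d z ∈ sq p d := (sim_mem_sq hp0).2 hz
  have hunit : sim p d z ∈ unitSq := by
    have := sq_subset_of_div hp0 0 d.1 d.2.1 d.2.2 (by rw [zero_add]; exact hsq)
    rwa [Nat.div_eq_of_lt hd.1, Nat.div_eq_of_lt hd.2.1, sq_zero] at this
  constructor
  · intro h
    by_contra hcon
    obtain ⟨c, hc, hzc⟩ := exists_cell_of_not_mem hp hop hz hcon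
    refine ((mem_carpet_iff hp hop _).1 h).2 (comp p d c) ?_
    rw [mid_comp]
    exact (sim_mem_osq_comp hp0).2 hzc
  · intro h
    by_contra hcon
    obtain ⟨c, hc, hzc⟩ := exists_cell_of_not_mem hp hop hunit hcon
    by_cases hle : d.1 ≤ c.1
    · obtain ⟨c', h1, h2, rfl⟩ := exists_comp hp0 hle
        (sq_mid_subset hp c (osq_subset_sq _ _ hzc)) hsq
      rw [mid_comp] at hzc
      exact ((mem_carpet_iff hp hop _).1 h).2 c' ((sim_mem_osq_comp hp0).1 hzc)
    · obtain ⟨n, a, b⟩ := d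
      obtain ⟨k, rfl⟩ : ∃ k, n = (c.1 + 1) + k := ⟨n - (c.1 + 1), by simp only at hle; omega⟩
      obtain ⟨h1, h2⟩ := div_eq_of_sq_osq hp0 hsq hzc
      refine hd.2.2 k (by simp only; omega) ?_
      simp only
      rw [h1, h2, Nat.mul_add_mod, Nat.mul_add_mod, Nat.mod_eq_of_lt (by omega)]
      exact ⟨rfl, rfl⟩

end comp

section rotation
variable {p : ℕ}

/-- Quarter turn of the unit square. -/
noncomputable def rot (z : ℂ) : ℂ := ⟨1 - z.im, z.re⟩

lemma rot_four (z : ℂ) : rot (rot (rot (rot z))) = z := by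
  apply Complex.ext <;> simp [rot]

lemma dist_rot (u v : ℂ) : dist (rot u) (rot v) = dist u v := by
  have e : rot u - rot v = Complex.I * (u - v) := by
    apply Complex.ext <;> simp [rot]
  rw [dist_eq_norm, e, norm_mul, Complex.norm_I, one_mul, dist_eq_norm]

lemma continuous_rot : Continuous rot :=
  (Isometry.of_dist_eq dist_rot).continuous

lemma rot_mem_carpet (hp : 3 ≤ p) (hop : Odd p) {z : ℂ} (hz : z ∈ sierpinskiCarpet p) :
    rot z ∈ sierpinskiCarpet p := by
  obtain ⟨⟨⟨h1, h2⟩, h3, h4⟩, hz'⟩ := (mem_carpet_iff hp hop z).1 hz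
  by_contra hcon
  obtain ⟨⟨n, a, b⟩, hc, ⟨g1, g2⟩, g3, g4⟩ := exists_cell_of_not_mem hp hop
    (z := rot z) ⟨⟨by simp only [rot]; linarith, by simp only [rot]; linarith⟩, h1, h2⟩ hcon
  refine hz' (n, b, p ^ n - 1 - a) ⟨⟨g3, g4⟩, ?_⟩
  have ha : a < p ^ n := hc.1
  have hcast : (((p * (p ^ n - 1 - a) + p / 2 : ℕ)) : ℝ) =
      (p:ℝ) ^ (n + 1) - 1 - ((p * a + p / 2 : ℕ) : ℝ) := by
    obtain ⟨r, hr⟩ : ∃ r, p ^ n = a + 1 + r := ⟨p ^ n - a - 1, by omega⟩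
    have e : p ^ n - 1 - a = r := by omega
    rw [e, pow_succ]
    have hr' : (p:ℝ) ^ n = a + 1 + r := by exact_mod_cast hr
    obtain ⟨m, hm⟩ := hop
    have hm2 : p / 2 = m := by omega
    rw [hr', hm2]
    push_cast
    have : (p:ℝ) = 2 * m + 1 := by exact_mod_cast hm
    rw [this]; ring
  simp only [mid, rot] at g1 g2 ⊢
  rw [hcast]
  constructor <;> linarith

lemma QSPair.rot {p q : ℕ} {F G : ℂ → ℂ} (h : QSPair p q F G) (hp : 3 ≤ p) (hop : Odd p) :
    QSPair p q (fun z => F (rot z)) (fun z => rot (rot (rot (G z)))) where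
  contF := h.contF.comp continuous_rot.continuousOn fun z hz => rot_mem_carpet hp hop hz
  contG := (continuous_rot.comp (continuous_rot.comp continuous_rot)).comp_continuousOn h.contG
  mapsF := fun z hz => h.mapsF (rot_mem_carpet hp hop hz)
  mapsG := fun z hz => rot_mem_carpet hp hop (rot_mem_carpet hp hop (rot_mem_carpet hp hop
    (h.mapsG hz)))
  leftInv := fun z hz => by
    rw [h.leftInv _ (rot_mem_carpet hp hop hz), rot_four]
  rightInv := fun z hz => by
    rw [rot_four, h.rightInv z hz]
  wqsF := fun t => by
    obtain ⟨T, hT, H⟩ := h.wqsF t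
    refine ⟨T, hT, fun u hu v hv w hw hd => H _ (rot_mem_carpet hp hop hu) _
      (rot_mem_carpet hp hop hv) _ (rot_mem_carpet hp hop hw) ?_⟩
    rwa [dist_rot, dist_rot]
  wqsG := fun t => by
    obtain ⟨T, hT, H⟩ := h.wqsG t
    refine ⟨T, hT, fun u hu v hv w hw hd => ?_⟩
    simp only [dist_rot]
    exact H u hu v hv w hw hd

/-- Up to rotation, a boundary point of the source lies on the bottom side. -/
lemma QSPair.exists_bottom {p q : ℕ} {F G : ℂ → ℂ} (h : QSPair p q F G) (hp : 3 ≤ p)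
    (hop : Odd p) {z : ℂ} (hz : z ∈ perO p none) :
    ∃ F' G' : ℂ → ℂ, QSPair p q F' G' ∧ ∃ x : ℝ, 0 ≤ x ∧ x < 1 ∧ F' ⟨x, 0⟩ = F z := by
  obtain ⟨⟨⟨h1, h2⟩, h3, h4⟩, hn⟩ := hz
  simp only [pow_zero, one_mul, Nat.cast_zero, zero_add] at h1 h2 h3 h4
  simp only [osq, pow_zero, one_mul, Nat.cast_zero, zero_add, mem_ofPred_eq] at hn
  have hr := h.rot hp hop
  have hrr := hr.rot hp hop
  have hrrr := hrr.rot hp hop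
  by_cases a1 : z.im = 0 ∧ z.re < 1
  · exact ⟨F, G, h, z.re, h1, a1.2, congrArg F (Complex.ext rfl a1.1.symm)⟩
  by_cases a2 : z.re = 1 ∧ z.im < 1
  · exact ⟨_, _, hr, z.im, h3, a2.2, congrArg F (by apply Complex.ext <;> simp [Carpet.rot, a2.1])⟩
  by_cases a3 : z.im = 1 ∧ 0 < z.re
  · exact ⟨_, _, hrr, 1 - z.re, by linarith, by linarith,
      congrArg F (by apply Complex.ext <;> simp [Carpet.rot, a3.1])⟩
  by_cases a4 : z.re = 0 ∧ 0 < z.im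
  · exact ⟨_, _, hrrr, 1 - z.im, by linarith, by linarith,
      congrArg F (by apply Complex.ext <;> simp [Carpet.rot, a4.1])⟩
  exfalso
  refine hn ⟨⟨?_, ?_⟩, ?_, ?_⟩ <;> by_contra hh <;> grind

end rotation

/-- The cell directly above a hole. -/
lemma isCell_above {q : ℕ} (hq : 3 ≤ q) {c : Idx} (hc : IsCell q c) :
    IsCell q (c.1 + 1, q * c.2.1 + q / 2, q * c.2.2 + q / 2 + 1) := by
  have hm := mid_bounds hq
  have h1 : q * c.2.2 + q / 2 + 1 < q ^ (c.1 + 1) := by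
    have : q * (c.2.2 + 1) ≤ q * q ^ c.1 := Nat.mul_le_mul_left _ hc.2.1
    rw [mul_add, ← pow_succ'] at this
    show q * c.2.2 + q / 2 + 1 < q ^ (c.1 + 1)
    omega
  refine ⟨mul_add_mid_lt hq hc.1, h1, fun k hk => ?_⟩
  cases k with
  | zero =>
    simp only [pow_zero, Nat.div_one, add_assoc, Nat.mul_add_mod]
    rw [Nat.mod_eq_of_lt hm.2]
    omega
  | succ k =>
    have e : (q * c.2.2 + q / 2 + 1) / q ^ (k + 1) = c.2.2 / q ^ k := by
      rw [pow_succ', ← Nat.div_div_eq_div_mul, add_assoc, Nat.mul_add_div (by omega),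
        Nat.div_eq_of_lt hm.2, add_zero]
    simp only at hk ⊢
    rw [mul_add_mid_div hq, e]
    exact hc.2.2 k (by omega)

/-- Every peripheral square contains, near a suitable point, the bottom side of a cell that covers
a neighbourhood of that point in the carpet. -/
lemma exists_good_cell {q : ℕ} (hq : 3 ≤ q) (hoq : Odd q) {e : Option Idx} (he : ValidO q e) :
    ∃ d, IsCell q d ∧ (e ≠ none → 0 < d.2.2) ∧ ∃ w ∈ perO q e, ∃ ρ > 0,
      ∀ v ∈ sierpinskiCarpet q, dist v w < ρ → unsim q d v ∈ unitSq ∧ (unsim q d v).im < 1 ∧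
        (v ∈ perO q e → (unsim q d v).im = 0) := by
  have hq0 : 0 < q := by omega
  have near : ∀ (d : Idx) (v : ℂ), dist v (sim q d ⟨1 / 2, 0⟩) < 1 / 2 / (q:ℝ) ^ d.1 →
      |(unsim q d v).re - 1 / 2| < 1 / 2 ∧ |(unsim q d v).im| < 1 / 2 := by
    intro d v h
    rw [lt_div_iff₀' (by positivity), ← dist_unsim hq0, unsim_sim hq0] at h
    have h1 := (abs_re_sub_le_dist _ _).trans_lt h
    have h2 := (abs_im_sub_le_dist _ _).trans_lt h
    simp only [sub_zero] at h2
    exact ⟨h1, h2⟩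
  cases e with
  | none =>
    refine ⟨(0, 0, 0), isCell_zero q, fun h => absurd rfl h, sim q (0, 0, 0) ⟨1 / 2, 0⟩, ?_,
      1 / 2 / (q:ℝ) ^ (0, 0, 0).1, by positivity, fun v hv hd => ?_⟩
    · refine ⟨(sim_mem_sq hq0).2 ?_, fun h => ?_⟩
      · constructor <;> constructor <;> norm_num
      · simp [osq, sim] at h
    · obtain ⟨h1, h2⟩ := near _ _ hd
      have e1 : unsim q (0, 0, 0) v = v := by apply Complex.ext <;> simp [unsim]
      rw [e1] at h1 h2 ⊢
      rw [abs_lt] at h1 h2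
      have hu := ((mem_carpet_iff hq hoq v).1 hv).1
      refine ⟨hu, by linarith, fun hb => ?_⟩
      by_contra hne
      have hpos : 0 < v.im := lt_of_le_of_ne hu.2.1 (Ne.symm hne)
      refine hb.2 ?_
      simp only [osq, pow_zero, one_mul, Nat.cast_zero, zero_add, mem_ofPred_eq]
      exact ⟨⟨by linarith, by linarith⟩, hpos, by linarith⟩
  | some c =>
    set d : Idx := (c.1 + 1, q * c.2.1 + q / 2, q * c.2.2 + q / 2 + 1) with hd
    have hu : ∀ v, (q:ℝ) ^ (c.1 + 1) * v.re = (unsim q d v).re + ((q * c.2.1 + q / 2 : ℕ) : ℝ) ∧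
        (q:ℝ) ^ (c.1 + 1) * v.im = (unsim q d v).im + ((q * c.2.2 + q / 2 : ℕ) : ℝ) + 1 := by
      intro v
      simp only [unsim, hd]
      constructor <;> push_cast <;> ring
    refine ⟨d, isCell_above hq he, fun _ => by simp [hd], sim q d ⟨1 / 2, 0⟩, ?_,
      1 / 2 / (q:ℝ) ^ d.1, by positivity, fun v hv hd' => ?_⟩
    · have h := hu (sim q d ⟨1 / 2, 0⟩)
      rw [unsim_sim hq0] at h
      refine ⟨?_, fun h' => ?_⟩
      · simp only [sq, mid, mem_ofPred_eq, h.1, h.2]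
        refine ⟨⟨?_, ?_⟩, ?_, ?_⟩ <;> linarith
      · simp only [osq, mid, mem_ofPred_eq, h.1, h.2] at h'
        linarith [h'.2.2]
    · obtain ⟨h1, h2⟩ := near _ _ hd'
      rw [abs_lt] at h1 h2
      have h := hu v
      have him : 0 ≤ (unsim q d v).im := by
        by_contra hneg
        refine ((mem_carpet_iff hq hoq v).1 hv).2 c ?_
        simp only [osq, mid, mem_ofPred_eq, h.1, h.2]
        refine ⟨⟨?_, ?_⟩, ?_, ?_⟩ <;> linarith
      refine ⟨⟨⟨by linarith, by linarith⟩, him, by linarith⟩, by linarith, fun hb => ?_⟩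
      have h3 := hb.1.2.2
      simp only [mid] at h3
      rw [h.2] at h3
      linarith

/-- A small bottom cell containing a given boundary point. -/
lemma exists_bottom_cell {p : ℕ} (hp : 3 ≤ p) {x r : ℝ} (hx0 : 0 ≤ x) (hx1 : x < 1)
    (hr : 0 < r) : ∃ t : Idx, IsCell p t ∧ t.2.2 = 0 ∧ (⟨x, 0⟩ : ℂ) ∈ sq p t ∧
      2 * (1 / (p:ℝ) ^ t.1) < r := by
  have hp0 : 0 < p := by omega
  have hpr : (1:ℝ) < p := by exact_mod_cast (by omega : 1 < p)
  obtain ⟨k, hk⟩ := exists_pow_lt_of_lt_one (half_pos hr) (inv_lt_one_of_one_lt₀ hpr)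
  have hP : (0:ℝ) < (p:ℝ) ^ k := by positivity
  have h0 : 0 ≤ (p:ℝ) ^ k * x := by positivity
  refine ⟨(k, ⌊(p:ℝ) ^ k * x⌋₊, 0), isCell_bottom hp ?_, rfl, ?_, ?_⟩
  · rw [Nat.floor_lt h0]
    push_cast
    nlinarith
  · refine ⟨⟨Nat.floor_le h0, (Nat.lt_floor_add_one _).le⟩, ?_, ?_⟩ <;> simp
  · rw [inv_pow, ← one_div] at hk
    linarith

lemma QSPair.injF {p q : ℕ} {F G : ℂ → ℂ} (h : QSPair p q F G) :
    InjOn F (sierpinskiCarpet p) := fun x hx y hy hxy => by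
  rw [← h.leftInv x hx, ← h.leftInv y hy, hxy]

section
variable {p q : ℕ} {F G : ℂ → ℂ} {t d : Idx} {e : Option Idx}

lemma mem_unitSq_of_carpet (hp : 3 ≤ p) (hop : Odd p) {z : ℂ} (hz : z ∈ sierpinskiCarpet p) :
    z ∈ unitSq := ((mem_carpet_iff hp hop z).1 hz).1

lemma sim_mem_perO_none (hz : t.2.2 = 0) {z : ℂ} (him : z.im = 0)
    (hs : sim p t z ∈ unitSq) : sim p t z ∈ perO p none := by
  refine ⟨by rw [sq_zero]; exact hs, fun h => ?_⟩
  have := h.2.1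
  simp [sim, hz, him] at this

/-- Images of holes of the small source cell are holes of the target cell. -/
lemma exists_hole_image (hp : 3 ≤ p) (hop : Odd p) (hq : 3 ≤ q) (hoq : Odd q)
    (h : QSPair p q F G) (ht : IsCell p t)
    (hd0 : e ≠ none → 0 < d.2.2) (hFe : F '' perO p none = perO q e)
    (hin : ∀ z ∈ sierpinskiCarpet p, unsim q d (F (sim p t z)) ∈ unitSq ∧
      (unsim q d (F (sim p t z))).im < 1) {c : Idx} (hc : IsCell p c) :
    ∃ c', IsCell q c' ∧ (fun z => unsim q d (F (sim p t z))) '' per p c = per q c' := by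
  have hp0 : 0 < p := by omega
  have hq0 : 0 < q := by omega
  have hcc := isCell_comp hp0 ht hc
  obtain ⟨e₂, he₂, hFe₂⟩ := h.image_perO hp hop hq hoq (d := some (comp p t c)) hcc
  have hpre : ∀ v ∈ perO q e₂, ∃ z ∈ per p c, F (sim p t z) = v := by
    intro v hv
    rw [← hFe₂] at hv
    obtain ⟨y, hy, rfl⟩ := hv
    refine ⟨unsim p t y, ?_, by rw [sim_unsim hp0]⟩
    rw [← sim_mem_per_comp hp0 (d := t), sim_unsim hp0]
    exact hy
  have hloc : ∀ v ∈ perO q e₂, unsim q d v ∈ unitSq ∧ (unsim q d v).im < 1 := by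
    intro v hv
    obtain ⟨z, hz, rfl⟩ := hpre v hv
    exact hin z (per_subset_carpet hp hop hc hz)
  cases e₂ with
  | none =>
    exfalso
    have h0 : (0:ℂ) ∈ perO q none := by
      refine ⟨by simp [sq], fun h => ?_⟩
      simp [osq] at h
    have h1 := (hloc 0 h0).1.2.1
    by_cases hen : e = none
    · subst hen
      obtain ⟨z, hz, hz0⟩ := hpre 0 h0
      rw [← hFe] at h0
      obtain ⟨y, hy, hy0⟩ := h0
      have hmem : sim p t z ∈ perO p (some (comp p t c)) := (sim_mem_per_comp hp0).2 hz
      have hyz : sim p t z = y := h.injF (perO_subset hp hop (d := some (comp p t c)) hcc hmem)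
        (perO_subset hp hop (d := none) trivial hy) (hz0.trans hy0.symm)
      have := perO_disjoint hp (d := some (comp p t c)) (d' := none) hcc trivial hmem (hyz ▸ hy)
      exact absurd this (by simp)
    · have := hd0 hen
      simp only [unsim, Complex.zero_im, mul_zero, zero_sub, Left.nonneg_neg_iff] at h1
      have h2 : (0:ℝ) < d.2.2 := by exact_mod_cast this
      linarith
  | some c₂ =>
    have hc₂ : IsCell q c₂ := he₂
    have hle : d.1 ≤ c₂.1 := by
      by_contra hlt
      have hs0 := hs_pos hq0 c₂
      have hco := corner_mem_per hq0 c₂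
      have htop : (⟨hx q c₂, hy q c₂ + hs q c₂⟩ : ℂ) ∈ per q c₂ := by
        rw [per, mem_sdiff, mem_sq_mid_iff hq0, mem_osq_mid_iff hq0]
        simp [hs0.le]
      have h1 := (hloc _ hco).1.2.1
      have h2 := (hloc _ htop).2
      simp only [unsim, corner] at h1 h2
      have h3 : 1 ≤ (q:ℝ) ^ d.1 * hs q c₂ := by
        rw [hs, mul_one_div, one_le_div (by positivity)]
        exact pow_le_pow_right₀ (by exact_mod_cast hq0) (by omega)
      nlinarith
    obtain ⟨c', h1, h2, rfl⟩ := exists_comp hq0 hle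
      (sq_mid_subset hq c₂ (corner_mem_per hq0 c₂).1) (d := d) (by
        have := (hloc _ (corner_mem_per hq0 c₂)).1
        rwa [← sim_mem_sq hq0 (d := d), sim_unsim hq0] at this)
    refine ⟨c', isCell_of_comp hq0 h1 h2 hc₂, ?_⟩
    ext v
    constructor
    · rintro ⟨z, hz, rfl⟩
      have : F (sim p t z) ∈ perO q (some (comp q d c')) := by
        rw [← hFe₂]
        exact mem_image_of_mem F ((sim_mem_per_comp hp0).2 hz)
      rw [← sim_unsim hq0 d (F (sim p t z))] at this
      exact (sim_mem_per_comp hq0).1 this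
    · intro hv
      obtain ⟨z, hz, hz'⟩ := hpre (sim q d v) ((sim_mem_per_comp hq0).2 hv)
      exact ⟨z, hz, by simp only [hz', unsim_sim hq0]⟩

/-- Rescaling a homeomorphism near a boundary point. -/
lemma exists_setup_of_local (hp : 3 ≤ p) (hop : Odd p) (hq : 3 ≤ q) (hoq : Odd q)
    (h : QSPair p q F G) (ht : IsCell p t) (ht0 : t.2.2 = 0) (hd : IsCell q d)
    (hd0 : e ≠ none → 0 < d.2.2) (hFe : F '' perO p none = perO q e)
    (hin : ∀ z ∈ sierpinskiCarpet p, unsim q d (F (sim p t z)) ∈ unitSq ∧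
      (unsim q d (F (sim p t z))).im < 1 ∧
      (F (sim p t z) ∈ perO q e → (unsim q d (F (sim p t z))).im = 0)) :
    ∃ g τ, Setup p q g τ := by
  classical
  have hp0 : 0 < p := by omega
  have hq0 : 0 < q := by omega
  have hPt : (0:ℝ) < (p:ℝ) ^ t.1 := by positivity
  have hQd : (0:ℝ) < (q:ℝ) ^ d.1 := by positivity
  have hsim : ∀ z ∈ sierpinskiCarpet p, sim p t z ∈ sierpinskiCarpet p := fun z hz =>
    (sim_mem_carpet_iff hp hop ht (mem_unitSq_of_carpet hp hop hz)).2 hz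
  have hhole := fun (c : Idx) (hc : IsCell p c) => exists_hole_image hp hop hq hoq h ht hd0 hFe
    (fun z hz => ⟨(hin z hz).1, (hin z hz).2.1⟩) hc
  choose! τ hτ1 hτ2 using hhole
  have hbot : ∀ z ∈ sierpinskiCarpet p, z.im = 0 → (unsim q d (F (sim p t z))).im = 0 := by
    intro z hz hz0
    refine (hin z hz).2.2 ?_
    rw [← hFe]
    exact mem_image_of_mem F
      (sim_mem_perO_none ht0 hz0 (mem_unitSq_of_carpet hp hop (hsim z hz)))
  refine ⟨fun z => unsim q d (F (sim p t z)), τ, ?_⟩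
  refine
    { maps := fun z hz => ?_
      inj := fun u hu v hv huv => ?_
      cont := (continuous_unsim q d).comp_continuousOn
        (h.contF.comp (continuous_sim p t).continuousOn hsim)
      wqs := fun s => ?_
      wqsInv := fun s => ?_
      bot := hbot
      top := fun z hz => (hin z hz).2.1
      hole := fun c hc => ⟨hτ1 c hc, hτ2 c hc⟩
      hinv := fun c' hc' => ?_
      hopen := ?_ }
  · rw [← sim_mem_carpet_iff hq hoq hd (hin z hz).1, sim_unsim hq0]
    exact h.mapsF (hsim z hz)
  · have h1 := congrArg (sim q d) huv
    simp only [sim_unsim hq0] at h1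
    have h2 := congrArg (unsim p t) (h.injF (hsim u hu) (hsim v hv) h1)
    rwa [unsim_sim hp0, unsim_sim hp0] at h2
  · obtain ⟨T, hT, H⟩ := h.wqsF s
    refine ⟨T, hT, fun u hu v hv w hw hd => ?_⟩
    have h1 := H _ (hsim u hu) _ (hsim v hv) _ (hsim w hw) (by
      rw [dist_sim hp0 t u v, dist_sim hp0 t u w] at hd
      refine le_of_mul_le_mul_left ?_ hPt
      linarith)
    rw [dist_unsim hq0, dist_unsim hq0]
    linarith [mul_le_mul_of_nonneg_left h1 hQd.le]
  · obtain ⟨T, hT, H⟩ := h.wqsG s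
    refine ⟨T, hT, fun u hu v hv w hw hd => ?_⟩
    have h1 := H _ (h.mapsF (hsim u hu)) _ (h.mapsF (hsim v hv)) _ (h.mapsF (hsim w hw)) (by
      rw [dist_unsim hq0, dist_unsim hq0] at hd
      refine le_of_mul_le_mul_left ?_ hQd
      linarith)
    rw [h.leftInv _ (hsim u hu), h.leftInv _ (hsim v hv), h.leftInv _ (hsim w hw)] at h1
    rw [dist_sim hp0 t u v, dist_sim hp0 t u w]
    linarith [mul_le_mul_of_nonneg_left h1 hPt.le]
  · by_contra! hcon
    obtain ⟨hne, z, hz, hz1, hz2, hz3, hgz⟩ := hcon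
    have hzpos : 0 < z.im := by
      refine lt_of_le_of_ne (mem_unitSq_of_carpet hp hop hz).2.1 fun h0 => ?_
      have h1 := hbot z hz h0.symm
      have h2 := ((mem_sq_mid_iff hq0).1 hgz.1).2.1
      linarith [hs_le_hy hq c', hs_pos hq0 c']
    have hosq : sim p t z ∈ osq p t := by
      have : sim p t z ∈ osq p (comp p t (0, 0, 0)) := by
        refine (sim_mem_osq_comp hp0).2 ?_
        simp only [osq, pow_zero, one_mul, Nat.cast_zero, zero_add, mem_ofPred_eq]
        exact ⟨⟨hz1, hz2⟩, hzpos, hz3⟩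
      simpa [comp] using this
    have hcc := isCell_comp hq0 hd hc'
    obtain ⟨e₃, he₃, hGe₃⟩ := h.symm.image_perO hq hoq hp hop (d := some (comp q d c')) hcc
    have hmem : sim p t z ∈ perO p e₃ := by
      rw [← hGe₃]
      refine ⟨F (sim p t z), ?_, h.leftInv _ (hsim z hz)⟩
      rw [← sim_mem_per_comp hq0 (d := d), sim_unsim hq0] at hgz
      exact hgz
    obtain ⟨k, a, b⟩ := t
    cases e₃ with
    | none =>
      have := div_eq_of_osq_sq hp0 (n := 0) (k := k) (by rw [zero_add]; exact hosq) hmem.1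
      exact hmem.2 this.2.2
    | some c₃ =>
      have hc₃ : IsCell p c₃ := he₃
      by_cases hle : k ≤ c₃.1
      · obtain ⟨c, h1, h2, rfl⟩ := exists_comp hp0 (d := (k, a, b)) hle
          (sq_mid_subset hp c₃ hmem.1) (osq_subset_sq _ _ hosq)
        have hc := isCell_of_comp hp0 h1 h2 hc₃
        refine hne c hc (mid_eq_of_mem hq (hτ1 c hc) hc' ?_ hgz.1)
        have : unsim q d (F (sim p (k, a, b) z)) ∈ per q (τ c) := by
          rw [← hτ2 c hc]
          exact ⟨z, (sim_mem_per_comp hp0).1 hmem, rfl⟩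
        exact this.1
      · obtain ⟨r, rfl⟩ : ∃ r, k = (c₃.1 + 1) + r := ⟨k - (c₃.1 + 1), by omega⟩
        exact hmem.2 (div_eq_of_osq_sq hp0 hosq hmem.1).2.2
  · set O : Set ℂ := {y | 0 < (unsim p t y).re ∧ (unsim p t y).re < 1 ∧ (unsim p t y).im < 1}
    have hO : IsOpen O := by
      have hc := continuous_unsim p t
      exact (isOpen_lt continuous_const (Complex.continuous_re.comp hc)).inter
        ((isOpen_lt (Complex.continuous_re.comp hc) continuous_const).inter
          (isOpen_lt (Complex.continuous_im.comp hc) continuous_const))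
    obtain ⟨U, hU, hGU⟩ := continuousOn_iff'.1 h.contG O hO
    refine ⟨sim q d ⁻¹' U, hU.preimage (continuous_sim q d), ?_⟩
    ext v
    constructor
    · rintro ⟨z, ⟨hz, hz1⟩, rfl⟩
      refine ⟨?_, ?_⟩
      · have : F (sim p t z) ∈ G ⁻¹' O ∩ sierpinskiCarpet q := by
          refine ⟨?_, h.mapsF (hsim z hz)⟩
          rw [mem_preimage, h.leftInv _ (hsim z hz)]
          simp only [O, mem_ofPred_eq, unsim_sim hp0]
          exact hz1
        rw [hGU] at this
        rw [mem_preimage, sim_unsim hq0]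
        exact this.1
      · rw [← sim_mem_carpet_iff hq hoq hd (hin z hz).1, sim_unsim hq0]
        exact h.mapsF (hsim z hz)
    · rintro ⟨hvU, hv⟩
      have hsv := (sim_mem_carpet_iff hq hoq hd (mem_unitSq_of_carpet hq hoq hv)).2 hv
      have : sim q d v ∈ G ⁻¹' O ∩ sierpinskiCarpet q := by
        rw [hGU]
        exact ⟨hvU, hsv⟩
      obtain ⟨h1, h2, h3⟩ : 0 < (unsim p t (G (sim q d v))).re ∧
        (unsim p t (G (sim q d v))).re < 1 ∧ (unsim p t (G (sim q d v))).im < 1 := this.1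
      have hG := h.mapsG hsv
      have h4 : 0 ≤ (unsim p t (G (sim q d v))).im := by
        have := (mem_unitSq_of_carpet hp hop hG).2.1
        simp only [unsim, ht0, Nat.cast_zero, sub_zero]
        positivity
      refine ⟨unsim p t (G (sim q d v)), ⟨?_, h1, h2, h3⟩, ?_⟩
      · rw [← sim_mem_carpet_iff hp hop ht ⟨⟨h1.le, h2.le⟩, h4, h3.le⟩, sim_unsim hp0]
        exact hG
      · simp only [sim_unsim hp0]
        rw [h.rightInv _ hsv, unsim_sim hq0]

lemma QSPair.exists_pow (hp : 3 ≤ p) (hop : Odd p) (hq : 3 ≤ q) (hoq : Odd q)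
    (h : QSPair p q F G) : ∃ j : ℕ, p = q ^ j := by
  have hp0 : 0 < p := by omega
  obtain ⟨e, he, hFe⟩ := h.image_perO hp hop hq hoq (d := none) trivial
  obtain ⟨d, hd, hd0, w, hw, ρ, hρ, hgood⟩ := exists_good_cell hq hoq he
  obtain ⟨z₀, hz₀, hz₀w⟩ : w ∈ F '' perO p none := hFe ▸ hw
  obtain ⟨F₁, G', h', x, hx0, hx1, hx⟩ := h.exists_bottom hp hop hz₀
  rw [hz₀w] at hx
  have hxO : (⟨x, 0⟩ : ℂ) ∈ perO p none := by
    refine ⟨?_, fun hh => ?_⟩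
    · rw [sq_zero]; exact ⟨⟨hx0, hx1.le⟩, by simp⟩
    · simp [osq] at hh
  have hxS := perO_subset hp hop (d := none) trivial hxO
  have hFe' : F₁ '' perO p none = perO q e := by
    obtain ⟨e', he', hFe'⟩ := h'.image_perO hp hop hq hoq (d := none) trivial
    have : w ∈ perO q e' := by rw [← hFe', ← hx]; exact mem_image_of_mem F₁ hxO
    rw [hFe', perO_disjoint hq he' he this hw]
  obtain ⟨r, hr, hcont⟩ := Metric.continuousOn_iff.1 h'.contF _ hxS ρ hρ
  obtain ⟨t, ht, ht0, hxt, htr⟩ := exists_bottom_cell hp hx0 hx1 hr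
  obtain ⟨g, τ, S⟩ := exists_setup_of_local hp hop hq hoq h' ht ht0 hd hd0 hFe' (fun z hz => by
    have hu := mem_unitSq_of_carpet hp hop hz
    have hzS := (sim_mem_carpet_iff hp hop ht hu).2 hz
    have h1 := hcont _ hzS ((dist_le_of_mem_sq hp0 ((sim_mem_sq hp0).2 hu) hxt).trans_lt htr)
    rw [hx] at h1
    exact hgood _ (h'.mapsF hzS) h1)
  exact S.exists_pow hp hop hq hoq

end

/-- Carpets related by a quasisymmetric homeomorphism have the same parameter. -/
theorem eq_of_qsPair {p q : ℕ} {F G : ℂ → ℂ} (hp : 3 ≤ p) (hop : Odd p) (hq : 3 ≤ q)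
    (hoq : Odd q) (h : QSPair p q F G) : p = q := by
  obtain ⟨i, hi⟩ := h.exists_pow hp hop hq hoq
  obtain ⟨j, hj⟩ := h.symm.exists_pow hq hoq hp hop
  refine le_antisymm ?_ ?_
  · rw [hj]
    refine Nat.le_self_pow ?_ p
    rintro rfl
    rw [pow_zero] at hj
    omega
  · rw [hi]
    refine Nat.le_self_pow ?_ q
    rintro rfl
    rw [pow_zero] at hi
    omega

end Carpet

/-- **Quasisymmetric non-equivalence of the standard carpets** (Theorem 1.3).
For odd `p, q ≥ 3`, there is a quasisymmetric homeomorphism from `S_p` onto `S_q`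
if and only if `p = q`. -/
theorem Sp_qs_equivalent_Sq_iff_eq (p q : ℕ) (hp : 3 ≤ p) (hq : 3 ≤ q)
    (hop : Odd p) (hoq : Odd q) :
    (∃ f : ↥(sierpinskiCarpet p) ≃ₜ ↥(sierpinskiCarpet q), IsQSMap f) ↔ p = q := by
  constructor
  · rintro ⟨f, hf⟩
    obtain ⟨F, G, h⟩ := Carpet.exists_qsPair f hf
    exact Carpet.eq_of_qsPair hp hop hq hoq h
  · rintro rfl
    refine ⟨Homeomorph.refl _, id, ⟨continuousOn_id, strictMonoOn_id, rfl, surjOn_id _⟩, ?_⟩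
    intro u v w huw
    change dist u v ≤ dist u v / dist u w * dist u w
    rw [div_mul_cancel₀ _ (dist_pos.2 huw).ne']
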